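/- Suppose K = K_1, the residue field of F has exactly p elements (q = p), and sigma is a weight of K with chi_sigma different from chi_sigma^s; let sigma^s be the unique irreducible subrepresentation of the finite principal series Ind_B^{Gamma_K} chi_sigma (which has length two with unique irreducible subrepresentation sigma^s and unique irreducible quotient sigma). Then the universal quotient (ind_K^G sigma)/(T) contains the weight sigma^s: more precisely, the K-subrepresentation generated by the (nonzero) image of f_1 in (ind_K^G sigma)/(T) is isomorphic to sigma^s. -/

import Mathlib

open scoped Classical

noncomputable section

namespace U21

/-- The arithmetic setting: `E` is the unramified quadratic extension of a non-archimedean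
local field `F` of odd residue characteristic `p`, with residue field of `F` of cardinality
`q = p ^ fdeg`.  The field `E` is encoded through its valuation subring `O = o_E`, a
uniformizer `ϖ`, the maximal ideal `mI` (so that `p_E^k` is `ϖ ^ k * O`), and the nontrivial
`F`-automorphism `conj` of `E` (which induces the `q`-power Frobenius on the residue field
of `E`, of cardinality `q ^ 2`). -/
structure Setting where
  p : ℕ
  q : ℕ
  fdeg : ℕ
  hp : p.Prime
  hodd : p ≠ 2
  hfdeg : 0 < fdeg
  hq : q = p ^ fdeg
  E : Type
  [fieldE : Field E]
  conj : E →+* E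
  conj_invol : ∀ x, conj (conj x) = x
  conj_ne : conj ≠ RingHom.id E
  O : Subring E
  val_ring : ∀ x : E, x ≠ 0 → x ∈ O ∨ x⁻¹ ∈ O
  conj_O : ∀ x, x ∈ O → conj x ∈ O
  ϖ : E
  unif_mem : ϖ ∈ O
  unif_ne : ϖ ≠ 0
  unif_conj : conj ϖ = ϖ
  unif_not_unit : ¬ IsUnit (⟨ϖ, unif_mem⟩ : O)
  disc : ∀ x : E, x ≠ 0 → ∃ (n : ℤ) (u : Oˣ), x = (u : O) * ϖ ^ n
  mI : Ideal O
  hmI : ∀ x : O, x ∈ mI ↔ ∃ y ∈ O, (x : E) = ϖ * y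
  [fin_res : Fintype (O ⧸ mI)]
  card_res : Fintype.card (O ⧸ mI) = q ^ 2
  res_frob : ∀ x : O, Ideal.Quotient.mk mI ⟨conj x, conj_O x x.2⟩ = (Ideal.Quotient.mk mI x) ^ q
  complete : ∀ a : ℕ → E,
    (∀ k : ℕ, ∃ N, ∀ m ≥ N, ∀ n ≥ N, ∃ w ∈ O, a m - a n = ϖ ^ k * w) →
    ∃ L : E, ∀ k : ℕ, ∃ N, ∀ n ≥ N, ∃ w ∈ O, a n - L = ϖ ^ k * w

attribute [instance] Setting.fieldE Setting.fin_res

namespace Setting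

variable (S : Setting)

/-- 3×3 matrices over `E`. -/
abbrev M3 := Matrix (Fin 3) (Fin 3) S.E

/-- The antidiagonal matrix `β` of the Hermitian form. -/
def betaM : S.M3 := !![0,0,1;0,1,0;1,0,0]

/-- The fractional ideal `p_E ^ k ⊆ E` (for `k : ℤ`). -/
def pE (k : ℤ) : Set S.E := {z | ∃ w ∈ S.O, z = S.ϖ ^ k * w}

/-- The unramified unitary group `G = U(2,1)(E/F)`, as a subgroup of `GL₃(E)`:
`g ∈ G` iff `g.transpose * β * conj g = β`. -/
def Gsub : Subgroup (Matrix.GeneralLinearGroup (Fin 3) S.E) where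
  carrier := {g | ((g : S.M3)).transpose * S.betaM * ((g : S.M3).map S.conj) = S.betaM}
  one_mem' := by
    simp [Matrix.map_one (⇑S.conj) (map_zero S.conj) (map_one S.conj)]
  mul_mem' := by
    intro a b ha hb
    simp only [Set.mem_setOf_eq, Units.val_mul, Matrix.transpose_mul, Matrix.map_mul] at ha hb ⊢
    calc ((b : S.M3)).transpose * ((a : S.M3)).transpose * S.betaM * ((a : S.M3).map S.conj * (b : S.M3).map S.conj)
        = ((b : S.M3)).transpose * (((a : S.M3)).transpose * S.betaM * (a : S.M3).map S.conj) * ((b : S.M3).map S.conj) := by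
          simp only [mul_assoc]
      _ = S.betaM := by rw [ha]; exact hb
  inv_mem' := by
    intro a ha
    simp only [Set.mem_setOf_eq] at ha ⊢
    have hA : IsUnit ((a : S.M3)) := a.isUnit
    have hdet : IsUnit ((a : S.M3)).det := (Matrix.isUnit_iff_isUnit_det _).mp hA
    have hAc : IsUnit (((a : S.M3)).map ⇑S.conj) := by
      rw [← RingHom.mapMatrix_apply]; exact hA.map _
    have hdetc : IsUnit ((((a : S.M3)).map ⇑S.conj).det) := (Matrix.isUnit_iff_isUnit_det _).mp hAc
    have hdetT : IsUnit ((((a : S.M3)).transpose).det) := by rw [Matrix.det_transpose]; exact hdet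
    have hmapinv : ((a : S.M3)⁻¹).map ⇑S.conj = (((a : S.M3)).map ⇑S.conj)⁻¹ := by
      symm
      apply Matrix.inv_eq_left_inv
      rw [← Matrix.map_mul, Matrix.nonsing_inv_mul _ hdet,
        Matrix.map_one (⇑S.conj) (map_zero S.conj) (map_one S.conj)]
    rw [Matrix.coe_units_inv, Matrix.transpose_nonsing_inv, hmapinv]
    conv_lhs => rw [← ha]
    calc (((a:S.M3)).transpose)⁻¹ * (((a:S.M3)).transpose * S.betaM * ((a:S.M3)).map ⇑S.conj) * (((a:S.M3)).map ⇑S.conj)⁻¹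
        = (((a:S.M3)).transpose)⁻¹ * ((a:S.M3)).transpose * S.betaM *
            (((a:S.M3)).map ⇑S.conj * (((a:S.M3)).map ⇑S.conj)⁻¹) := by simp only [mul_assoc]
      _ = S.betaM := by
          rw [Matrix.nonsing_inv_mul _ hdetT, Matrix.mul_nonsing_inv _ hdetc, one_mul, mul_one]

/-- The group `G = U(2,1)(E/F)`. -/
abbrev GG := ↥S.Gsub

/-- The matrix of an element of `G`. -/
def mat (g : S.GG) : S.M3 := ((g : Matrix.GeneralLinearGroup (Fin 3) S.E) : S.M3)

/-- The upper unipotent matrix `n(x,y)`. -/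
def nM (x y : S.E) : S.M3 := !![1, x, y; 0, 1, -S.conj x; 0, 0, 1]

/-- The lower unipotent matrix `n'(x,y)`. -/
def n'M (x y : S.E) : S.M3 := !![1, 0, 0; x, 1, 0; y, -S.conj x, 1]

/-- The diagonal matrix `h(x) = diag(x, -x̄x⁻¹, x̄⁻¹)`. -/
def hM (x : S.E) : S.M3 := !![x, 0, 0; 0, -S.conj x * x⁻¹, 0; 0, 0, (S.conj x)⁻¹]

/-- The subgroup `N` of `G` (unipotent radical of the upper triangular Borel), as a set. -/
def Nset : Set S.GG := {g | ∃ x y : S.E, x * S.conj x + y + S.conj y = 0 ∧ S.mat g = S.nM x y}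

/-- The subgroup `N_k = {n(x,y) : y ∈ p_E^k}`, as a set. -/
def Nk (k : ℤ) : Set S.GG :=
  {g | ∃ x y : S.E, x * S.conj x + y + S.conj y = 0 ∧ y ∈ S.pE k ∧ S.mat g = S.nM x y}

/-- The subgroup `N'` of `G`, as a set. -/
def N'set : Set S.GG := {g | ∃ x y : S.E, x * S.conj x + y + S.conj y = 0 ∧ S.mat g = S.n'M x y}

/-- The subgroup `N'_k = {n'(x,y) : y ∈ p_E^k}`, as a set. -/
def N'k (k : ℤ) : Set S.GG :=
  {g | ∃ x y : S.E, x * S.conj x + y + S.conj y = 0 ∧ y ∈ S.pE k ∧ S.mat g = S.n'M x y}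

/-- The diagonal subgroup `H` of `G`, as a set. -/
def Hset : Set S.GG := {g | ∃ a b c : S.E, S.mat g = !![a,0,0;0,b,0;0,0,c]}

/-- The hyperspecial maximal compact subgroup `K₀ = G ∩ GL₃(o_E)`, as a set. -/
def K0set : Set S.GG := {g | ∀ i j, S.mat g i j ∈ S.O}

/-- The special (non-hyperspecial) maximal compact subgroup `K₁`, as a set. -/
def K1set : Set S.GG :=
  {g | S.mat g 0 0 ∈ S.O ∧ S.mat g 0 1 ∈ S.O ∧ S.mat g 0 2 ∈ S.pE (-1) ∧
       S.mat g 1 0 ∈ S.pE 1 ∧ S.mat g 1 1 ∈ S.O ∧ S.mat g 1 2 ∈ S.O ∧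
       S.mat g 2 0 ∈ S.pE 1 ∧ S.mat g 2 1 ∈ S.pE 1 ∧ S.mat g 2 2 ∈ S.O}

/-- The Iwahori subgroup `I_{K₀}` (preimage of the Borel of `Γ_{K₀}`), as a set. -/
def IK0 : Set S.GG :=
  {g | g ∈ S.K0set ∧ S.mat g 1 0 ∈ S.pE 1 ∧ S.mat g 2 0 ∈ S.pE 1 ∧ S.mat g 2 1 ∈ S.pE 1}

/-- The pro-p Iwahori subgroup `I_{1,K₀}`, as a set. -/
def I1K0 : Set S.GG :=
  {g | g ∈ S.IK0 ∧ S.mat g 0 0 - 1 ∈ S.pE 1 ∧ S.mat g 1 1 - 1 ∈ S.pE 1 ∧ S.mat g 2 2 - 1 ∈ S.pE 1}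

/-- The opposite pro-p Iwahori subgroup `I'_{1,K₀}`, as a set. -/
def I1'K0 : Set S.GG :=
  {g | g ∈ S.K0set ∧ S.mat g 0 1 ∈ S.pE 1 ∧ S.mat g 0 2 ∈ S.pE 1 ∧ S.mat g 1 2 ∈ S.pE 1 ∧
       S.mat g 0 0 - 1 ∈ S.pE 1 ∧ S.mat g 1 1 - 1 ∈ S.pE 1 ∧ S.mat g 2 2 - 1 ∈ S.pE 1}

/-- The maximal normal pro-p subgroup `K₀¹` of `K₀` (principal congruence subgroup), as a set. -/
def Kone0 : Set S.GG := {g | ∀ i j, S.mat g i j - (1 : S.M3) i j ∈ S.pE 1}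

/-- The Iwahori subgroup `I_{K₁}`, as a set. -/
def IK1 : Set S.GG := {g | g ∈ S.K1set ∧ S.mat g 2 0 ∈ S.pE 2}

/-- The pro-p Iwahori subgroup `I_{1,K₁}`, as a set. -/
def I1K1 : Set S.GG :=
  {g | g ∈ S.IK1 ∧ S.mat g 0 0 - 1 ∈ S.pE 1 ∧ S.mat g 1 1 - 1 ∈ S.pE 1 ∧ S.mat g 2 2 - 1 ∈ S.pE 1}

/-- The opposite pro-p Iwahori subgroup `I'_{1,K₁}`, as a set. -/
def I1'K1 : Set S.GG :=
  {g | g ∈ S.K1set ∧ S.mat g 0 2 ∈ S.O ∧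
       S.mat g 0 0 - 1 ∈ S.pE 1 ∧ S.mat g 1 1 - 1 ∈ S.pE 1 ∧ S.mat g 2 2 - 1 ∈ S.pE 1}

/-- The maximal normal pro-p subgroup `K₁¹` of `K₁`, as a set. -/
def Kone1 : Set S.GG :=
  {g | g ∈ S.K1set ∧ S.mat g 0 2 ∈ S.O ∧ S.mat g 2 0 ∈ S.pE 2 ∧
       S.mat g 0 0 - 1 ∈ S.pE 1 ∧ S.mat g 1 1 - 1 ∈ S.pE 1 ∧ S.mat g 2 2 - 1 ∈ S.pE 1}

/-- The congruence subgroup of level `n` (used to express smoothness), as a set. -/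
def cong (n : ℕ) : Set S.GG := {g | ∀ i j, S.mat g i j - (1 : S.M3) i j ∈ S.pE n}

def alphaM : S.M3 := !![S.ϖ⁻¹, 0, 0; 0, 1, 0; 0, 0, S.ϖ]

def alphaMinv : S.M3 := !![S.ϖ, 0, 0; 0, 1, 0; 0, 0, S.ϖ⁻¹]

lemma alpha_mul_inv : S.alphaM * S.alphaMinv = 1 := by
  ext i j
  fin_cases i <;> fin_cases j <;>
    simp [alphaM, alphaMinv, Matrix.mul_apply, Fin.sum_univ_three, Matrix.one_apply,
      Matrix.vecHead, Matrix.vecTail, inv_mul_cancel₀ S.unif_ne, mul_inv_cancel₀ S.unif_ne]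

lemma alpha_inv_mul : S.alphaMinv * S.alphaM = 1 := by
  ext i j
  fin_cases i <;> fin_cases j <;>
    simp [alphaM, alphaMinv, Matrix.mul_apply, Fin.sum_univ_three, Matrix.one_apply,
      Matrix.vecHead, Matrix.vecTail, inv_mul_cancel₀ S.unif_ne, mul_inv_cancel₀ S.unif_ne]

def alphaU : Matrix.GeneralLinearGroup (Fin 3) S.E :=
  ⟨S.alphaM, S.alphaMinv, S.alpha_mul_inv, S.alpha_inv_mul⟩

lemma alphaU_mem : S.alphaU ∈ S.Gsub := by
  show ((S.alphaU : S.M3)).transpose * S.betaM * ((S.alphaU : S.M3).map S.conj) = S.betaM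
  have : (S.alphaU : S.M3) = S.alphaM := rfl
  rw [this]
  ext i j
  fin_cases i <;> fin_cases j <;>
    simp [alphaM, betaM, Matrix.mul_apply, Fin.sum_univ_three, Matrix.map_apply,
      Matrix.transpose_apply, Matrix.vecHead, Matrix.vecTail, map_inv₀, S.unif_conj,
      inv_mul_cancel₀ S.unif_ne, mul_inv_cancel₀ S.unif_ne]

/-- The element `α = diag(ϖ⁻¹, 1, ϖ)` of `G`. -/
def alphaE : S.GG := ⟨S.alphaU, S.alphaU_mem⟩

lemma beta_mul_beta : S.betaM * S.betaM = 1 := by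
  ext i j
  fin_cases i <;> fin_cases j <;>
    simp [betaM, Matrix.mul_apply, Fin.sum_univ_three, Matrix.one_apply,
      Matrix.vecHead, Matrix.vecTail]

def betaU : Matrix.GeneralLinearGroup (Fin 3) S.E :=
  ⟨S.betaM, S.betaM, S.beta_mul_beta, S.beta_mul_beta⟩

lemma betaU_mem : S.betaU ∈ S.Gsub := by
  show ((S.betaU : S.M3)).transpose * S.betaM * ((S.betaU : S.M3).map S.conj) = S.betaM
  have : (S.betaU : S.M3) = S.betaM := rfl
  rw [this]
  ext i j
  fin_cases i <;> fin_cases j <;>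
    simp [betaM, Matrix.mul_apply, Fin.sum_univ_three, Matrix.map_apply, Matrix.transpose_apply,
      Matrix.vecHead, Matrix.vecTail]

/-- The element `β` of `G`. -/
def betaE : S.GG := ⟨S.betaU, S.betaU_mem⟩

/-- The element `β' = β * α⁻¹` of `G`. -/
def betaPr : S.GG := S.betaE * S.alphaE⁻¹

/-- A finite set `U` is a set of representatives for the cosets `A/B`. -/
def IsReps (A B : Set S.GG) (U : Finset S.GG) : Prop :=
  (↑U : Set S.GG) ⊆ A ∧ ∀ a ∈ A, ∃! u, u ∈ U ∧ a⁻¹ * u ∈ B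

/-- The residue field `k_E` of `E`. -/
abbrev kE := S.O ⧸ S.mI

/-- The residue map `o_E → k_E`. -/
def resmap : S.O →+* S.kE := Ideal.Quotient.mk S.mI

/-- The group `L_{q³} = {(x,t) ∈ k_E² : x x̄ + t + t̄ = 0}` (where `x̄ = x^q`). -/
def Lbig : Set (S.kE × S.kE) := {z | z.1 * z.1 ^ S.q + z.2 + z.2 ^ S.q = 0}

/-- The group `L_q = {(0,t) ∈ k_E² : t + t̄ = 0}`. -/
def Lsmall : Set (S.kE × S.kE) := {z | z.1 = 0 ∧ z.2 + z.2 ^ S.q = 0}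

/-- `L_{q^t}` for `t ∈ {1,3}`. -/
def Lof (t : ℕ) : Set (S.kE × S.kE) := if t = 3 then S.Lbig else S.Lsmall

end Setting

/-- A choice of one of the two maximal compact open subgroups `K ∈ {K₀, K₁}` of `G`,
together with its maximal normal pro-p subgroup `K¹`, the (pro-p) Iwahori subgroups
`I_K ⊇ I_{1,K}`, the opposite pro-p Iwahori `I'_{1,K}`, the element
`β_K ∈ K ∩ {β, β'}`, and the integers `n_K, m_K, t_K`. -/
structure Chamber (S : Setting) where
  K : Subgroup S.GG
  KoneS : Set S.GG
  IK : Set S.GG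
  I1 : Set S.GG
  I1' : Set S.GG
  βK : S.GG
  nK : ℤ
  mK : ℤ
  tK : ℕ
  cases :
    ((K : Set S.GG) = S.K0set ∧ KoneS = S.Kone0 ∧ IK = S.IK0 ∧ I1 = S.I1K0 ∧ I1' = S.I1'K0 ∧
      βK = S.betaE ∧ nK = 0 ∧ mK = 1 ∧ tK = 3) ∨
    ((K : Set S.GG) = S.K1set ∧ KoneS = S.Kone1 ∧ IK = S.IK1 ∧ I1 = S.I1K1 ∧ I1' = S.I1'K1 ∧
      βK = S.betaPr ∧ nK = -1 ∧ mK = 2 ∧ tK = 1)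

namespace Chamber

variable {S : Setting} (C : Chamber S)

/-- `H₀ = H ∩ I_K`. -/
def H0 : Set S.GG := S.Hset ∩ C.IK

/-- `H₁ = H ∩ I_{1,K}`. -/
def H1 : Set S.GG := S.Hset ∩ C.I1

end Chamber

section RepTheory

variable {S : Setting} (C : Chamber S)
variable (𝔽 : Type) [Field 𝔽]

section Generic

variable {G₀ : Type} [Monoid G₀] {V : Type} [AddCommGroup V] [Module 𝔽 V]

/-- A submodule is invariant under a representation. -/
def Invt (ρ : Representation 𝔽 G₀ V) (Ssub : Submodule 𝔽 V) : Prop :=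
  ∀ g v, v ∈ Ssub → ρ g v ∈ Ssub

/-- The subrepresentation generated by a vector (the span of its orbit). -/
def orbitSpan (ρ : Representation 𝔽 G₀ V) (v : V) : Submodule 𝔽 V :=
  Submodule.span 𝔽 {w | ∃ g, w = ρ g v}

/-- The subrepresentation generated by a vector under a subset `A` of the group. -/
def orbitSpanOn (ρ : Representation 𝔽 G₀ V) (A : Set G₀) (v : V) : Submodule 𝔽 V :=
  Submodule.span 𝔽 {w | ∃ g ∈ A, w = ρ g v}

/-- The quotient of a representation by an invariant submodule `N` is irreducible:
equivalently (by the lattice correspondence), `N ≠ ⊤` and any invariant submodule lying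
between `N` and `⊤` equals `N` or `⊤`. -/
def QuotientIrreducible (ρ : Representation 𝔽 G₀ V) (N : Submodule 𝔽 V) : Prop :=
  N ≠ ⊤ ∧ ∀ Ssub : Submodule 𝔽 V, Invt 𝔽 ρ Ssub → N ≤ Ssub → Ssub = N ∨ Ssub = ⊤

/-- The submodule of vectors invariant under all elements of the subset `A`. -/
def invariantsOn (ρ : Representation 𝔽 G₀ V) (A : Set G₀) : Submodule 𝔽 V where
  carrier := {v | ∀ g ∈ A, ρ g v = v}
  add_mem' := by
    intro a b ha hb g hg
    rw [map_add, ha g hg, hb g hg]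
  zero_mem' := by
    intro g hg
    rw [map_zero]
  smul_mem' := by
    intro c a ha g hg
    rw [map_smul, ha g hg]

/-- The space `Hom_G(ρ₁, ρ₂)` of equivariant linear maps, as a submodule of the linear maps. -/
def EquivHomSub {V₂ : Type} [AddCommGroup V₂] [Module 𝔽 V₂]
    (ρ₁ : Representation 𝔽 G₀ V) (ρ₂ : Representation 𝔽 G₀ V₂) :
    Submodule 𝔽 (V →ₗ[𝔽] V₂) where
  carrier := {φ | ∀ g x, φ (ρ₁ g x) = ρ₂ g (φ x)}
  add_mem' := by
    intro a b ha hb g x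
    simp only [LinearMap.add_apply, ha g x, hb g x, map_add]
  zero_mem' := by
    intro g x
    simp only [LinearMap.zero_apply, map_zero]
  smul_mem' := by
    intro c a ha g x
    simp only [LinearMap.smul_apply, ha g x, map_smul]

end Generic

section Weight

variable (W : Type) [AddCommGroup W] [Module 𝔽 W]
variable (σ : Representation 𝔽 ↥C.K W)

/-- Extension of `σ` to all of `G` (by `1` outside `K`); used to avoid coercion issues. -/
def sigma' : S.GG → Module.End 𝔽 W := fun g => if h : g ∈ C.K then σ ⟨g, h⟩ else 1

/-- `σ` is a weight of `K`: an irreducible smooth representation of `K` over `𝔽`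
factoring through `Γ_K = K / K¹` (automatically finite dimensional). -/
def IsWeight : Prop :=
  Nontrivial W ∧ FiniteDimensional 𝔽 W ∧
  (∀ Ssub : Submodule 𝔽 W, (∀ (k : ↥C.K) (w : W), w ∈ Ssub → σ k w ∈ Ssub) → Ssub = ⊥ ∨ Ssub = ⊤) ∧
  (∀ (g : S.GG) (hg : g ∈ C.K), g ∈ C.KoneS → σ ⟨g, hg⟩ = LinearMap.id)

/-- `σ` is one dimensional of the form `χ ∘ det`. -/
def IsDetWeight : Prop :=
  Module.finrank 𝔽 W = 1 ∧
  ∃ c : S.E → 𝔽, ∀ (g : S.GG) (hg : g ∈ C.K) (w : W), σ ⟨g, hg⟩ w = c ((S.mat g).det) • w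

/-- `j_σ : σ → σ` is the composition of the coinvariant projection `σ → σ_{I'_{1,K}}`
with the inverse of the natural isomorphism `σ^{I_{1,K}} ≅ σ_{I'_{1,K}}`:
it restricts to the identity on `σ^{I_{1,K}}` and kills the augmentation part of
`σ` with respect to `I'_{1,K}`. -/
def IsJ (jσ : W →ₗ[𝔽] W) : Prop :=
  (∀ w : W, (∀ g ∈ C.I1, sigma' C 𝔽 W σ g w = w) → jσ w = w) ∧
  (∀ (w : W) (g : S.GG), g ∈ C.I1' → jσ (sigma' C 𝔽 W σ g w - w) = 0)

/-- The defining conditions of the compact induction `ind_K^G σ`: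
`K`-equivariance on the left and compact support (finitely many cosets `K g`). -/
def IndCarrier : Set (S.GG → W) :=
  {f | (∀ (k : S.GG) (hk : k ∈ C.K) (g : S.GG), f (k * g) = σ ⟨k, hk⟩ (f g)) ∧
       ∃ s : Finset S.GG, ∀ g : S.GG, f g ≠ 0 → ∃ k ∈ C.K, ∃ t ∈ s, g = k * t}

/-- The compact induction `ind_K^G σ`, as a submodule of `G → W`. -/
def IndSub : Submodule 𝔽 (S.GG → W) where
  carrier := IndCarrier C 𝔽 W σ
  add_mem' := by
    rintro f g ⟨hf1, sf, hf2⟩ ⟨hg1, sg, hg2⟩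
    refine ⟨fun k hk x => by simp [hf1 k hk x, hg1 k hk x], sf ∪ sg, fun x hx => ?_⟩
    by_cases h : f x ≠ 0
    · obtain ⟨k, hk, t, ht, rfl⟩ := hf2 x h
      exact ⟨k, hk, t, Finset.mem_union_left _ ht, rfl⟩
    · push_neg at h
      have hgx : g x ≠ 0 := by
        intro h0
        apply hx
        simp [Pi.add_apply, h, h0]
      obtain ⟨k, hk, t, ht, rfl⟩ := hg2 x hgx
      exact ⟨k, hk, t, Finset.mem_union_right _ ht, rfl⟩
  zero_mem' := ⟨fun k hk g => by simp, ∅, fun g hg => absurd rfl hg⟩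
  smul_mem' := by
    rintro c f ⟨hf1, sf, hf2⟩
    refine ⟨fun k hk g => by simp [hf1 k hk g], sf, fun x hx => ?_⟩
    refine hf2 x ?_
    intro h0
    apply hx
    simp [h0]

lemma indAct_mem (g : S.GG) {f : S.GG → W} (hf : f ∈ IndCarrier C 𝔽 W σ) :
    (fun x => f (x * g)) ∈ IndCarrier C 𝔽 W σ := by
  obtain ⟨h1, s, h2⟩ := hf
  refine ⟨fun k hk x => ?_, s.image (· * g⁻¹), ?_⟩
  · show f (k * x * g) = _
    rw [mul_assoc]
    exact h1 k hk (x * g)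
  intro x hx
  obtain ⟨k, hk, t, ht, hxg⟩ := h2 (x * g) hx
  refine ⟨k, hk, t * g⁻¹, Finset.mem_image_of_mem _ ht, ?_⟩
  rw [← mul_assoc, ← hxg, mul_assoc, mul_inv_cancel, mul_one]

/-- The representation of `G` on `ind_K^G σ` by right translation. -/
def indRep : Representation 𝔽 S.GG ↥(IndSub C 𝔽 W σ) where
  toFun g :=
    { toFun := fun f => ⟨fun x => (f : S.GG → W) (x * g), indAct_mem C 𝔽 W σ g f.2⟩
      map_add' := fun f1 f2 => Subtype.ext (funext fun x => rfl)
      map_smul' := fun c f => Subtype.ext (funext fun x => rfl) }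
  map_one' := LinearMap.ext fun f => Subtype.ext (funext fun x => by simp [mul_one])
  map_mul' g h := LinearMap.ext fun f => Subtype.ext (funext fun x => by simp [mul_assoc])

/-- The function `[g, v] ∈ ind_K^G σ`: supported on `K g⁻¹`, with value `v` at `g⁻¹`. -/
def stdFn (g : S.GG) (v : W) : S.GG → W :=
  fun x => if h : x * g ∈ C.K then σ ⟨x * g, h⟩ v else 0

/-- The characterization of the family `f_n` (`n ∈ ℤ`) of `I_{1,K}`-invariant elements of
`ind_K^G σ`: `f_n` is supported on `K α⁻ⁿ I_{1,K}` and has value at `α⁻ⁿ` equal to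
`σ(β_K) v₀` for `n > 0` and `v₀` for `n ≤ 0`, where `v₀` is a fixed nonzero vector of
`σ^{I_{1,K}}`. -/
def IsFFamily (v0 : W) (ff : ℤ → ↥(IndSub C 𝔽 W σ)) : Prop :=
  v0 ≠ 0 ∧ (∀ g ∈ C.I1, sigma' C 𝔽 W σ g v0 = v0) ∧
  (∀ (n : ℤ) (g : S.GG), g ∈ C.I1 → indRep C 𝔽 W σ g (ff n) = ff n) ∧
  (∀ (n : ℤ) (x : S.GG), (ff n : S.GG → W) x ≠ 0 →
    ∃ k ∈ C.K, ∃ i ∈ C.I1, x = k * S.alphaE ^ (-n) * i) ∧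
  (∀ n : ℤ, 0 < n → (ff n : S.GG → W) (S.alphaE ^ (-n)) = sigma' C 𝔽 W σ C.βK v0) ∧
  (∀ n : ℤ, n ≤ 0 → (ff n : S.GG → W) (S.alphaE ^ (-n)) = v0)

/-- The characterization of the Hecke operator `T ∈ End_G(ind_K^G σ)`:
it is `G`-equivariant and satisfies
`T [1, v] = ∑_{u ∈ N_{n_K}/N_{n_K+2}} [u α⁻¹, j_σ σ(u⁻¹) v]
  + ∑_{u ∈ N_{n_K+1}/N_{n_K+2}} [β_K u α⁻¹, j_σ σ(β_K) v]`. -/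
def IsHeckeT (jσ : W →ₗ[𝔽] W) (T : Module.End 𝔽 ↥(IndSub C 𝔽 W σ)) : Prop :=
  (∀ (g : S.GG) (x : ↥(IndSub C 𝔽 W σ)),
    T (indRep C 𝔽 W σ g x) = indRep C 𝔽 W σ g (T x)) ∧
  (∀ (v : W) (x : ↥(IndSub C 𝔽 W σ)), (x : S.GG → W) = stdFn C 𝔽 W σ 1 v →
    ∀ (U2 U1 : Finset S.GG),
      S.IsReps (S.Nk C.nK) (S.Nk (C.nK + 2)) U2 →
      S.IsReps (S.Nk (C.nK + 1)) (S.Nk (C.nK + 2)) U1 →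
      ((T x : S.GG → W)) =
        (∑ u ∈ U2, stdFn C 𝔽 W σ (u * S.alphaE⁻¹) (jσ (sigma' C 𝔽 W σ u⁻¹ v))) +
        ∑ u ∈ U1, stdFn C 𝔽 W σ (C.βK * u * S.alphaE⁻¹) (jσ (sigma' C 𝔽 W σ C.βK v)))

/-- The eigencharacter `χ_σ` of `H₀/H₁` afforded by the (one-dimensional) space
`σ^{I_{1,K}}` with chosen basis vector `v₀`. -/
def IsChi (v0 : W) (χ : S.GG → 𝔽) : Prop :=
  (∀ h ∈ C.H0, sigma' C 𝔽 W σ h v0 = χ h • v0)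

/-- Right translation on functions `K → 𝔽` (the action on a (finite) principal series). -/
def PSact (k : ↥C.K) (f : ↥C.K → 𝔽) : ↥C.K → 𝔽 := fun x => f (x * k)

/-- The (inflation to `K` of the) finite principal series `Ind_𝔹^{Γ_K} χ`:
functions on `K`, invariant under right translation by `K¹`, left `I_{1,K}`-invariant and
left `(H₀, χ)`-equivariant. -/
def PSchiSub (χ : S.GG → 𝔽) : Submodule 𝔽 (↥C.K → 𝔽) where
  carrier := {f | (∀ b : ↥C.K, (b : S.GG) ∈ C.I1 → ∀ x, f (b * x) = f x) ∧
                  (∀ h : ↥C.K, (h : S.GG) ∈ C.H0 → ∀ x, f (h * x) = χ (h : S.GG) * f x) ∧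
                  (∀ z : ↥C.K, (z : S.GG) ∈ C.KoneS → ∀ x, f (x * z) = f x)}
  add_mem' := by
    rintro f g ⟨hf1, hf2, hf3⟩ ⟨hg1, hg2, hg3⟩
    exact ⟨fun b hb x => by simp [hf1 b hb x, hg1 b hb x],
           fun h hh x => by simp [hf2 h hh x, hg2 h hh x, mul_add],
           fun z hz x => by simp [hf3 z hz x, hg3 z hz x]⟩
  zero_mem' := ⟨fun b hb x => rfl, fun h hh x => by simp, fun z hz x => rfl⟩
  smul_mem' := by
    rintro c f ⟨hf1, hf2, hf3⟩
    refine ⟨fun b hb x => by simp [hf1 b hb x], fun h hh x => ?_, fun z hz x => by simp [hf3 z hz x]⟩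
    simp only [Pi.smul_apply, hf2 h hh x, smul_eq_mul]
    ring

/-- The principal series `Ind_𝔹^{Γ_K} 1` for the trivial character. -/
def PS1sub : Submodule 𝔽 (↥C.K → 𝔽) := PSchiSub C 𝔽 (fun _ => 1)

/-- `σ_{st}` is the Steinberg weight `st = (Ind_𝔹^{Γ_K} 1)/1`: there is a surjective
`K`-equivariant linear map from `Ind_𝔹^{Γ_K} 1` to it whose kernel is exactly the
constant functions. -/
def IsSteinberg {Wst : Type} [AddCommGroup Wst] [Module 𝔽 Wst]
    (σst : Representation 𝔽 ↥C.K Wst) : Prop :=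
  ∃ φ : ↥(PS1sub C 𝔽) →ₗ[𝔽] Wst, Function.Surjective φ ∧
    (∀ f : ↥(PS1sub C 𝔽), φ f = 0 ↔ ∃ c : 𝔽, (f : ↥C.K → 𝔽) = fun _ => c) ∧
    (∀ (k : ↥C.K) (f f' : ↥(PS1sub C 𝔽)),
      (f' : ↥C.K → 𝔽) = PSact C 𝔽 k (f : ↥C.K → 𝔽) → φ f' = σst k (φ f))

/-- `σ` is isomorphic to a twist of the Steinberg weight by a character. -/
def IsTwistSteinberg : Prop :=
  ∃ (c : ↥C.K →* 𝔽ˣ) (φ : ↥(PS1sub C 𝔽) →ₗ[𝔽] W), Function.Surjective φ ∧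
    (∀ f : ↥(PS1sub C 𝔽), φ f = 0 ↔ ∃ cc : 𝔽, (f : ↥C.K → 𝔽) = fun _ => cc) ∧
    (∀ (k : ↥C.K) (f f' : ↥(PS1sub C 𝔽)),
      (f' : ↥C.K → 𝔽) = PSact C 𝔽 k (f : ↥C.K → 𝔽) →
        φ f' = (c k : 𝔽) • σ k (φ f))


/-- The `K`-subrepresentation of the quotient `(ind_K^G σ) / (range T)` generated by the
image of a vector `v`. -/
def genQuot (T : Module.End 𝔽 ↥(IndSub C 𝔽 W σ)) (v : ↥(IndSub C 𝔽 W σ)) :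
    Submodule 𝔽 (↥(IndSub C 𝔽 W σ) ⧸ LinearMap.range T) :=
  Submodule.span 𝔽 {w | ∃ k ∈ C.K, w = Submodule.Quotient.mk (indRep C 𝔽 W σ k v)}

end Weight

/-- Smoothness of a representation of `G`: every vector is fixed by some congruence
subgroup (equivalently, has open stabilizer). -/
def SmoothRep {V : Type} [AddCommGroup V] [Module 𝔽 V] (ρ : Representation 𝔽 S.GG V) : Prop :=
  ∀ v : V, ∃ n : ℕ, ∀ g ∈ S.cong n, ρ g v = v

end RepTheory

end U21

namespace U21
namespace Setting
variable (S : Setting)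

/-! ### Fractional ideals -/

lemma mem_pE_iff (k : ℤ) (z : S.E) : z ∈ S.pE k ↔ z * S.ϖ ^ (-k) ∈ S.O := by
  have hk : S.ϖ ^ k ≠ 0 := zpow_ne_zero _ S.unif_ne
  constructor
  · rintro ⟨w, hw, rfl⟩
    rw [zpow_neg, mul_assoc, mul_comm w, ← mul_assoc, mul_inv_cancel₀ hk, one_mul]
    exact hw
  · intro h
    refine ⟨_, h, ?_⟩
    rw [zpow_neg, mul_comm z, ← mul_assoc, mul_inv_cancel₀ hk, one_mul]

lemma pE_zero_iff (z : S.E) : z ∈ S.pE 0 ↔ z ∈ S.O := by simp [mem_pE_iff]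

variable {S}

lemma zero_mem_pE (k : ℤ) : (0 : S.E) ∈ S.pE k := by simp [mem_pE_iff, S.O.zero_mem]

lemma pE_add {k : ℤ} {a b : S.E} (ha : a ∈ S.pE k) (hb : b ∈ S.pE k) : a + b ∈ S.pE k := by
  rw [mem_pE_iff] at *
  rw [add_mul]; exact S.O.add_mem ha hb

lemma pE_neg {k : ℤ} {a : S.E} (ha : a ∈ S.pE k) : -a ∈ S.pE k := by
  rw [mem_pE_iff] at *
  rw [neg_mul]; exact S.O.neg_mem ha

lemma pE_sub {k : ℤ} {a b : S.E} (ha : a ∈ S.pE k) (hb : b ∈ S.pE k) : a - b ∈ S.pE k := by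
  rw [sub_eq_add_neg]; exact pE_add ha (pE_neg hb)

lemma pE_mul {k l : ℤ} {a b : S.E} (ha : a ∈ S.pE k) (hb : b ∈ S.pE l) :
    a * b ∈ S.pE (k + l) := by
  rw [mem_pE_iff] at *
  have : a * b * S.ϖ ^ (-(k + l)) = (a * S.ϖ ^ (-k)) * (b * S.ϖ ^ (-l)) := by
    rw [neg_add, zpow_add₀ S.unif_ne]; ring
  rw [this]; exact S.O.mul_mem ha hb

lemma unif_zpow_mem {n k : ℤ} (h : k ≤ n) : S.ϖ ^ n ∈ S.pE k := by
  rw [mem_pE_iff, ← zpow_add₀ S.unif_ne]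
  obtain ⟨m, hm⟩ := Int.eq_ofNat_of_zero_le (sub_nonneg.2 h)
  have : n + -k = (m : ℤ) := by omega
  rw [this, zpow_natCast]
  exact S.O.pow_mem S.unif_mem m

lemma pE_mono {k l : ℤ} (h : k ≤ l) {a : S.E} (ha : a ∈ S.pE l) : a ∈ S.pE k := by
  obtain ⟨w, hw, rfl⟩ := ha
  have := pE_mul (unif_zpow_mem h) ((S.pE_zero_iff w).2 hw)
  simpa using this

lemma pE_mul' {k l m : ℤ} {a b : S.E} (ha : a ∈ S.pE k) (hb : b ∈ S.pE l) (h : m ≤ k + l) :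
    a * b ∈ S.pE m := pE_mono h (pE_mul ha hb)

lemma one_mem_pE : (1 : S.E) ∈ S.pE 0 := by rw [pE_zero_iff]; exact S.O.one_mem

lemma pE_conj {k : ℤ} {a : S.E} (ha : a ∈ S.pE k) : S.conj a ∈ S.pE k := by
  rw [mem_pE_iff] at *
  have := S.conj_O _ ha
  rwa [map_mul, map_zpow₀, S.unif_conj] at this

lemma one_notMem_pE {k : ℤ} (hk : 1 ≤ k) : (1 : S.E) ∉ S.pE k := by
  intro h
  have h1 := pE_mono hk h
  obtain ⟨w, hw, h⟩ := h1
  apply S.unif_not_unit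
  refine isUnit_iff_exists_inv.2 ⟨⟨w, hw⟩, Subtype.ext ?_⟩
  simpa using h.symm

/-- `a` has valuation exactly `k`. -/
def IsVal (S : Setting) (k : ℤ) (a : S.E) : Prop := a ≠ 0 ∧ a ∈ S.pE k ∧ a⁻¹ ∈ S.pE (-k)

lemma exists_isVal {a : S.E} (ha : a ≠ 0) : ∃ k, S.IsVal k a := by
  obtain ⟨n, u, hu⟩ := S.disc a ha
  refine ⟨n, ha, ?_, ?_⟩
  · rw [hu]
    simpa using pE_mul ((S.pE_zero_iff _).2 (u : S.O).2) (unif_zpow_mem (le_refl n))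
  · have h1 : ((u : S.O) : S.E)⁻¹ = ((u⁻¹ : S.Oˣ) : S.O) := by
      apply inv_eq_of_mul_eq_one_right
      exact_mod_cast congrArg Subtype.val (u.mul_inv)
    rw [hu, mul_inv, h1, ← zpow_neg]
    simpa using pE_mul ((S.pE_zero_iff _).2 ((u⁻¹ : S.Oˣ) : S.O).2) (unif_zpow_mem (le_refl (-n)))

lemma IsVal.mem_iff {k l : ℤ} {a : S.E} (h : S.IsVal k a) : a ∈ S.pE l ↔ l ≤ k := by
  refine ⟨fun h1 => ?_, fun h1 => pE_mono h1 h.2.1⟩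
  by_contra hlt
  have := pE_mul h1 h.2.2
  rw [mul_inv_cancel₀ h.1] at this
  exact one_notMem_pE (by omega) this

lemma IsVal.mul {k l : ℤ} {a b : S.E} (ha : S.IsVal k a) (hb : S.IsVal l b) :
    S.IsVal (k + l) (a * b) :=
  ⟨mul_ne_zero ha.1 hb.1, pE_mul ha.2.1 hb.2.1, by
    rw [mul_inv]; exact pE_mono (by omega) (pE_mul ha.2.2 hb.2.2)⟩

lemma IsVal.inv {k : ℤ} {a : S.E} (ha : S.IsVal k a) : S.IsVal (-k) a⁻¹ :=
  ⟨inv_ne_zero ha.1, ha.2.2, by simpa using ha.2.1⟩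

lemma IsVal.neg {k : ℤ} {a : S.E} (ha : S.IsVal k a) : S.IsVal k (-a) :=
  ⟨neg_ne_zero.2 ha.1, pE_neg ha.2.1, by rw [inv_neg]; exact pE_neg ha.2.2⟩

lemma IsVal.conj {k : ℤ} {a : S.E} (ha : S.IsVal k a) : S.IsVal k (S.conj a) :=
  ⟨(map_ne_zero _).2 ha.1, pE_conj ha.2.1, by rw [← map_inv₀]; exact pE_conj ha.2.2⟩

lemma isVal_zpow (n : ℤ) : S.IsVal n (S.ϖ ^ n) :=
  ⟨zpow_ne_zero _ S.unif_ne, unif_zpow_mem le_rfl, by rw [← zpow_neg]; exact unif_zpow_mem le_rfl⟩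

lemma isVal_unif : S.IsVal 1 S.ϖ := by simpa using isVal_zpow (S := S) 1

lemma isVal_of_mem_of_notMem {k : ℤ} {a : S.E} (h : a ∈ S.pE k) (h' : a ∉ S.pE (k + 1)) :
    S.IsVal k a := by
  have ha : a ≠ 0 := by rintro rfl; exact h' (zero_mem_pE _)
  obtain ⟨l, hl⟩ := exists_isVal ha
  have h1 := hl.mem_iff.1 h
  have h2 : ¬ (k + 1 ≤ l) := fun h3 => h' (hl.mem_iff.2 h3)
  have : l = k := by omega
  rwa [← this]

/-- If the norm of `x` lies in `p_E^k`, then `x` lies in `p_E^l` for `2l ≤ k + 1`. -/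
lemma pE_of_norm {k l : ℤ} (hkl : 2 * l ≤ k + 1) {x : S.E} (h : x * S.conj x ∈ S.pE k) :
    x ∈ S.pE l := by
  by_cases hx : x = 0
  · rw [hx]; exact zero_mem_pE _
  obtain ⟨n, hn⟩ := exists_isVal hx
  have := (hn.mul hn.conj).mem_iff.1 h
  exact hn.mem_iff.2 (by omega)

lemma pE_of_rel {k l : ℤ} (hkl : 2 * l ≤ k + 1) {x y : S.E} (h : x * S.conj x + y + S.conj y = 0)
    (hy : y ∈ S.pE k) : x ∈ S.pE l := by
  apply pE_of_norm hkl
  have : x * S.conj x = -(y + S.conj y) := by linear_combination h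
  rw [this]; exact pE_neg (pE_add hy (pE_conj hy))

/-! ### The residue field -/

lemma resmap_eq_zero_iff (x : S.O) : S.resmap x = 0 ↔ (x : S.E) ∈ S.pE 1 := by
  rw [resmap, Ideal.Quotient.eq_zero_iff_mem, S.hmI]
  simp [pE]

lemma resmap_eq_iff (x y : S.O) : S.resmap x = S.resmap y ↔ (x - y : S.E) ∈ S.pE 1 := by
  rw [← sub_eq_zero, ← map_sub, resmap_eq_zero_iff]; rfl

lemma kE_isMaximal : S.mI.IsMaximal := by
  rw [Ideal.isMaximal_iff]
  constructor
  · rw [S.hmI]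
    rintro ⟨y, hy, h⟩
    exact one_notMem_pE (S := S) le_rfl ⟨y, hy, by simpa using h⟩
  · intro J x hJ hx hxJ
    have hx' : (x : S.E) ∉ S.pE 1 := by
      rw [← resmap_eq_zero_iff, resmap, Ideal.Quotient.eq_zero_iff_mem]; exact hx
    have hv := isVal_of_mem_of_notMem ((S.pE_zero_iff _).2 x.2) hx'
    have hinv : (x : S.E)⁻¹ ∈ S.O := (S.pE_zero_iff _).1 (by simpa using hv.2.2)
    have : (1 : S.O) = ⟨_, hinv⟩ * x := Subtype.ext (by simp [inv_mul_cancel₀ hv.1])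
    rw [this]
    exact J.mul_mem_left _ hxJ

lemma card_kE : Fintype.card S.kE = S.p ^ (2 * S.fdeg) := by
  rw [S.card_res, S.hq, ← pow_mul, mul_comm]

lemma charP_kE : CharP S.kE S.p := by
  have := kE_isMaximal (S := S)
  let := Ideal.Quotient.field S.mI
  have : Fact S.p.Prime := ⟨S.hp⟩
  obtain ⟨r, hr⟩ := CharP.exists S.kE
  have := hr
  obtain ⟨n, hr', hn⟩ := FiniteField.card S.kE r
  have h1 : r ∣ S.p ^ (2 * S.fdeg) := by
    rw [← card_kE, hn]; exact dvd_pow_self r n.pos.ne'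
  have := (Nat.prime_dvd_prime_iff_eq hr' S.hp).1 (hr'.dvd_of_dvd_pow h1)
  rw [← this]; exact hr

lemma natCast_mem_O (a : ℕ) : (a : S.E) ∈ S.O := natCast_mem S.O a

lemma natCast_mem_pE_one_iff (a : ℕ) : (a : S.E) ∈ S.pE 1 ↔ S.p ∣ a := by
  have := charP_kE (S := S)
  rw [← CharP.cast_eq_zero_iff S.kE S.p a, ← map_natCast S.resmap, resmap_eq_zero_iff]
  simp

lemma isVal_natCast {a : ℕ} (h : ¬ S.p ∣ a) : S.IsVal 0 (a : S.E) :=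
  isVal_of_mem_of_notMem ((S.pE_zero_iff _).2 (natCast_mem_O a))
    (by simpa [natCast_mem_pE_one_iff] using h)

/-- If `q = p`, an integer fixed by conjugation modulo `p_E` is congruent to a natural number. -/
lemma exists_nat_of_conj_fixed (hqp : S.q = S.p) {z : S.E} (hz : z ∈ S.O)
    (h : S.conj z - z ∈ S.pE 1) : ∃ a < S.p, z - (a : ℕ) ∈ S.pE 1 := by
  have := kE_isMaximal (S := S)
  let := Ideal.Quotient.field S.mI
  have : Fact S.p.Prime := ⟨S.hp⟩
  have := charP_kE (S := S)
  have h1 : S.resmap ⟨z, hz⟩ ^ S.p = S.resmap ⟨z, hz⟩ := by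
    have h2 : S.resmap ⟨S.conj z, S.conj_O z hz⟩ = S.resmap ⟨z, hz⟩ := by
      rw [resmap_eq_iff]; exact h
    rw [← hqp]
    exact (S.res_frob ⟨z, hz⟩).symm.trans h2
  have h3 : S.resmap ⟨z, hz⟩ ∈ Set.range (Nat.cast : ℕ → S.kE) := by
    rw [← Subfield.mem_bot_iff_pow_eq_self S.kE S.p, ← ZMod.fieldRange_castHom_eq_bot S.p] at h1
    obtain ⟨c, hc⟩ := h1
    refine ⟨c.val, ?_⟩
    rw [← hc, ← ZMod.natCast_zmod_val c, map_natCast, ZMod.natCast_zmod_val]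
  obtain ⟨a, ha⟩ := h3
  refine ⟨a % S.p, Nat.mod_lt _ S.hp.pos, ?_⟩
  have h4 : ((a % S.p : ℕ) : S.kE) = a := (CharP.cast_eq_mod S.kE S.p a).symm
  rw [← h4, ← map_natCast S.resmap, eq_comm, resmap_eq_iff] at ha
  simpa using ha

lemma exists_traceZero : ∃ τ : S.E, S.IsVal 0 τ ∧ S.conj τ = -τ := by
  have : ∃ x, S.conj x ≠ x := by
    by_contra h
    push Not at h
    exact S.conj_ne (RingHom.ext h)
  obtain ⟨x, hx⟩ := this
  have hy : x - S.conj x ≠ 0 := sub_ne_zero.2 (Ne.symm hx)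
  obtain ⟨n, hn⟩ := exists_isVal hy
  refine ⟨(x - S.conj x) * S.ϖ ^ (-n), ?_, ?_⟩
  · simpa using hn.mul (isVal_zpow (-n))
  · rw [map_mul, map_zpow₀, S.unif_conj, map_sub, S.conj_invol]; ring

/-- A fixed trace-zero unit of `E`. -/
def tz (S : Setting) : S.E := (exists_traceZero (S := S)).choose

lemma isVal_tz : S.IsVal 0 S.tz := (exists_traceZero (S := S)).choose_spec.1

lemma conj_tz : S.conj S.tz = -S.tz := (exists_traceZero (S := S)).choose_spec.2

lemma tz_ne : S.tz ≠ 0 := isVal_tz.1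

end Setting
end U21

namespace U21
namespace Setting
variable {S : Setting}

/-! ### Matrices and elements of `G` -/

lemma mat_injective : Function.Injective S.mat := fun _ _ h => Subtype.ext (Units.ext h)

lemma mat_mul (g h : S.GG) : S.mat (g * h) = S.mat g * S.mat h := rfl

lemma mat_one : S.mat 1 = 1 := rfl

lemma mat_mul_apply (g h : S.GG) (i j : Fin 3) : S.mat (g * h) i j =
    S.mat g i 0 * S.mat h 0 j + S.mat g i 1 * S.mat h 1 j + S.mat g i 2 * S.mat h 2 j := by
  rw [mat_mul, Matrix.mul_apply, Fin.sum_univ_three]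

lemma mat_form (g : S.GG) : (S.mat g).transpose * S.betaM * (S.mat g).map S.conj = S.betaM := g.2

/-- The columns of an element of `G` form a basis with Gram matrix `β`. -/
lemma mat_form_apply (g : S.GG) (i j : Fin 3) :
    S.mat g 0 i * S.conj (S.mat g 2 j) + S.mat g 1 i * S.conj (S.mat g 1 j) +
      S.mat g 2 i * S.conj (S.mat g 0 j) = S.betaM i j := by
  rw [← congrFun (congrFun (mat_form g) i) j]
  simp [Matrix.mul_apply, Fin.sum_univ_three, betaM]
  ring

lemma betaM_transpose : S.betaM.transpose = S.betaM := by
  ext i j; fin_cases i <;> fin_cases j <;> simp [betaM]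

lemma left_inv_of_form {M : S.M3} (h : M.transpose * S.betaM * M.map S.conj = S.betaM) :
    S.betaM * (M.map S.conj).transpose * S.betaM * M = 1 := by
  have h2 := congrArg Matrix.transpose h
  rw [Matrix.transpose_mul, Matrix.transpose_mul, Matrix.transpose_transpose, betaM_transpose] at h2
  rw [mul_assoc, mul_assoc, h2, beta_mul_beta]

/-- An element of `G` from its matrix. -/
def mkG (M : S.M3) (h : M.transpose * S.betaM * M.map S.conj = S.betaM) : S.GG :=
  ⟨⟨M, S.betaM * (M.map S.conj).transpose * S.betaM,
    mul_eq_one_comm.1 (left_inv_of_form h), left_inv_of_form h⟩, h⟩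

@[simp] lemma mat_mkG (M : S.M3) (h) : S.mat (mkG M h) = M := rfl

lemma mat_inv (g : S.GG) :
    S.mat g⁻¹ = S.betaM * ((S.mat g).map S.conj).transpose * S.betaM := by
  have h1 : S.mat g⁻¹ * S.mat g = 1 := by rw [← mat_mul, inv_mul_cancel, mat_one]
  have h2 := left_inv_of_form (mat_form g)
  have h3 := mul_eq_one_comm.1 h1
  calc S.mat g⁻¹ = (S.betaM * ((S.mat g).map S.conj).transpose * S.betaM * S.mat g) * S.mat g⁻¹ := by
        rw [h2, one_mul]
    _ = _ := by rw [mul_assoc, h3, mul_one]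

lemma mat_inv_apply (g : S.GG) (i j : Fin 3) :
    S.mat g⁻¹ i j = S.conj (S.mat g j.rev i.rev) := by
  rw [mat_inv]
  simp only [Matrix.mul_apply, Fin.sum_univ_three, Matrix.transpose_apply, Matrix.map_apply]
  fin_cases i <;> fin_cases j <;> simp [betaM, Fin.rev]

lemma mat_alphaE : S.mat S.alphaE = S.alphaM := rfl

lemma mat_betaPr : S.mat S.betaPr = !![0, 0, S.ϖ⁻¹; 0, 1, 0; S.ϖ, 0, 0] := by
  have : S.mat S.betaPr = S.betaM * S.alphaMinv := rfl
  rw [this]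
  ext i j; fin_cases i <;> fin_cases j <;>
    simp [betaM, alphaMinv, Matrix.mul_apply, Fin.sum_univ_three]

lemma betaPr_mul_self : S.betaPr * S.betaPr = 1 := by
  apply mat_injective
  ext i j
  rw [mat_mul_apply, mat_betaPr, mat_one]
  fin_cases i <;> fin_cases j <;> simp [S.unif_ne]

lemma betaPr_inv : S.betaPr⁻¹ = S.betaPr := inv_eq_of_mul_eq_one_left betaPr_mul_self

lemma mat_alphaE_zpow (n : ℤ) :
    S.mat (S.alphaE ^ n) = !![S.ϖ ^ (-n), 0, 0; 0, 1, 0; 0, 0, S.ϖ ^ n] := by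
  have hinv : S.mat S.alphaE⁻¹ = S.alphaMinv := rfl
  induction n using Int.induction_on with
  | zero =>
    rw [zpow_zero, mat_one]
    ext i j; fin_cases i <;> fin_cases j <;> simp
  | succ k ih =>
    rw [zpow_add_one]
    ext i j
    rw [mat_mul_apply, ih, mat_alphaE]
    fin_cases i <;> fin_cases j <;> simp [alphaM, zpow_add₀ S.unif_ne, mul_comm]
  | pred k ih =>
    rw [zpow_sub_one]
    ext i j
    rw [mat_mul_apply, ih, hinv]
    fin_cases i <;> fin_cases j <;>
      simp [alphaMinv, zpow_add₀ S.unif_ne, zpow_sub₀ S.unif_ne, mul_comm, div_eq_mul_inv]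

/-- The element `n(x,y)` of `N`. -/
def nE (x y : S.E) (h : x * S.conj x + y + S.conj y = 0) : S.GG :=
  mkG (S.nM x y) (by
    ext i j; fin_cases i <;> fin_cases j <;>
      simp [nM, betaM, Matrix.mul_apply, Fin.sum_univ_three, S.conj_invol]
    linear_combination h)

/-- The element `n'(x,y)` of `N'`. -/
def n'E (x y : S.E) (h : x * S.conj x + y + S.conj y = 0) : S.GG :=
  mkG (S.n'M x y) (by
    ext i j; fin_cases i <;> fin_cases j <;>
      simp [n'M, betaM, Matrix.mul_apply, Fin.sum_univ_three, S.conj_invol]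
    linear_combination h)

/-- The element `diag(a, b, ā⁻¹)` of `H`. -/
def hE (a b : S.E) (ha : a ≠ 0) (hb : b * S.conj b = 1) : S.GG :=
  mkG !![a, 0, 0; 0, b, 0; 0, 0, (S.conj a)⁻¹] (by
    have ha' : S.conj a ≠ 0 := (map_ne_zero _).2 ha
    ext i j; fin_cases i <;> fin_cases j <;>
      simp [betaM, Matrix.mul_apply, Fin.sum_univ_three, S.conj_invol, ha, ha', hb])

@[simp] lemma mat_nE (x y : S.E) (h) : S.mat (nE x y h) = S.nM x y := rfl
@[simp] lemma mat_n'E (x y : S.E) (h) : S.mat (n'E x y h) = S.n'M x y := rfl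
@[simp] lemma mat_hE (a b : S.E) (ha hb) :
    S.mat (hE a b ha hb) = !![a, 0, 0; 0, b, 0; 0, 0, (S.conj a)⁻¹] := rfl

lemma nE_mem (x y : S.E) (h) : nE x y h ∈ S.Nset := ⟨x, y, h, rfl⟩
lemma hE_mem (a b : S.E) (ha hb) : hE a b ha hb ∈ S.Hset := ⟨a, b, _, rfl⟩

lemma exists_nE {g : S.GG} (hg : g ∈ S.Nset) : ∃ x y h, g = nE x y h := by
  obtain ⟨x, y, h, hm⟩ := hg
  exact ⟨x, y, h, mat_injective hm⟩

lemma exists_hE {g : S.GG} (hg : g ∈ S.Hset) : ∃ a b ha hb, g = hE a b ha hb := by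
  obtain ⟨a, b, c, hm⟩ := hg
  have h1 := mat_form_apply g 0 2
  have h2 := mat_form_apply g 1 1
  simp [hm, betaM] at h1 h2
  have ha : a ≠ 0 := by rintro rfl; simp at h1
  refine ⟨a, b, ha, h2, mat_injective ?_⟩
  rw [hm, mat_hE]
  have : c = (S.conj a)⁻¹ := by
    have := congrArg S.conj h1
    rw [map_mul, S.conj_invol, map_one] at this
    exact eq_inv_of_mul_eq_one_right this
  rw [this]

lemma rel_symm {x y : S.E} (h : x * S.conj x + y + S.conj y = 0) :
    (-x) * S.conj (-x) + S.conj y + S.conj (S.conj y) = 0 := by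
  rw [S.conj_invol, map_neg]; linear_combination h

lemma rel_add {x y x' y' : S.E} (h : x * S.conj x + y + S.conj y = 0)
    (h' : x' * S.conj x' + y' + S.conj y' = 0) :
    (x + x') * S.conj (x + x') + (y + y' - x * S.conj x') +
      S.conj (y + y' - x * S.conj x') = 0 := by
  simp only [map_add, map_sub, map_mul, S.conj_invol]; linear_combination h + h'

lemma rel_smul {x y t : S.E} (h : x * S.conj x + y + S.conj y = 0) :
    (t * x) * S.conj (t * x) + (t * S.conj t * y) + S.conj (t * S.conj t * y) = 0 := by
  simp only [map_mul, S.conj_invol]; linear_combination (t * S.conj t) * h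

lemma nE_inv (x y : S.E) (h) : (nE x y h)⁻¹ = nE (-x) (S.conj y) (rel_symm h) := by
  apply mat_injective
  ext i j
  rw [mat_inv_apply]
  fin_cases i <;> fin_cases j <;> simp [nM, Fin.rev, S.conj_invol]

lemma n'E_inv (x y : S.E) (h) : (n'E x y h)⁻¹ = n'E (-x) (S.conj y) (rel_symm h) := by
  apply mat_injective
  ext i j
  rw [mat_inv_apply]
  fin_cases i <;> fin_cases j <;> simp [n'M, Fin.rev, S.conj_invol]

lemma nE_mul (x y x' y' : S.E) (h h') :
    nE x y h * nE x' y' h' = nE (x + x') (y + y' - x * S.conj x') (rel_add h h') := by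
  apply mat_injective
  ext i j
  rw [mat_mul_apply]
  fin_cases i <;> fin_cases j <;> simp [nM] <;> ring

lemma Nset_mul {g h : S.GG} (hg : g ∈ S.Nset) (hh : h ∈ S.Nset) : g * h ∈ S.Nset := by
  obtain ⟨x, y, h1, rfl⟩ := exists_nE hg
  obtain ⟨x', y', h2, rfl⟩ := exists_nE hh
  rw [nE_mul]; exact nE_mem _ _ _

lemma Nset_inv {g : S.GG} (hg : g ∈ S.Nset) : g⁻¹ ∈ S.Nset := by
  obtain ⟨x, y, h1, rfl⟩ := exists_nE hg
  rw [nE_inv]; exact nE_mem _ _ _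

lemma one_mem_Nk (k : ℤ) : (1 : S.GG) ∈ S.Nk k := by
  refine ⟨0, 0, by simp, zero_mem_pE _, ?_⟩
  rw [mat_one]
  ext i j; fin_cases i <;> fin_cases j <;> simp [nM]

lemma one_mem_Nset : (1 : S.GG) ∈ S.Nset := by
  obtain ⟨x, y, h, -, h'⟩ := one_mem_Nk (S := S) 0
  exact ⟨x, y, h, h'⟩

lemma mem_Nk_iff {k : ℤ} {g : S.GG} : g ∈ S.Nk k ↔ g ∈ S.Nset ∧ S.mat g 0 2 ∈ S.pE k := by
  constructor
  · rintro ⟨x, y, h, hy, hm⟩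
    exact ⟨⟨x, y, h, hm⟩, by simpa [hm, nM] using hy⟩
  · rintro ⟨⟨x, y, h, hm⟩, hy⟩
    exact ⟨x, y, h, by simpa [hm, nM] using hy, hm⟩

lemma Nk_mul {k : ℤ} {g h : S.GG} (hg : g ∈ S.Nk k) (hh : h ∈ S.Nk k) : g * h ∈ S.Nk k := by
  rw [mem_Nk_iff] at *
  refine ⟨Nset_mul hg.1 hh.1, ?_⟩
  obtain ⟨x, y, h1, rfl⟩ := exists_nE hg.1
  obtain ⟨x', y', h2, rfl⟩ := exists_nE hh.1
  have hy := hg.2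
  have hy' := hh.2
  rw [nE_mul]
  simp [nM] at hy hy' ⊢
  have hx := pE_of_rel (l := (k + 1) / 2) (by omega) h1 hy
  have hx' := pE_of_rel (l := (k + 1) / 2) (by omega) h2 hy'
  exact pE_sub (pE_add hy hy') (pE_mul' hx (pE_conj hx') (by omega))

lemma Nk_inv {k : ℤ} {g : S.GG} (hg : g ∈ S.Nk k) : g⁻¹ ∈ S.Nk k := by
  rw [mem_Nk_iff] at *
  refine ⟨Nset_inv hg.1, ?_⟩
  obtain ⟨x, y, h1, rfl⟩ := exists_nE hg.1
  have hy := hg.2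
  rw [nE_inv]
  simp [nM] at hy ⊢
  exact pE_conj hy

lemma Nk_mono {k l : ℤ} (h : k ≤ l) {g : S.GG} (hg : g ∈ S.Nk l) : g ∈ S.Nk k := by
  rw [mem_Nk_iff] at *
  exact ⟨hg.1, pE_mono h hg.2⟩

lemma alpha_conj_nE (k : ℤ) (x y : S.E) (h) :
    S.alphaE ^ k * nE x y h * (S.alphaE ^ k)⁻¹ =
      nE (S.ϖ ^ (-k) * x) (S.ϖ ^ (-k) * S.conj (S.ϖ ^ (-k)) * y) (rel_smul h) := by
  rw [mul_inv_eq_iff_eq_mul]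
  have := S.unif_ne
  apply mat_injective
  ext i j
  rw [mat_mul_apply, mat_mul_apply, mat_alphaE_zpow]
  fin_cases i <;> fin_cases j <;>
    simp [nM, map_zpow₀, map_inv₀, S.unif_conj] <;> field_simp

lemma alpha_conj_Nk (k l : ℤ) {g : S.GG} (hg : g ∈ S.Nk l) :
    S.alphaE ^ k * g * (S.alphaE ^ k)⁻¹ ∈ S.Nk (l - 2 * k) := by
  obtain ⟨hg1, hg2⟩ := mem_Nk_iff.1 hg
  obtain ⟨x, y, h, rfl⟩ := exists_nE hg1
  rw [alpha_conj_nE, mem_Nk_iff]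
  refine ⟨nE_mem _ _ _, ?_⟩
  simp [nM] at hg2 ⊢
  rw [S.unif_conj]
  have h1 : (S.ϖ ^ k)⁻¹ ∈ S.pE (-k) := by rw [← zpow_neg]; exact unif_zpow_mem le_rfl
  exact pE_mul' (pE_mul h1 h1) hg2 (by omega)

lemma alpha_conj_Nset (k : ℤ) {g : S.GG} (hg : g ∈ S.Nset) :
    S.alphaE ^ k * g * (S.alphaE ^ k)⁻¹ ∈ S.Nset := by
  obtain ⟨x, y, h, rfl⟩ := exists_nE hg
  rw [alpha_conj_nE]; exact nE_mem _ _ _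

lemma beta_conj_nE (x y : S.E) (h) :
    S.betaPr * nE x y h * S.betaPr =
      n'E (-S.ϖ * S.conj x) (S.ϖ * S.conj S.ϖ * y)
        (by simp only [map_mul, map_neg, S.conj_invol, S.unif_conj]
            linear_combination (S.ϖ * S.ϖ) * h) := by
  have := S.unif_ne
  apply mat_injective
  ext i j
  rw [mat_mul_apply, mat_mul_apply, mat_mul_apply, mat_mul_apply, mat_betaPr]
  fin_cases i <;> fin_cases j <;>
    simp [nM, n'M, S.conj_invol, S.unif_conj, S.unif_ne, mul_comm, mul_assoc]
  ring

lemma beta_conj_n'E (x y : S.E) (h) :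
    S.betaPr * n'E x y h * S.betaPr =
      nE (-S.ϖ⁻¹ * S.conj x) (S.ϖ⁻¹ * S.ϖ⁻¹ * y)
        (by simp only [map_mul, map_neg, map_inv₀, S.conj_invol, S.unif_conj]
            linear_combination (S.ϖ⁻¹ * S.ϖ⁻¹) * h) := by
  have := S.unif_ne
  apply mat_injective
  ext i j
  rw [mat_mul_apply, mat_mul_apply, mat_mul_apply, mat_mul_apply, mat_betaPr]
  fin_cases i <;> fin_cases j <;>
    simp [nM, n'M, S.conj_invol, S.unif_conj, S.unif_ne, mul_comm, mul_assoc]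
  ring

lemma beta_conj_hE (a b : S.E) (ha hb) :
    S.betaPr * hE a b ha hb * S.betaPr =
      hE (S.conj a)⁻¹ b (inv_ne_zero ((map_ne_zero _).2 ha)) hb := by
  have := S.unif_ne
  apply mat_injective
  ext i j
  rw [mat_mul_apply, mat_mul_apply, mat_mul_apply, mat_mul_apply, mat_betaPr]
  fin_cases i <;> fin_cases j <;>
    simp [S.conj_invol, mul_comm, S.unif_ne]

lemma hE_mul (a b a' b' : S.E) (ha hb ha' hb') :
    hE a b ha hb * hE a' b' ha' hb' = hE (a * a') (b * b') (mul_ne_zero ha ha')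
      (by rw [map_mul]; linear_combination (b' * S.conj b') * hb + hb') := by
  apply mat_injective
  ext i j
  rw [mat_mul_apply]
  fin_cases i <;> fin_cases j <;> simp [mul_comm]

lemma hE_inv (a b : S.E) (ha hb) :
    (hE a b ha hb)⁻¹ = hE a⁻¹ b⁻¹ (inv_ne_zero ha) (by rw [map_inv₀, ← mul_inv, hb, inv_one]) := by
  rw [inv_eq_iff_mul_eq_one, hE_mul]
  apply mat_injective
  have hb0 : b ≠ 0 := by rintro rfl; simp at hb
  ext i j
  rw [mat_one]
  fin_cases i <;> fin_cases j <;> simp [ha, hb0]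

lemma hE_conj_nE (a b x y : S.E) (ha hb h) :
    ∃ x' , ∃ h' : x' * S.conj x' + a * S.conj a * y + S.conj (a * S.conj a * y) = 0,
      hE a b ha hb * nE x y h * (hE a b ha hb)⁻¹ = nE x' (a * S.conj a * y) h' := by
  have ha' : S.conj a ≠ 0 := (map_ne_zero _).2 ha
  have hb' : b⁻¹ = S.conj b := inv_eq_of_mul_eq_one_right hb
  have hb0 : b ≠ 0 := by rintro rfl; simp at hb
  refine ⟨a * b⁻¹ * x, ?_, ?_⟩
  · simp only [map_mul, S.conj_invol, map_inv₀]
    have : b⁻¹ * (S.conj b)⁻¹ = 1 := by rw [← mul_inv, hb, inv_one]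
    linear_combination (a * S.conj a) * h + (a * S.conj a * x * S.conj x) * this
  · rw [hE_inv]
    apply mat_injective
    ext i j
    rw [mat_mul_apply, mat_mul_apply, mat_mul_apply, mat_mul_apply]
    have hcb : S.conj b = b⁻¹ := hb'.symm
    fin_cases i <;> fin_cases j <;>
      simp [nM, ha, hb0, hcb] <;> field_simp

/-- An element of `G` with first column proportional to the first basis vector lies in `H N`. -/
lemma exists_hn {g : S.GG} (h1 : S.mat g 1 0 = 0) (h2 : S.mat g 2 0 = 0) :
    ∃ h ∈ S.Hset, ∃ n ∈ S.Nset, g = h * n ∧ S.mat h 0 0 = S.mat g 0 0 := by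
  have e01 := mat_form_apply g 0 1
  have e02 := mat_form_apply g 0 2
  have e11 := mat_form_apply g 1 1
  have e12 := mat_form_apply g 1 2
  have e22 := mat_form_apply g 2 2
  simp [betaM, h1, h2] at e01 e02 e11 e12 e22
  set a := S.mat g 0 0 with ha
  have ha0 : a ≠ 0 := by intro h; simp [h] at e02
  have ha' : S.conj a ≠ 0 := (map_ne_zero _).2 ha0
  have h21 : S.mat g 2 1 = 0 := by simpa [ha0] using e01
  simp [h21] at e11 e12
  have h22 : S.mat g 2 2 = (S.conj a)⁻¹ := by
    have := congrArg S.conj e02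
    rw [map_mul, S.conj_invol, map_one] at this
    exact eq_inv_of_mul_eq_one_right this
  set b := S.mat g 1 1 with hb
  have hb0 : b ≠ 0 := by intro h; simp [h] at e11
  have hcb : S.conj b = b⁻¹ := (inv_eq_of_mul_eq_one_right e11).symm
  rw [h22] at e12 e22
  simp only [map_inv₀, S.conj_invol] at e12 e22
  have h12 : S.mat g 1 2 = -b * S.conj (S.mat g 0 1) * (S.conj a)⁻¹ := by
    have := congrArg S.conj e12
    simp only [map_add, map_mul, map_inv₀, S.conj_invol, map_zero, hcb] at this
    field_simp at this ⊢
    linear_combination this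
  have hrel : (S.mat g 0 1 * a⁻¹) * S.conj (S.mat g 0 1 * a⁻¹) + S.mat g 0 2 * a⁻¹ +
      S.conj (S.mat g 0 2 * a⁻¹) = 0 := by
    rw [h12] at e22
    simp only [map_mul, map_neg, map_inv₀, S.conj_invol, hcb] at e22 ⊢
    field_simp at e22 ⊢
    linear_combination e22
  refine ⟨hE a b ha0 e11, hE_mem _ _ _ _, nE _ _ hrel, nE_mem _ _ _, ?_, rfl⟩
  apply mat_injective
  ext i j
  rw [mat_mul_apply]
  fin_cases i <;> fin_cases j <;>
    simp [nM, h1, h2, h21, h22, h12, ← ha, ← hb] <;> field_simp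

/-- The factorization `G ∩ {g₀₀ ≠ 0} = N' H N`. -/
lemma exists_n'hn {g : S.GG} (h0 : S.mat g 0 0 ≠ 0) :
    ∃ hr, ∃ h ∈ S.Hset, ∃ n ∈ S.Nset,
      g = n'E (S.mat g 1 0 / S.mat g 0 0) (S.mat g 2 0 / S.mat g 0 0) hr * h * n ∧
      S.mat h 0 0 = S.mat g 0 0 := by
  have hc : S.conj (S.mat g 0 0) ≠ 0 := (map_ne_zero _).2 h0
  have e00 := mat_form_apply g 0 0
  simp [betaM] at e00
  have hr : S.mat g 1 0 / S.mat g 0 0 * S.conj (S.mat g 1 0 / S.mat g 0 0) +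
      S.mat g 2 0 / S.mat g 0 0 + S.conj (S.mat g 2 0 / S.mat g 0 0) = 0 := by
    simp only [map_div₀]
    field_simp
    linear_combination e00
  refine ⟨hr, ?_⟩
  set n' := n'E _ _ hr with hn'
  have hcol : ∀ i, S.mat (n'⁻¹ * g) i 0 = if i = 0 then S.mat g 0 0 else 0 := by
    intro i
    rw [mat_mul_apply, hn', n'E_inv]
    fin_cases i <;> simp [n'M, map_div₀]
    · field_simp; ring
    · field_simp; linear_combination e00
  obtain ⟨h, hh, n, hn, he, hm⟩ := exists_hn (g := n'⁻¹ * g) (by simp [hcol]) (by simp [hcol])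
  refine ⟨h, hh, n, hn, ?_, by rw [hm, hcol]; simp⟩
  rw [mul_assoc, ← he, mul_inv_cancel_left]

end Setting
end U21

namespace U21
namespace Setting
variable {S : Setting}

/-! ### Lattices of matrices and the parahoric subgroups -/

/-- Matrices whose `(i,j)` entry lies in `p_E ^ (a i j)`. -/
def Lat (a : Fin 3 → Fin 3 → ℤ) (M : S.M3) : Prop := ∀ i j, M i j ∈ S.pE (a i j)

/-- The exponents of the order attached to `K₁`. -/
def kM : Fin 3 → Fin 3 → ℤ := ![![0, 0, -1], ![1, 0, 0], ![1, 1, 0]]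
/-- The exponents of the radical of the order attached to `K₁`. -/
def rM : Fin 3 → Fin 3 → ℤ := ![![1, 0, 0], ![1, 1, 0], ![2, 1, 1]]
/-- The exponents of the Iwahori order. -/
def iM : Fin 3 → Fin 3 → ℤ := ![![0, 0, -1], ![1, 0, 0], ![2, 1, 0]]
/-- The exponents of the radical of the Iwahori order. -/
def i1M : Fin 3 → Fin 3 → ℤ := ![![1, 0, -1], ![1, 1, 0], ![2, 1, 1]]
/-- The exponents of the radical of the opposite Iwahori order. -/
def i1'M : Fin 3 → Fin 3 → ℤ := ![![1, 0, 0], ![1, 1, 0], ![1, 1, 1]]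

lemma Lat.mul {a b c : Fin 3 → Fin 3 → ℤ} {M N : S.M3} (hM : Lat a M) (hN : Lat b N)
    (h : ∀ i j k, c i j ≤ a i k + b k j) : Lat c (M * N) := by
  intro i j
  rw [Matrix.mul_apply, Fin.sum_univ_three]
  exact pE_add (pE_add (pE_mul' (hM i 0) (hN 0 j) (h _ _ _)) (pE_mul' (hM i 1) (hN 1 j) (h _ _ _)))
    (pE_mul' (hM i 2) (hN 2 j) (h _ _ _))

lemma Lat.add {a : Fin 3 → Fin 3 → ℤ} {M N : S.M3} (hM : Lat a M) (hN : Lat a N) :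
    Lat a (M + N) := fun i j => pE_add (hM i j) (hN i j)

lemma Lat.mono {a b : Fin 3 → Fin 3 → ℤ} {M : S.M3} (hM : Lat a M) (h : ∀ i j, b i j ≤ a i j) :
    Lat b M := fun i j => pE_mono (h i j) (hM i j)

lemma Lat.inv {a : Fin 3 → Fin 3 → ℤ} {g : S.GG} (hg : Lat a (S.mat g))
    (h : ∀ i j, a i j ≤ a j.rev i.rev) : Lat a (S.mat g⁻¹) := by
  intro i j
  rw [mat_inv_apply]
  exact pE_mono (h i j) (pE_conj (hg _ _))

lemma mem_K1_iff {g : S.GG} : g ∈ S.K1set ↔ Lat kM (S.mat g) := by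
  constructor
  · rintro ⟨h1, h2, h3, h4, h5, h6, h7, h8, h9⟩ i j
    fin_cases i <;> fin_cases j <;> simp [kM, pE_zero_iff, *]
  · intro h
    refine ⟨?_, ?_, h 0 2, h 1 0, ?_, ?_, h 2 0, h 2 1, ?_⟩ <;> rw [← pE_zero_iff]
    exacts [h 0 0, h 0 1, h 1 1, h 1 2, h 2 2]

lemma mem_IK1_iff {g : S.GG} : g ∈ S.IK1 ↔ Lat iM (S.mat g) := by
  constructor
  · rintro ⟨hk, h'⟩ i j
    have h := mem_K1_iff.1 hk i j
    fin_cases i <;> fin_cases j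
    all_goals first | exact h' | exact h
  · intro h
    exact ⟨mem_K1_iff.2 (h.mono (by decide)), h 2 0⟩

lemma mem_I1K1_iff {g : S.GG} : g ∈ S.I1K1 ↔ Lat i1M (S.mat g - 1) := by
  constructor
  · rintro ⟨hk, h0, h1, h2⟩ i j
    have h := mem_IK1_iff.1 hk i j
    fin_cases i <;> fin_cases j <;> simp [iM, i1M, Matrix.one_apply] at h ⊢ <;> assumption
  · intro h
    refine ⟨mem_IK1_iff.2 ?_, ?_, ?_, ?_⟩
    · have h1 : Lat iM (1 : S.M3) := by
        intro i j
        fin_cases i <;> fin_cases j <;>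
          simp [iM, zero_mem_pE, one_mem_pE]
      simpa using (h.mono (b := iM) (by decide)).add h1
    · simpa [i1M] using h 0 0
    · simpa [i1M] using h 1 1
    · simpa [i1M] using h 2 2

lemma mem_I1'K1_iff {g : S.GG} : g ∈ S.I1'K1 ↔ Lat i1'M (S.mat g - 1) := by
  constructor
  · rintro ⟨hk, h', h0, h1, h2⟩ i j
    rw [← pE_zero_iff] at h'
    have h := mem_K1_iff.1 hk i j
    fin_cases i <;> fin_cases j <;> simp [kM, i1'M, Matrix.one_apply] at h ⊢ <;> assumption
  · intro h
    refine ⟨mem_K1_iff.2 ?_, ?_, ?_, ?_, ?_⟩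
    · have h1 : Lat kM (1 : S.M3) := by
        intro i j
        fin_cases i <;> fin_cases j <;>
          simp [kM, zero_mem_pE, one_mem_pE]
      simpa using (h.mono (b := kM) (by decide)).add h1
    · rw [← pE_zero_iff]; simpa [i1'M, Matrix.one_apply] using h 0 2
    · simpa [i1'M] using h 0 0
    · simpa [i1'M] using h 1 1
    · simpa [i1'M] using h 2 2

lemma mem_Kone1_iff {g : S.GG} : g ∈ S.Kone1 ↔ Lat rM (S.mat g - 1) := by
  constructor
  · rintro ⟨hk, h', h'', h0, h1, h2⟩ i j
    rw [← pE_zero_iff] at h'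
    have h := mem_K1_iff.1 hk i j
    fin_cases i <;> fin_cases j <;> simp [kM, rM, Matrix.one_apply] at h ⊢ <;> assumption
  · intro h
    have hk : g ∈ S.I1'K1 := mem_I1'K1_iff.2 (h.mono (by decide))
    exact ⟨hk.1, hk.2.1, by simpa [rM, Matrix.one_apply] using h 2 0, hk.2.2⟩

lemma Kone1_sub_I1 {g : S.GG} (h : g ∈ S.Kone1) : g ∈ S.I1K1 :=
  mem_I1K1_iff.2 ((mem_Kone1_iff.1 h).mono (by decide))

lemma I1_sub_K1 {g : S.GG} (h : g ∈ S.I1K1) : g ∈ S.K1set := h.1.1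

lemma Kone1_sub_K1 {g : S.GG} (h : g ∈ S.Kone1) : g ∈ S.K1set := h.1

lemma K1_mul {g h : S.GG} (hg : g ∈ S.K1set) (hh : h ∈ S.K1set) : g * h ∈ S.K1set := by
  rw [mem_K1_iff] at *
  exact Lat.mul hg hh (by decide)

lemma K1_inv {g : S.GG} (hg : g ∈ S.K1set) : g⁻¹ ∈ S.K1set := by
  rw [mem_K1_iff] at *
  exact hg.inv (by decide)

lemma IK1_mul {g h : S.GG} (hg : g ∈ S.IK1) (hh : h ∈ S.IK1) : g * h ∈ S.IK1 := by
  rw [mem_IK1_iff] at *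
  exact Lat.mul hg hh (by decide)

lemma IK1_inv {g : S.GG} (hg : g ∈ S.IK1) : g⁻¹ ∈ S.IK1 := by
  rw [mem_IK1_iff] at *
  exact hg.inv (by decide)

/-- `K¹` is normal in `K₁`. -/
lemma Kone1_conj {g z : S.GG} (hg : g ∈ S.K1set) (hz : z ∈ S.Kone1) : g * z * g⁻¹ ∈ S.Kone1 := by
  have hg' := mem_K1_iff.1 (K1_inv hg)
  rw [mem_Kone1_iff] at *
  rw [mem_K1_iff] at hg
  have : S.mat (g * z * g⁻¹) - 1 = S.mat g * (S.mat z - 1) * S.mat g⁻¹ := by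
    rw [mul_sub, sub_mul, mul_one, ← mat_mul, ← mat_mul, ← mat_mul, mul_inv_cancel, mat_one]
  rw [this]
  exact Lat.mul (Lat.mul (c := rM) hg hz (by decide)) hg' (by decide)

/-- The bottom row of an element of `K₁` is primitive. -/
lemma K1_bottom {g : S.GG} (hg : g ∈ S.K1set) :
    ¬ (S.mat g 2 0 ∈ S.pE 2 ∧ S.mat g 2 1 ∈ S.pE 2 ∧ S.mat g 2 2 ∈ S.pE 1) := by
  rintro ⟨h0, h1, h2⟩
  have hg' := mem_K1_iff.1 (K1_inv hg)
  have h : S.mat (g * g⁻¹) 2 2 = 1 := by rw [mul_inv_cancel, mat_one]; simp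
  rw [mat_mul_apply] at h
  apply one_notMem_pE (S := S) le_rfl
  rw [← h]
  exact pE_add (pE_add (pE_mul' h0 (hg' 0 2) (by decide)) (pE_mul' h1 (hg' 1 2) (by decide)))
    (pE_mul' h2 (hg' 2 2) (by decide))

lemma nE_mem_I1 {x y : S.E} (h) (hy : y ∈ S.pE (-1)) : nE x y h ∈ S.I1K1 := by
  have hx : x ∈ S.pE 0 := pE_of_rel (by norm_num) h hy
  rw [mem_I1K1_iff]
  intro i j
  fin_cases i <;> fin_cases j <;>
    simp [i1M, nM, Matrix.one_apply, zero_mem_pE, hx, hy, pE_neg, pE_conj]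

lemma nE_mem_Kone1 {x y : S.E} (h) (hy : y ∈ S.pE 0) : nE x y h ∈ S.Kone1 := by
  have hx : x ∈ S.pE 0 := pE_of_rel (by norm_num) h hy
  rw [mem_Kone1_iff]
  intro i j
  fin_cases i <;> fin_cases j <;>
    simp [rM, nM, Matrix.one_apply, zero_mem_pE, hx, hy, pE_neg, pE_conj]

lemma n'E_mem_Kone1 {x y : S.E} (h) (hy : y ∈ S.pE 2) : n'E x y h ∈ S.Kone1 := by
  have hx : x ∈ S.pE 1 := pE_of_rel (by norm_num) h hy
  rw [mem_Kone1_iff]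
  intro i j
  fin_cases i <;> fin_cases j <;>
    simp [rM, n'M, Matrix.one_apply, zero_mem_pE, hx, hy, pE_neg, pE_conj]

lemma n'E_mem_I1' {x y : S.E} (h) (hy : y ∈ S.pE 1) : n'E x y h ∈ S.I1'K1 := by
  have hx : x ∈ S.pE 1 := pE_of_rel (by norm_num) h hy
  rw [mem_I1'K1_iff]
  intro i j
  fin_cases i <;> fin_cases j <;>
    simp [i1'M, n'M, Matrix.one_apply, zero_mem_pE, hx, hy, pE_neg, pE_conj]

lemma Nk_sub_I1 {g : S.GG} (hg : g ∈ S.Nk (-1)) : g ∈ S.I1K1 := by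
  obtain ⟨h1, h2⟩ := mem_Nk_iff.1 hg
  obtain ⟨x, y, h, rfl⟩ := exists_nE h1
  exact nE_mem_I1 h (by simpa [nM] using h2)

lemma Nk_sub_Kone1 {g : S.GG} (hg : g ∈ S.Nk 0) : g ∈ S.Kone1 := by
  obtain ⟨h1, h2⟩ := mem_Nk_iff.1 hg
  obtain ⟨x, y, h, rfl⟩ := exists_nE h1
  exact nE_mem_Kone1 h (by simpa [nM] using h2)

lemma Nk_of_K1 {g : S.GG} (h : g ∈ S.Nset) (hk : g ∈ S.K1set) : g ∈ S.Nk (-1) :=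
  mem_Nk_iff.2 ⟨h, hk.2.2.1⟩

lemma isVal_of_norm_one {b : S.E} (hb : b * S.conj b = 1) : S.IsVal 0 b := by
  have hb0 : b ≠ 0 := by rintro rfl; simp at hb
  have h1 : b ∈ S.pE 0 := pE_of_norm (k := 0) (by norm_num) (by rw [hb]; exact one_mem_pE)
  refine ⟨hb0, h1, ?_⟩
  rw [inv_eq_of_mul_eq_one_right hb]
  simpa using pE_conj h1

lemma hE_mem_IK1 {a b : S.E} (ha hb) (hv : S.IsVal 0 a) : hE a b ha hb ∈ S.IK1 := by
  have hb' := (isVal_of_norm_one hb).2.1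
  have hc : (S.conj a)⁻¹ ∈ S.pE 0 := by simpa using hv.conj.inv.2.1
  rw [mem_IK1_iff]
  intro i j
  fin_cases i <;> fin_cases j <;> simp [iM, zero_mem_pE, hb', hc, hv.2.1]

lemma hE_mem_I1 {a b : S.E} (ha hb) (hv : a - 1 ∈ S.pE 1) (hb1 : b - 1 ∈ S.pE 1) :
    hE a b ha hb ∈ S.I1K1 := by
  have h0 : S.IsVal 0 a := by
    refine isVal_of_mem_of_notMem ?_ ?_
    · have := pE_add (pE_mono (by norm_num) hv) (one_mem_pE (S := S))
      simpa using this
    · intro h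
      have := pE_sub h hv
      simp at this
      exact one_notMem_pE le_rfl this
  have hb' := (isVal_of_norm_one hb).2.1
  have hc : (S.conj a)⁻¹ - 1 ∈ S.pE 1 := by
    have h1 : (S.conj a)⁻¹ - 1 = (S.conj a)⁻¹ * (-(S.conj (a - 1))) := by
      have := h0.conj.1
      rw [map_sub, map_one]; field_simp; ring
    rw [h1]
    exact pE_mul' h0.conj.inv.2.1 (pE_neg (pE_conj hv)) (by norm_num)
  rw [mem_I1K1_iff]
  intro i j
  fin_cases i <;> fin_cases j <;> simp [i1M, zero_mem_pE, hb1, hc, hv]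

lemma betaPr_mem : S.betaPr ∈ S.K1set := by
  rw [mem_K1_iff, mat_betaPr]
  have h1 : S.ϖ⁻¹ ∈ S.pE (-1) := isVal_unif.inv.2.1
  have h2 : S.ϖ ∈ S.pE 1 := isVal_unif.2.1
  intro i j
  fin_cases i <;> fin_cases j <;> simp [kM, zero_mem_pE, one_mem_pE, h1, h2]

/-! ### The generator of `N_{-1}` modulo `N_0` -/

lemma rel_traceless {y : S.E} (h : S.conj y = -y) : (0 : S.E) * S.conj 0 + y + S.conj y = 0 := by
  rw [h]; simp

lemma conj_natCast (a : ℕ) : S.conj (a : S.E) = a := map_natCast _ _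

/-- The trace-zero element `a τ ϖ⁻¹`. -/
lemma conj_natCast_tz_unif (a : ℕ) : S.conj (a * S.tz * S.ϖ⁻¹) = -(a * S.tz * S.ϖ⁻¹) := by
  rw [map_mul, map_mul, map_inv₀, conj_natCast, conj_tz, S.unif_conj]; ring

/-- A generator of `N_{-1}` modulo `N_0`. -/
def uE (S : Setting) : S.GG := nE 0 ((1 : ℕ) * S.tz * S.ϖ⁻¹) (rel_traceless (conj_natCast_tz_unif _))

lemma nE_ext {x y x' y' : S.E} {h h'} (hx : x = x') (hy : y = y') : nE x y h = nE x' y' h' := by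
  subst hx hy; rfl

lemma uE_pow (a : ℕ) :
    S.uE ^ a = nE 0 ((a : S.E) * S.tz * S.ϖ⁻¹) (rel_traceless (conj_natCast_tz_unif _)) := by
  induction a with
  | zero =>
    apply mat_injective
    rw [pow_zero, mat_one]
    ext i j; fin_cases i <;> fin_cases j <;> simp [nM]
  | succ a ih =>
    rw [pow_succ, ih, uE, nE_mul]
    refine nE_ext (by simp) ?_
    push_cast
    simp
    ring

lemma uE_pow_mem (a : ℕ) : S.uE ^ a ∈ S.Nk (-1) := by
  rw [uE_pow, mem_Nk_iff]
  refine ⟨nE_mem _ _ _, ?_⟩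
  simp [nM]
  exact pE_mul' (pE_mul ((S.pE_zero_iff _).2 (natCast_mem_O a)) isVal_tz.2.1) isVal_unif.inv.2.1
    (by norm_num)

lemma uE_mem : S.uE ∈ S.Nk (-1) := by simpa using uE_pow_mem (S := S) 1

lemma uE_pow_p_mem : S.uE ^ S.p ∈ S.Nk 0 := by
  rw [uE_pow, mem_Nk_iff]
  refine ⟨nE_mem _ _ _, ?_⟩
  simp [nM]
  exact pE_mul' (pE_mul ((natCast_mem_pE_one_iff _).2 dvd_rfl) isVal_tz.2.1) isVal_unif.inv.2.1
    (by norm_num)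

lemma exists_uE_pow (hqp : S.q = S.p) {n : S.GG} (hn : n ∈ S.Nk (-1)) :
    ∃ a < S.p, ∃ n0 ∈ S.Nk 0, n = S.uE ^ a * n0 := by
  obtain ⟨h1, h2⟩ := mem_Nk_iff.1 hn
  obtain ⟨x, y, h, rfl⟩ := exists_nE h1
  have hy : y ∈ S.pE (-1) := by simpa [nM] using h2
  have hx : x ∈ S.pE 0 := pE_of_rel (by norm_num) h hy
  have ht := tz_ne (S := S)
  have hu := S.unif_ne
  have hti : (S.tz)⁻¹ ∈ S.pE 0 := by simpa using isVal_tz.inv.2.1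
  have hz : y * S.ϖ * S.tz⁻¹ ∈ S.O := by
    rw [← pE_zero_iff]
    exact pE_mul' (pE_mul hy isVal_unif.2.1) hti (by norm_num)
  obtain ⟨a, ha, hza⟩ := exists_nat_of_conj_fixed hqp hz (by
    have : S.conj (y * S.ϖ * S.tz⁻¹) - y * S.ϖ * S.tz⁻¹ = (x * S.conj x) * S.ϖ * S.tz⁻¹ := by
      rw [map_mul, map_mul, map_inv₀, conj_tz, S.unif_conj]
      field_simp
      linear_combination -h
    rw [this]
    exact pE_mul' (pE_mul (pE_mul hx (pE_conj hx)) isVal_unif.2.1) hti (by norm_num))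
  refine ⟨a, ha, (S.uE ^ a)⁻¹ * nE x y h, ?_, by rw [mul_inv_cancel_left]⟩
  rw [uE_pow, nE_inv, nE_mul, mem_Nk_iff]
  refine ⟨nE_mem _ _ _, ?_⟩
  rw [mat_nE, conj_natCast_tz_unif]
  simp only [nM, Matrix.of_apply, Matrix.cons_val', Matrix.cons_val_zero, Matrix.cons_val]
  have : -(a * S.tz * S.ϖ⁻¹) + y - -0 * S.conj x = (y * S.ϖ * S.tz⁻¹ - a) * S.tz * S.ϖ⁻¹ := by
    field_simp; ring
  rw [this]
  exact pE_mul' (pE_mul hza isVal_tz.2.1) isVal_unif.inv.2.1 (by norm_num)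

end Setting
end U21

namespace U21
namespace Setting
variable {S : Setting}

/-! ### Decompositions -/

lemma mat_Nset_mul_bottom {n w : S.GG} (hn : n ∈ S.Nset) (j : Fin 3) :
    S.mat (n * w) 2 j = S.mat w 2 j := by
  obtain ⟨x, y, h, rfl⟩ := exists_nE hn
  rw [mat_mul_apply]; simp [nM]

lemma alpha_N_bottom {k : ℤ} {n w : S.GG} (hn : n ∈ S.Nset)
    (hk : S.alphaE ^ k * n * w ∈ S.K1set) :
    ¬ (S.mat w 2 0 ∈ S.pE (2 - k) ∧ S.mat w 2 1 ∈ S.pE (2 - k) ∧ S.mat w 2 2 ∈ S.pE (1 - k)) := by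
  rintro ⟨h0, h1, h2⟩
  have e : ∀ j, S.mat (S.alphaE ^ k * n * w) 2 j = S.ϖ ^ k * S.mat w 2 j := by
    intro j
    rw [mul_assoc, mat_mul_apply, mat_alphaE_zpow, mat_Nset_mul_bottom hn]; simp
  apply K1_bottom hk
  rw [e, e, e]
  have hu : S.ϖ ^ k ∈ S.pE k := unif_zpow_mem le_rfl
  exact ⟨pE_mul' hu h0 (by omega), pE_mul' hu h1 (by omega), pE_mul' hu h2 (by omega)⟩

lemma col_zero_ne {g : S.GG} (h : S.mat g 2 0 = 0) : S.mat g 0 0 ≠ 0 := by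
  intro h0
  have e := mat_form_apply g 0 2
  have e0 := mat_form_apply g 0 0
  simp [betaM, h, h0] at e e0
  simp [e0] at e

lemma IK1_isVal {i : S.GG} (hi : i ∈ S.IK1) : S.IsVal 0 (S.mat i 0 0) := by
  have h1 := mem_IK1_iff.1 hi
  have h2 := mem_IK1_iff.1 (IK1_inv hi)
  refine isVal_of_mem_of_notMem (h1 0 0) fun h => ?_
  have e : S.mat (i * i⁻¹) 0 0 = 1 := by rw [mul_inv_cancel, mat_one]; simp
  rw [mat_mul_apply] at e
  apply one_notMem_pE (S := S) le_rfl
  rw [← e]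
  exact pE_add (pE_add (pE_mul' h (h2 0 0) (by decide)) (pE_mul' (h1 0 1) (h2 1 0) (by decide)))
    (pE_mul' (h1 0 2) (h2 2 0) (by decide))

/-- The Iwahori factorization. -/
lemma IK1_decomp {i : S.GG} (hi : i ∈ S.IK1) :
    ∃ x y hr, y ∈ S.pE 2 ∧ ∃ h ∈ S.Hset, h ∈ S.IK1 ∧ ∃ n ∈ S.Nk (-1), i = n'E x y hr * h * n := by
  have hv := IK1_isVal hi
  obtain ⟨hr, h, hh, n, hn, e, hm⟩ := exists_n'hn hv.1
  have hy : S.mat i 2 0 / S.mat i 0 0 ∈ S.pE 2 := by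
    have h20 : S.mat i 2 0 ∈ S.pE 2 := hi.2
    rw [div_eq_mul_inv]
    exact pE_mul' h20 hv.inv.2.1 (by norm_num)
  have hI : h ∈ S.IK1 := by
    obtain ⟨a, b, ha, hb, rfl⟩ := exists_hE hh
    refine hE_mem_IK1 _ _ ?_
    have : a = S.mat i 0 0 := by rw [← hm]; simp
    rwa [this]
  refine ⟨_, _, hr, hy, h, hh, hI, n, Nk_of_K1 hn ?_, e⟩
  have : n = h⁻¹ * ((n'E _ _ hr)⁻¹ * i) := by
    rw [eq_inv_mul_iff_mul_eq, eq_inv_mul_iff_mul_eq, ← mul_assoc]; exact e.symm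
  rw [this]
  exact K1_mul (K1_inv hI.1) (K1_mul (K1_inv (n'E_mem_Kone1 _ hy).1) hi.1)

/-- The Iwahori factorization in the opposite order. -/
lemma IK1_decomp' {i : S.GG} (hi : i ∈ S.IK1) :
    ∃ n ∈ S.Nk (-1), ∃ h ∈ S.Hset, h ∈ S.IK1 ∧ ∃ x y hr, y ∈ S.pE 2 ∧ i = n * h * n'E x y hr := by
  obtain ⟨x, y, hr, hy, h, hh, hI, n, hn, e⟩ := IK1_decomp (IK1_inv hi)
  refine ⟨n⁻¹, Nk_inv hn, h⁻¹, ?_, IK1_inv hI, -x, S.conj y, rel_symm hr, pE_conj hy, ?_⟩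
  · obtain ⟨a, b, ha, hb, rfl⟩ := exists_hE hh
    rw [hE_inv]; exact hE_mem _ _ _ _
  · rw [← n'E_inv x y hr, ← inv_inv i, e]; group

lemma iwasawa_aux {g : S.GG} (h0 : S.mat g 0 0 ≠ 0) (h1 : S.mat g 2 0 / S.mat g 0 0 ∈ S.pE 1) :
    ∃ κ ∈ S.K1set, ∃ m : ℤ, ∃ n ∈ S.Nset, g = κ * S.alphaE ^ m * n := by
  obtain ⟨hr, h, hh, n, hn, e, -⟩ := exists_n'hn h0
  obtain ⟨a, b, ha, hb, rfl⟩ := exists_hE hh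
  obtain ⟨k, hk⟩ := exists_isVal ha
  have hva : S.IsVal 0 (a * S.ϖ ^ (-k)) := by simpa using hk.mul (isVal_zpow (S := S) (-k))
  have e2 : hE a b ha hb = hE (a * S.ϖ ^ (-k)) b hva.1 hb * S.alphaE ^ (-k) := by
    apply mat_injective
    have := S.unif_ne
    ext i j
    rw [mat_mul_apply, mat_alphaE_zpow]
    fin_cases i <;> fin_cases j <;> simp [S.unif_conj] <;> field_simp
  refine ⟨n'E _ _ hr * hE (a * S.ϖ ^ (-k)) b hva.1 hb,
    K1_mul (n'E_mem_I1' _ h1).1 (hE_mem_IK1 _ _ hva).1, -k, n, hn, ?_⟩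
  refine e.trans ?_
  rw [e2]; group

/-- The Iwasawa decomposition relative to `K₁`. -/
lemma iwasawa (g : S.GG) :
    ∃ κ ∈ S.K1set, ∃ m : ℤ, ∃ n ∈ S.Nset, g = κ * S.alphaE ^ m * n := by
  by_cases hA : S.mat g 0 0 ≠ 0 ∧ S.mat g 2 0 / S.mat g 0 0 ∈ S.pE 1
  · exact iwasawa_aux hA.1 hA.2
  have h20 : S.mat g 2 0 ≠ 0 := by
    intro h
    exact hA ⟨col_zero_ne h, by rw [h, zero_div]; exact zero_mem_pE _⟩
  have e0 : S.mat (S.betaPr * g) 0 0 = S.ϖ⁻¹ * S.mat g 2 0 := by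
    rw [mat_mul_apply, mat_betaPr]; simp
  have e2 : S.mat (S.betaPr * g) 2 0 = S.ϖ * S.mat g 0 0 := by
    rw [mat_mul_apply, mat_betaPr]; simp
  have hu := S.unif_ne
  have key : S.mat g 0 0 / S.mat g 2 0 ∈ S.pE (-1) := by
    by_cases h0 : S.mat g 0 0 = 0
    · rw [h0, zero_div]; exact zero_mem_pE _
    · have h1 : S.mat g 2 0 / S.mat g 0 0 ∉ S.pE 1 := fun h => hA ⟨h0, h⟩
      obtain ⟨k, hk⟩ := exists_isVal (div_ne_zero h20 h0)
      rw [hk.mem_iff] at h1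
      have := hk.inv.2.1
      rw [inv_div] at this
      exact pE_mono (by omega) this
  obtain ⟨κ, hκ, m, n, hn, e⟩ := iwasawa_aux (g := S.betaPr * g)
    (by rw [e0]; exact mul_ne_zero (inv_ne_zero hu) h20) (by
      rw [e0, e2]
      have : S.ϖ * S.mat g 0 0 / (S.ϖ⁻¹ * S.mat g 2 0) =
          S.ϖ * S.ϖ * (S.mat g 0 0 / S.mat g 2 0) := by field_simp
      rw [this]
      exact pE_mul' (pE_mul isVal_unif.2.1 isVal_unif.2.1) key (by norm_num))
  refine ⟨S.betaPr * κ, K1_mul betaPr_mem hκ, m, n, hn, ?_⟩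
  rw [mul_assoc, mul_assoc, ← mul_assoc κ, ← e, ← mul_assoc, betaPr_mul_self, one_mul]

/-- The Bruhat decomposition of `K₁`, when `q = p`. -/
lemma bruhat (hqp : S.q = S.p) {k : S.GG} (hk : k ∈ S.K1set) :
    k ∈ S.IK1 ∨ ∃ a < S.p, ∃ i ∈ S.IK1, k = S.uE ^ a * S.betaPr * i := by
  by_cases h : S.mat k 2 0 ∈ S.pE 2
  · exact Or.inl ⟨hk, h⟩
  right
  have hl := mem_K1_iff.1 hk
  have hv : S.IsVal 1 (S.mat k 2 0) := isVal_of_mem_of_notMem (hl 2 0) h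
  have ht := tz_ne (S := S)
  have hu := S.unif_ne
  have h20 := hv.1
  have h20c := hv.conj.1
  have hz : S.mat k 0 0 * S.ϖ * S.tz⁻¹ * (S.mat k 2 0)⁻¹ ∈ S.O := by
    rw [← pE_zero_iff]
    exact pE_mul' (pE_mul (pE_mul (hl 0 0) isVal_unif.2.1) isVal_tz.inv.2.1) hv.inv.2.1 (by decide)
  obtain ⟨a, ha, hza⟩ := exists_nat_of_conj_fixed hqp hz (by
    have e0 := mat_form_apply k 0 0
    simp [betaM] at e0
    have : S.conj (S.mat k 0 0 * S.ϖ * S.tz⁻¹ * (S.mat k 2 0)⁻¹) -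
        S.mat k 0 0 * S.ϖ * S.tz⁻¹ * (S.mat k 2 0)⁻¹ =
        S.mat k 1 0 * S.conj (S.mat k 1 0) * S.ϖ * S.tz⁻¹ *
          ((S.mat k 2 0)⁻¹ * (S.conj (S.mat k 2 0))⁻¹) := by
      rw [map_mul, map_mul, map_mul, map_inv₀, map_inv₀, conj_tz, S.unif_conj]
      field_simp
      linear_combination -e0
    rw [this]
    exact pE_mul' (pE_mul (pE_mul (pE_mul (hl 1 0) (pE_conj (hl 1 0))) isVal_unif.2.1)
      isVal_tz.inv.2.1) (pE_mul hv.inv.2.1 hv.conj.inv.2.1) (by decide))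
  refine ⟨a, ha, S.betaPr * ((S.uE ^ a)⁻¹ * k), ⟨?_, ?_⟩, ?_⟩
  · exact K1_mul betaPr_mem (K1_mul (K1_inv (Nk_sub_I1 (uE_pow_mem a)).1.1) hk)
  · have : S.mat (S.betaPr * ((S.uE ^ a)⁻¹ * k)) 2 0 =
        (S.mat k 0 0 * S.ϖ * S.tz⁻¹ * (S.mat k 2 0)⁻¹ - a) * S.tz * S.mat k 2 0 := by
      rw [mat_mul_apply, mat_mul_apply, uE_pow, nE_inv, mat_betaPr, mat_nE]
      simp [nM, conj_tz, S.unif_conj]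
      field_simp
      ring
    rw [this]
    exact pE_mul' (pE_mul hza isVal_tz.2.1) hv.2.1 (by norm_num)
  · rw [mul_assoc, ← mul_assoc S.betaPr, betaPr_mul_self, one_mul, mul_inv_cancel_left]

/-! ### The rank one relation -/

/-- The torus element `diag(z, 1, z̄⁻¹)`. -/
def dE (z : S.E) (hz : z ≠ 0) : S.GG := hE z 1 hz (by simp)

lemma conj_inv_traceless {c : S.E} (h : S.conj c = -c) : S.conj c⁻¹ = -c⁻¹ := by
  rw [map_inv₀, h, inv_neg]

lemma n'E_traceless {c : S.E} (hc : c ≠ 0) (h : S.conj c = -c) :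
    n'E 0 (c * S.ϖ) (rel_traceless (by rw [map_mul, h, S.unif_conj]; ring)) =
      nE 0 (c⁻¹ * S.ϖ⁻¹)
        (rel_traceless (by rw [map_mul, conj_inv_traceless h, map_inv₀, S.unif_conj]; ring)) *
      dE (-c⁻¹) (neg_ne_zero.2 (inv_ne_zero hc)) * S.betaPr *
      nE 0 (c⁻¹ * S.ϖ⁻¹)
        (rel_traceless (by rw [map_mul, conj_inv_traceless h, map_inv₀, S.unif_conj]; ring)) := by
  have hu := S.unif_ne
  apply mat_injective
  ext i j
  simp only [mat_mul_apply, mat_betaPr]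
  fin_cases i <;> fin_cases j <;>
    simp [n'M, nM, dE, h, hu, hc, conj_inv_traceless] <;> field_simp <;> ring

lemma beta_uE_beta (a : ℕ) :
    S.betaPr * S.uE ^ a * S.betaPr = n'E 0 ((a * S.tz : S.E) * S.ϖ)
      (rel_traceless (by rw [map_mul, map_mul, conj_natCast, conj_tz, S.unif_conj]; ring)) := by
  rw [uE_pow, beta_conj_nE]
  apply mat_injective
  have hu := S.unif_ne
  simp only [mat_n'E]
  ext i j
  fin_cases i <;> fin_cases j <;> simp [n'M, S.unif_conj] <;> field_simp

lemma beta_uE_beta_mem (a : ℕ) : S.betaPr * S.uE ^ a * S.betaPr ∈ S.I1'K1 := by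
  rw [beta_uE_beta]
  exact n'E_mem_I1' _ (pE_mul' (pE_mul ((S.pE_zero_iff _).2 (natCast_mem_O a)) isVal_tz.2.1)
    isVal_unif.2.1 (by norm_num))

lemma beta_uE_beta_notMem {a : ℕ} (h0 : 0 < a) (ha : a < S.p) :
    S.betaPr * S.uE ^ a * S.betaPr ∉ S.IK1 := by
  intro h
  have h := h.2
  rw [beta_uE_beta] at h
  simp [n'M] at h
  have hv := ((isVal_natCast (S := S) (a := a)
    (fun hd => absurd (Nat.le_of_dvd h0 hd) (by omega))).mul isVal_tz).mul isVal_unif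
  rw [hv.mem_iff] at h
  norm_num at h

lemma beta_Nk0_mem {n : S.GG} (hn : n ∈ S.Nk 0) : S.betaPr * n * S.betaPr ∈ S.Kone1 := by
  have := Kone1_conj betaPr_mem (Nk_sub_Kone1 hn)
  rwa [betaPr_inv] at this

lemma dE_mem_Hset (z : S.E) (hz) : dE z hz ∈ S.Hset := hE_mem _ _ _ _

lemma dE_mem_IK1 {z : S.E} (hz) (hv : S.IsVal 0 z) : dE z hz ∈ S.IK1 := hE_mem_IK1 _ _ hv

lemma beta_dE_beta (z : S.E) (hz) : S.betaPr * dE z hz * S.betaPr =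
    dE (S.conj z)⁻¹ (inv_ne_zero ((map_ne_zero _).2 hz)) := beta_conj_hE _ _ _ _

lemma dE_mul (z w : S.E) (hz hw) : dE z hz * dE w hw = dE (z * w) (mul_ne_zero hz hw) := by
  rw [dE, dE, hE_mul]
  apply mat_injective
  simp [dE]

lemma beta_Hset {h : S.GG} (hh : h ∈ S.Hset) : S.betaPr * h * S.betaPr ∈ S.Hset := by
  obtain ⟨a, b, ha, hb, rfl⟩ := exists_hE hh
  rw [beta_conj_hE]; exact hE_mem _ _ _ _

lemma Hset_K1_IK1 {h : S.GG} (hh : h ∈ S.Hset) (hk : h ∈ S.K1set) : h ∈ S.IK1 := by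
  obtain ⟨a, b, ha, hb, rfl⟩ := exists_hE hh
  exact ⟨hk, by simp [zero_mem_pE]⟩

/-! ### Coset representatives -/

lemma exists_reps {A B : Set S.GG} (hB1 : ∀ a ∈ A, a⁻¹ * a ∈ B)
    (hBm : ∀ g ∈ B, ∀ h ∈ B, g * h ∈ B) (hBi : ∀ g ∈ B, g⁻¹ ∈ B)
    {ι : Type} [Finite ι] (φ : S.GG → ι)
    (hφ : ∀ a ∈ A, ∀ b ∈ A, φ a = φ b → a⁻¹ * b ∈ B) : ∃ U, S.IsReps A B U := by
  let r : A → A → Prop := fun a b => (a : S.GG)⁻¹ * b ∈ B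
  let s : Setoid A := ⟨r, fun a => hB1 a a.2,
    fun {a b} h => by have := hBi _ h; rwa [mul_inv_rev, inv_inv] at this,
    fun {a b c} h h' => by have := hBm _ h _ h'; rwa [mul_assoc, mul_inv_cancel_left] at this⟩
  have hfin : Finite (Quotient s) := by
    refine Finite.of_injective (fun x : Quotient s => φ (x.out : S.GG)) fun x y hxy => ?_
    have := hφ _ x.out.2 _ y.out.2 hxy
    rw [← Quotient.out_eq x, ← Quotient.out_eq y]
    exact Quotient.sound this
  have hf := Set.finite_range (fun x : Quotient s => (x.out : S.GG))
  refine ⟨hf.toFinset, ?_, ?_⟩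
  · rw [hf.coe_toFinset]
    rintro _ ⟨x, rfl⟩
    exact x.out.2
  · intro a ha
    refine ⟨((⟦⟨a, ha⟩⟧ : Quotient s).out : S.GG), ⟨by simp, ?_⟩, ?_⟩
    · have : r _ _ := Quotient.exact ((⟦⟨a, ha⟩⟧ : Quotient s).out_eq)
      exact s.symm this
    · rintro y ⟨hy, hy'⟩
      rw [hf.mem_toFinset] at hy
      obtain ⟨x, rfl⟩ := hy
      have : x = (⟦⟨a, ha⟩⟧ : Quotient s) := by
        rw [← Quotient.out_eq x]
        exact Quotient.sound (s.symm hy')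
      rw [this]

/-- Classes modulo `p_E`. -/
def cls (z : S.E) : Option S.kE := if h : z ∈ S.O then some (S.resmap ⟨z, h⟩) else none

lemma cls_eq {z w : S.E} (hz : z ∈ S.O) (hw : w ∈ S.O) (h : cls z = cls w) : z - w ∈ S.pE 1 := by
  rw [cls, cls, dif_pos hz, dif_pos hw, Option.some_inj, resmap_eq_iff] at h
  exact h

/-- The class of an element of `N₀` modulo `N₁`. -/
def clsN (g : S.GG) : Option S.kE × Option S.kE := (cls (S.mat g 0 1), cls (S.mat g 0 2))

lemma clsN_eq {a b : S.GG} (ha : a ∈ S.Nk 0) (hb : b ∈ S.Nk 0) (hab : clsN a = clsN b) :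
    a⁻¹ * b ∈ S.Nk 1 := by
  obtain ⟨ha1, ha2⟩ := mem_Nk_iff.1 ha
  obtain ⟨x, y, h, rfl⟩ := exists_nE ha1
  obtain ⟨hb1, hb2⟩ := mem_Nk_iff.1 hb
  obtain ⟨x', y', h', rfl⟩ := exists_nE hb1
  simp [nM, clsN] at ha2 hb2 hab
  have hx : x ∈ S.pE 0 := pE_of_rel (by norm_num) h ha2
  have hx' : x' ∈ S.pE 0 := pE_of_rel (by norm_num) h' hb2
  have ex := cls_eq ((S.pE_zero_iff _).1 hx) ((S.pE_zero_iff _).1 hx') hab.1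
  have ey := cls_eq ((S.pE_zero_iff _).1 ha2) ((S.pE_zero_iff _).1 hb2) hab.2
  rw [nE_inv, nE_mul, mem_Nk_iff]
  refine ⟨nE_mem _ _ _, ?_⟩
  simp [nM]
  have : S.conj y + y' + x * S.conj x' = -(y - y') - x * S.conj (x - x') := by
    rw [map_sub]; linear_combination h
  rw [this]
  exact pE_sub (pE_neg ey) (pE_mul' hx (pE_conj ex) (by norm_num))

lemma exists_reps_Nk_zero : ∃ U, S.IsReps (S.Nk 0) (S.Nk 1) U :=
  exists_reps (fun a _ => by rw [inv_mul_cancel]; exact one_mem_Nk _)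
    (fun _ hg _ hh => Nk_mul hg hh) (fun _ hg => Nk_inv hg) clsN
    fun _ ha _ hb hab => clsN_eq ha hb hab

lemma exists_reps_Nk_neg_one (hqp : S.q = S.p) : ∃ U, S.IsReps (S.Nk (-1)) (S.Nk 1) U := by
  have h : ∀ n : S.GG, ∃ a : Fin S.p, ∃ n0 ∈ S.Nk 0, n ∈ S.Nk (-1) → n = S.uE ^ (a : ℕ) * n0 := by
    intro n
    by_cases hn : n ∈ S.Nk (-1)
    · obtain ⟨a, ha, n0, h0, e⟩ := exists_uE_pow hqp hn
      exact ⟨⟨a, ha⟩, n0, h0, fun _ => e⟩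
    · exact ⟨⟨0, S.hp.pos⟩, 1, one_mem_Nk _, fun h => absurd h hn⟩
  choose a n0 h0 e using h
  refine exists_reps (fun a _ => by rw [inv_mul_cancel]; exact one_mem_Nk _)
    (fun _ hg _ hh => Nk_mul hg hh) (fun _ hg => Nk_inv hg) (fun g => (a g, clsN (n0 g))) ?_
  intro g hg h hh hgh
  rw [Prod.mk.injEq] at hgh
  have := clsN_eq (h0 g) (h0 h) hgh.2
  rw [e g hg, e h hh, hgh.1, mul_inv_rev, mul_assoc, inv_mul_cancel_left]
  exact this

end Setting
end U21

namespace U21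

/-! ### Cyclic modules over a cyclic group of order `p` in characteristic `p` -/

section Cyclic

variable {𝔽 : Type} [Field 𝔽] {V : Type} [AddCommGroup V] [Module 𝔽 V]

lemma exists_ker_of_nilpotent {X : Module.End 𝔽 V} {s : V} (hs : s ≠ 0) {n : ℕ}
    (hn : (X ^ n) s = 0) : ∃ m, (X ^ m) s ≠ 0 ∧ X ((X ^ m) s) = 0 := by
  induction n with
  | zero => exact absurd (by simpa using hn) hs
  | succ n ih =>
    by_cases h : (X ^ n) s = 0
    · exact ih h
    · exact ⟨n, h, by rwa [pow_succ', Module.End.mul_apply] at hn⟩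

/-- A stable nonzero subspace of a cyclic module over a unipotent operator contains every
fixed vector. -/
lemma mem_of_cyclic {U : Module.End 𝔽 V} {w v : V} {p : ℕ} [Fact p.Prime] [CharP 𝔽 p]
    (hp : ∀ a, (U ^ p) ((U ^ a) w) = (U ^ a) w)
    (hv : v ∈ Submodule.span 𝔽 (Set.range fun a : Fin p => (U ^ (a : ℕ)) w)) (hv0 : v ≠ 0)
    (hU : U v = v) {S0 : Submodule 𝔽 V}
    (hS : S0 ≤ Submodule.span 𝔽 (Set.range fun a : Fin p => (U ^ (a : ℕ)) w))
    (hSU : ∀ x ∈ S0, U x ∈ S0) (hS0 : S0 ≠ ⊥) : v ∈ S0 := by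
  set M := Submodule.span 𝔽 (Set.range fun a : Fin p => (U ^ (a : ℕ)) w) with hM
  have hpp : 0 < p := (Fact.out : p.Prime).pos
  have : FiniteDimensional 𝔽 M := FiniteDimensional.span_of_finite 𝔽 (Set.finite_range _)
  have hpow : ∀ a : ℕ, (U ^ a) w ∈ M := by
    intro a
    induction a using Nat.strong_induction_on with
    | _ a ih =>
      by_cases h : a < p
      · exact Submodule.subset_span ⟨⟨a, h⟩, rfl⟩
      · have : (U ^ a) w = (U ^ (a - p)) w := by
          rw [← hp (a - p), ← Module.End.mul_apply, ← pow_add]; congr 2; omega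
        rw [this]; exact ih _ (by omega)
  have hMU : ∀ x ∈ M, U x ∈ M := by
    intro x hx
    refine Submodule.span_induction (p := fun x _ => U x ∈ M) ?_ ?_ ?_ ?_ hx
    · rintro _ ⟨a, rfl⟩
      have := hpow (a + 1)
      rwa [pow_succ', Module.End.mul_apply] at this
    · simp
    · intro x y _ _ h h'; rw [map_add]; exact M.add_mem h h'
    · intro c x _ h; rw [map_smul]; exact M.smul_mem _ h
  have hMp : ∀ x ∈ M, (U ^ p) x = x := by
    intro x hx
    refine Submodule.span_induction (p := fun x _ => (U ^ p) x = x) ?_ ?_ ?_ ?_ hx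
    · rintro _ ⟨a, rfl⟩; exact hp a
    · simp
    · intro x y _ _ h h'; rw [map_add, h, h']
    · intro c x _ h; rw [map_smul, h]
  set X : Module.End 𝔽 V := U - 1 with hX
  have : Nontrivial V := ⟨⟨v, 0, hv0⟩⟩
  have : CharP (Module.End 𝔽 V) p :=
    charP_of_injective_algebraMap (FaithfulSMul.algebraMap_injective 𝔽 (Module.End 𝔽 V)) p
  have hXp : ∀ x ∈ M, (X ^ p) x = 0 := by
    intro x hx
    rw [hX, sub_pow_char_of_commute p (Commute.one_right U), one_pow, LinearMap.sub_apply, hMp x hx]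
    simp
  have hXM : ∀ x ∈ M, X x ∈ M := fun x hx => M.sub_mem (hMU x hx) hx
  let Y : Module.End 𝔽 M := X.restrict hXM
  have hw : w ∈ M := hpow 0
  have htop : LinearMap.range Y ⊔ Submodule.span 𝔽 {(⟨w, hw⟩ : M)} = ⊤ := by
    rw [eq_top_iff]
    have key : ∀ a : ℕ, (⟨(U ^ a) w, hpow a⟩ : M) ∈
        LinearMap.range Y ⊔ Submodule.span 𝔽 {(⟨w, hw⟩ : M)} := by
      intro a
      induction a with
      | zero => exact Submodule.mem_sup_right (Submodule.mem_span_singleton_self _)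
      | succ a ih =>
        have : (⟨(U ^ (a + 1)) w, hpow (a + 1)⟩ : M) =
            Y ⟨(U ^ a) w, hpow a⟩ + ⟨(U ^ a) w, hpow a⟩ := by
          apply Subtype.ext
          simp [Y, hX, pow_succ', LinearMap.restrict_apply]
        rw [this]
        exact Submodule.add_mem _ (Submodule.mem_sup_left ⟨_, rfl⟩) ih
    rintro ⟨x, hx⟩ -
    refine Submodule.span_induction (p := fun x hx => (⟨x, hx⟩ : M) ∈
      LinearMap.range Y ⊔ Submodule.span 𝔽 {(⟨w, hw⟩ : M)}) ?_ ?_ ?_ ?_ hx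
    · rintro _ ⟨a, rfl⟩; exact key a
    · exact Submodule.zero_mem _
    · intro x y hx hy h h'; exact Submodule.add_mem _ h h'
    · intro c x hx h; exact Submodule.smul_mem _ c h
  have hker : Module.finrank 𝔽 (LinearMap.ker Y) ≤ 1 := by
    have h1 := LinearMap.finrank_range_add_finrank_ker Y
    have h2 := Submodule.finrank_add_le_finrank_add_finrank (LinearMap.range Y)
      (Submodule.span 𝔽 {(⟨w, hw⟩ : M)})
    rw [htop, finrank_top] at h2
    have h3 := finrank_span_le_card (R := 𝔽) ({(⟨w, hw⟩ : M)} : Set M)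
    simp at h3
    omega
  obtain ⟨s, hs, hs0⟩ := S0.ne_bot_iff.1 hS0
  obtain ⟨m, hm0, hm1⟩ := exists_ker_of_nilpotent hs0 (hXp s (hS hs))
  have hmS : ∀ m, (X ^ m) s ∈ S0 := by
    intro m
    induction m with
    | zero => simpa
    | succ m ih =>
      rw [pow_succ', Module.End.mul_apply]
      exact S0.sub_mem (hSU _ ih) ih
  have e1 : (⟨(X ^ m) s, hS (hmS m)⟩ : M) ∈ LinearMap.ker Y := Subtype.ext hm1
  have e2 : (⟨v, hv⟩ : M) ∈ LinearMap.ker Y := Subtype.ext (by simp [Y, hX, hU])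
  obtain ⟨c, hc⟩ := finrank_le_one_iff.1 hker
  obtain ⟨c1, h1⟩ := hc ⟨_, e1⟩
  obtain ⟨c2, h2⟩ := hc ⟨_, e2⟩
  have hc1 : c1 ≠ 0 := by
    rintro rfl
    rw [zero_smul] at h1
    exact hm0 (congrArg (fun z => ((z : LinearMap.ker Y) : M).1) h1).symm
  have : v = (c2 * c1⁻¹) • (X ^ m) s := by
    have h1' : c1 • ((c : M) : V) = (X ^ m) s := congrArg (fun z => ((z : LinearMap.ker Y) : M).1) h1
    have h2' : c2 • ((c : M) : V) = v := congrArg (fun z => ((z : LinearMap.ker Y) : M).1) h2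
    rw [← h1', ← h2', smul_smul, mul_assoc, inv_mul_cancel₀ hc1, mul_one]
  rw [this]
  exact S0.smul_mem _ (hmS m)

/-- Data describing a vector of a representation of a rank one group with big cell
`⋃ uᵃ β I`, spanning a line stable under `I`, and such that `∑ uᵃ β v = 0`. -/
structure Special {Γ : Type} [Group Γ] (ρ : Representation 𝔽 Γ V) (p : ℕ) (u β : Γ) (I : Set Γ)
    (v : V) : Prop where
  hβ : β * β = 1
  dec : ∀ k, k ∈ I ∨ ∃ a < p, ∃ i ∈ I, k = u ^ a * β * i
  notMem : ∀ a, 0 < a → a < p → β * u ^ a * β ∉ I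
  line : ∀ i ∈ I, ∃ c : 𝔽, ρ i v = c • v
  fix : ρ u v = v
  pow : ρ (u ^ p) (ρ β v) = ρ β v
  sum : ∑ a ∈ Finset.range p, ρ (u ^ a) (ρ β v) = 0

variable {Γ : Type} [Group Γ] {ρ : Representation 𝔽 Γ V} {p : ℕ} [Fact p.Prime] [CharP 𝔽 p]
  {u β : Γ} {I : Set Γ} {v : V}

/-- The span of the `u`-orbit of `β v`. -/
def bigSpan (ρ : Representation 𝔽 Γ V) (p : ℕ) (u β : Γ) (v : V) : Submodule 𝔽 V :=
  Submodule.span 𝔽 (Set.range fun a : Fin p => ((ρ u) ^ (a : ℕ)) (ρ β v))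

lemma Special.mem_of_bruhat (h : Special ρ p u β I v) {k : Γ} (hk : k ∉ I) :
    ρ k v ∈ bigSpan ρ p u β v := by
  obtain ⟨a, ha, i, hi, rfl⟩ := (h.dec k).resolve_left hk
  obtain ⟨c, hc⟩ := h.line i hi
  rw [map_mul, map_mul, map_pow, Module.End.mul_apply, hc, map_smul]
  exact Submodule.smul_mem _ _ (Submodule.subset_span ⟨⟨a, ha⟩, rfl⟩)

lemma Special.mem (h : Special ρ p u β I v) : v ∈ bigSpan ρ p u β v := by
  have hp : 0 < p := (Fact.out : p.Prime).pos
  have e := congrArg (ρ β) h.sum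
  rw [map_zero, map_sum, Finset.sum_range_eq_add_Ico _ hp] at e
  have e0 : ρ β (ρ (u ^ 0) (ρ β v)) = v := by
    rw [pow_zero, map_one, Module.End.one_apply, ← Module.End.mul_apply, ← map_mul, h.hβ, map_one,
      Module.End.one_apply]
  rw [e0] at e
  have mem : -∑ x ∈ Finset.Ico 1 p, ρ β (ρ (u ^ x) (ρ β v)) ∈ bigSpan ρ p u β v := by
    refine Submodule.neg_mem _ (Submodule.sum_mem _ fun a ha => ?_)
    rw [Finset.mem_Ico] at ha
    rw [← Module.End.mul_apply, ← map_mul, ← Module.End.mul_apply, ← map_mul]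
    exact h.mem_of_bruhat (h.notMem a ha.1 ha.2)
  rwa [← eq_neg_of_add_eq_zero_left e] at mem

lemma Special.orbit_le (h : Special ρ p u β I v) : orbitSpan 𝔽 ρ v ≤ bigSpan ρ p u β v := by
  rw [orbitSpan, Submodule.span_le]
  rintro _ ⟨k, rfl⟩
  by_cases hk : k ∈ I
  · obtain ⟨c, hc⟩ := h.line k hk
    rw [hc]
    exact Submodule.smul_mem _ _ h.mem
  · exact h.mem_of_bruhat hk

/-- A nonzero `u`-stable subspace of the span of the orbit of `v` contains `v`. -/
lemma Special.mem_of_stable (h : Special ρ p u β I v) (hv : v ≠ 0) {S0 : Submodule 𝔽 V}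
    (hS : S0 ≤ orbitSpan 𝔽 ρ v) (hSU : ∀ x ∈ S0, ρ u x ∈ S0) (hS0 : S0 ≠ ⊥) : v ∈ S0 := by
  refine mem_of_cyclic (p := p) (U := ρ u) (w := ρ β v) ?_ h.mem hv h.fix
    (hS.trans h.orbit_le) hSU hS0
  intro a
  rw [← Module.End.mul_apply, ← pow_add, add_comm, pow_add, Module.End.mul_apply, ← map_pow ρ u p,
    h.pow]

end Cyclic
end U21

namespace U21

/-- Reindexing a sum of a `p`-periodic function along a map which is injective modulo `p`. -/
lemma sum_range_reindex {M : Type} [AddCommMonoid M] {p : ℕ} (hp : 0 < p) (f : ℕ → M)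
    (hf : ∀ a, f (a % p) = f a) (i : ℕ → ℕ)
    (hi : ∀ a < p, ∀ b < p, i a ≡ i b [MOD p] → a ≡ b [MOD p]) :
    ∑ a ∈ Finset.range p, f (i a) = ∑ a ∈ Finset.range p, f a := by
  have hmaps : Set.MapsTo (fun a => i a % p) (Finset.range p) (Finset.range p) := by
    intro a _; simpa using Nat.mod_lt _ hp
  have hinj : Set.InjOn (fun a => i a % p) (Finset.range p) := by
    intro a ha b hb h
    simp only [Finset.coe_range, Set.mem_Iio] at ha hb
    have := hi a ha b hb h
    rwa [Nat.ModEq, Nat.mod_eq_of_lt ha, Nat.mod_eq_of_lt hb] at this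
  refine Finset.sum_nbij (fun a => i a % p) hmaps hinj ?_ fun a _ => (hf _).symm
  exact Finset.surjOn_of_injOn_of_card_le _ hmaps hinj le_rfl

namespace Setting
variable {S : Setting}

lemma H_conj_uE (hqp : S.q = S.p) {h : S.GG} (hh : h ∈ S.Hset) (hI : h ∈ S.IK1) :
    ∃ t : ℕ, ¬ S.p ∣ t ∧ ∀ k : ℕ, ∃ n0 ∈ S.Nk 0, h * S.uE ^ k = S.uE ^ (t * k) * n0 * h := by
  have hv := IK1_isVal hI
  obtain ⟨a, b, ha, hb, rfl⟩ := exists_hE hh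
  simp only [mat_hE] at hv
  have hv : S.IsVal 0 a := by simpa using hv
  have hv2 : S.IsVal 0 (a * S.conj a) := by simpa using hv.mul hv.conj
  obtain ⟨t, _, ht⟩ := exists_nat_of_conj_fixed hqp ((S.pE_zero_iff _).1 hv2.2.1) (by
    rw [map_mul, S.conj_invol, mul_comm, sub_self]; exact zero_mem_pE _)
  refine ⟨t, ?_, fun k => ?_⟩
  · rw [← natCast_mem_pE_one_iff]
    intro h1
    have := pE_add ht h1
    rw [sub_add_cancel, hv2.mem_iff] at this
    norm_num at this
  · refine ⟨(S.uE ^ (t * k))⁻¹ * (hE a b ha hb * S.uE ^ k * (hE a b ha hb)⁻¹), ?_, by group⟩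
    rw [uE_pow, uE_pow, nE_inv]
    obtain ⟨x', h', e⟩ := hE_conj_nE a b 0 (k * S.tz * S.ϖ⁻¹) ha hb
      (rel_traceless (conj_natCast_tz_unif _))
    rw [e, nE_mul, mem_Nk_iff]
    refine ⟨nE_mem _ _ _, ?_⟩
    simp only [mat_nE]
    have : S.conj ((t * k : ℕ) * S.tz * S.ϖ⁻¹) + a * S.conj a * (k * S.tz * S.ϖ⁻¹) - -0 * S.conj x' =
        (a * S.conj a - t) * (k * S.tz * S.ϖ⁻¹) := by
      rw [conj_natCast_tz_unif]; push_cast; ring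
    simp only [nM, Matrix.of_apply, Matrix.cons_val', Matrix.cons_val_zero, Matrix.cons_val]
    rw [this]
    exact pE_mul' ht (pE_mul (pE_mul ((S.pE_zero_iff _).2 (natCast_mem_O k)) isVal_tz.2.1)
      isVal_unif.inv.2.1) (by norm_num)

/-- `diag(z, 1, z̄⁻¹)`, with a junk value at `0`. -/
def dd (S : Setting) (z : S.E) : S.GG := if hz : z ≠ 0 then dE z hz else 1

lemma dd_eq {z : S.E} (hz : z ≠ 0) : S.dd z = dE z hz := dif_pos hz

lemma dd_mem {z : S.E} (hz : S.IsVal 0 z) : S.dd z ∈ S.Hset ∧ S.dd z ∈ S.IK1 := by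
  rw [dd_eq hz.1]; exact ⟨dE_mem_Hset _ _, dE_mem_IK1 _ hz⟩

lemma beta_dd_beta {z : S.E} (hz : z ≠ 0) : S.betaPr * S.dd z * S.betaPr = S.dd (S.conj z)⁻¹ := by
  rw [dd_eq hz, beta_dE_beta, dd_eq]

lemma dd_mul {z w : S.E} (hz : z ≠ 0) (hw : w ≠ 0) : S.dd z * S.dd w = S.dd (z * w) := by
  rw [dd_eq hz, dd_eq hw, dd_eq (mul_ne_zero hz hw), dE_mul]

lemma dd_mem_I1 {z : S.E} (hz : z - 1 ∈ S.pE 1) : S.dd z ∈ S.I1K1 := by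
  have : z ≠ 0 := by
    rintro rfl
    apply one_notMem_pE (S := S) le_rfl
    simpa using pE_neg hz
  rw [dd_eq this]
  exact hE_mem_I1 _ _ hz (by rw [sub_self]; exact zero_mem_pE _)

lemma beta_uE_beta_bruhat {b : ℕ} (hb : ¬ S.p ∣ b) : ∃ n ∈ S.Nk (-1),
    S.betaPr * S.uE ^ b * S.betaPr = n * S.dd (-(b * S.tz)⁻¹) * S.betaPr * n := by
  have hv : S.IsVal 0 ((b : S.E) * S.tz) := by simpa using (isVal_natCast hb).mul isVal_tz
  have hc : S.conj (b * S.tz) = -(b * S.tz) := by rw [map_mul, conj_natCast, conj_tz]; ring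
  have hm : nE 0 ((b * S.tz : S.E)⁻¹ * S.ϖ⁻¹)
      (rel_traceless (by rw [map_mul, conj_inv_traceless hc, map_inv₀, S.unif_conj]; ring)) ∈
      S.Nk (-1) := by
    rw [mem_Nk_iff]
    refine ⟨nE_mem _ _ _, ?_⟩
    have : (b * S.tz : S.E)⁻¹ * S.ϖ⁻¹ ∈ S.pE (-1) :=
      pE_mul' hv.inv.2.1 isVal_unif.inv.2.1 (by norm_num)
    simpa [nM] using this
  refine ⟨_, hm, ?_⟩
  rw [beta_uE_beta, n'E_traceless hv.1 hc, dd_eq (neg_ne_zero.2 (inv_ne_zero hv.1))]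

/-! ### Characters of the torus -/

/-- `χ` restricts to a character of `H₀/H₁` which is not fixed by conjugation by `β`. -/
structure RegChar {R : Type} [Field R] (χ : S.GG → R) : Prop where
  mul : ∀ h ∈ S.Hset, ∀ h' ∈ S.Hset, h ∈ S.IK1 → h' ∈ S.IK1 → χ (h * h') = χ h * χ h'
  one : ∀ h ∈ S.Hset, h ∈ S.I1K1 → χ h = 1
  reg : ∃ h ∈ S.Hset, h ∈ S.IK1 ∧ χ h ≠ χ (S.betaPr * h * S.betaPr)

section
variable {R : Type} [Field R] {χ : S.GG → R}

lemma RegChar.dd_congr (hχ : RegChar χ) {z w : S.E} (hz : S.IsVal 0 z) (hw : S.IsVal 0 w)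
    (h : z - w ∈ S.pE 1) : χ (S.dd z) = χ (S.dd w) := by
  have e : S.dd z = S.dd w * S.dd (w⁻¹ * z) := by
    rw [dd_mul hw.1 (mul_ne_zero (inv_ne_zero hw.1) hz.1), mul_inv_cancel_left₀ hw.1]
  have hv : S.IsVal 0 (w⁻¹ * z) := by simpa using hw.inv.mul hz
  have h1 : w⁻¹ * z - 1 ∈ S.pE 1 := by
    have : w⁻¹ * z - 1 = w⁻¹ * (z - w) := by rw [mul_sub, inv_mul_cancel₀ hw.1]
    rw [this]; exact pE_mul' hw.inv.2.1 h (by norm_num)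
  rw [e, hχ.mul _ (dd_mem hw).1 _ (dd_mem hv).1 (dd_mem hw).2 (dd_mem hv).2,
    hχ.one _ (dd_mem hv).1 (dd_mem_I1 h1), mul_one]

lemma RegChar.exists_nat (hqp : S.q = S.p) (hχ : RegChar χ) :
    ∃ t : ℕ, ¬ S.p ∣ t ∧ χ (S.dd (t : S.E)) ≠ 1 := by
  obtain ⟨h, hh, hI, hne⟩ := hχ.reg
  have hv := IK1_isVal hI
  have hI2 := Hset_K1_IK1 (beta_Hset hh) (K1_mul (K1_mul betaPr_mem hI.1) betaPr_mem)
  have hH2 := beta_Hset hh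
  obtain ⟨a, b, ha, hb, rfl⟩ := exists_hE hh
  have hv : S.IsVal 0 a := by simpa using hv
  have hv2 : S.IsVal 0 (a * S.conj a) := by simpa using hv.mul hv.conj
  obtain ⟨t, _, ht⟩ := exists_nat_of_conj_fixed hqp ((S.pE_zero_iff _).1 hv2.2.1) (by
    rw [map_mul, S.conj_invol, mul_comm, sub_self]; exact zero_mem_pE _)
  have hpt : ¬ S.p ∣ t := by
    rw [← natCast_mem_pE_one_iff]
    intro h1
    have := pE_add ht h1
    rw [sub_add_cancel, hv2.mem_iff] at this
    norm_num at this
  refine ⟨t, hpt, fun h1 => hne ?_⟩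
  rw [← hχ.dd_congr hv2 (isVal_natCast hpt) ht] at h1
  have e : hE a b ha hb = S.betaPr * hE a b ha hb * S.betaPr * S.dd (a * S.conj a) := by
    rw [beta_conj_hE, dd_eq hv2.1, dE, hE_mul]
    have := hv.conj.1
    apply mat_injective
    simp only [mat_hE]
    ext i j
    fin_cases i <;> fin_cases j <;> simp <;> field_simp
    rw [S.conj_invol]; field_simp
  conv_lhs => rw [e]
  rw [hχ.mul _ hH2 _ (dd_mem hv2).1 hI2 (dd_mem hv2).2, h1, mul_one]

lemma RegChar.sum (hqp : S.q = S.p) (hχ : RegChar χ) {c : S.E} (hc : S.IsVal 0 c) :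
    ∑ a ∈ Finset.Ico 1 S.p, χ (S.dd (a * c)) = 0 := by
  have hp := S.hp
  obtain ⟨t, ht, ht1⟩ := hχ.exists_nat hqp
  let g : ℕ → R := fun a => if S.p ∣ a then 0 else χ (S.dd (a * c))
  have hv : ∀ {a : ℕ}, ¬ S.p ∣ a → S.IsVal 0 ((a : S.E) * c) := fun h => by
    simpa using (isVal_natCast h).mul hc
  have hg : ∀ a, g (a % S.p) = g a := by
    intro a
    by_cases h : S.p ∣ a
    · simp [g, h, (Nat.dvd_mod_iff dvd_rfl).2 h]
    · have h' : ¬ S.p ∣ a % S.p := by rwa [Nat.dvd_mod_iff dvd_rfl]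
      simp only [g, h, h', if_false]
      refine hχ.dd_congr (hv h') (hv h) ?_
      have e : ((a % S.p : ℕ) : S.E) * c - a * c = ((S.p * (a / S.p) : ℕ) : S.E) * (-c) := by
        conv_lhs => rw [← Nat.mod_add_div a S.p]
        simp
        ring
      rw [e]
      exact pE_mul' ((natCast_mem_pE_one_iff _).2 (dvd_mul_right _ _)) (pE_neg hc.2.1) (by norm_num)
  have hgt : ∀ a, g (t * a) = χ (S.dd (t : S.E)) * g a := by
    intro a
    by_cases h : S.p ∣ a
    · simp [g, h, Dvd.dvd.mul_left h]
    · have h' : ¬ S.p ∣ t * a := by rw [hp.dvd_mul]; tauto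
      simp only [g, h, h', if_false]
      rw [← hχ.mul _ (dd_mem (isVal_natCast ht)).1 _ (dd_mem (hv h)).1
        (dd_mem (isVal_natCast ht)).2 (dd_mem (hv h)).2, dd_mul (isVal_natCast ht).1 (hv h).1]
      push_cast
      rw [mul_assoc]
  have key := sum_range_reindex hp.pos g hg (fun a => t * a) fun a _ b _ h =>
    Nat.ModEq.cancel_left_of_coprime ((Nat.Prime.coprime_iff_not_dvd hp).2 ht) h
  simp only [hgt] at key
  rw [← Finset.mul_sum] at key
  have h0 : ∑ a ∈ Finset.range S.p, g a = 0 := by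
    have : (χ (S.dd (t : S.E)) - 1) * ∑ a ∈ Finset.range S.p, g a = 0 := by
      rw [sub_mul, key, one_mul, sub_self]
    exact (mul_eq_zero.1 this).resolve_left (sub_ne_zero.2 ht1)
  rw [Finset.sum_range_eq_add_Ico _ hp.pos] at h0
  have h00 : g 0 = 0 := by simp [g]
  rw [h00, zero_add] at h0
  rw [← h0]
  refine Finset.sum_congr rfl fun a ha => ?_
  rw [Finset.mem_Ico] at ha
  have : ¬ S.p ∣ a := fun h => absurd (Nat.le_of_dvd ha.1 h) (by omega)
  simp [g, this]

end
end Setting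
end U21

namespace U21

open Setting

section KRep

variable {S : Setting} {C : Chamber S}

lemma chamber_eq (hK1 : (C.K : Set S.GG) = S.K1set) : C.KoneS = S.Kone1 ∧ C.IK = S.IK1 ∧
    C.I1 = S.I1K1 ∧ C.I1' = S.I1'K1 ∧ C.βK = S.betaPr ∧ C.nK = -1 := by
  rcases C.cases with ⟨h, _⟩ | ⟨_, h1, h2, h3, h4, h5, h6, _⟩
  · exfalso
    have hm : S.betaPr ∈ S.K0set := by rw [← h, hK1]; exact betaPr_mem
    have := hm 0 2
    rw [mat_betaPr, ← pE_zero_iff] at this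
    simp [isVal_unif.inv.mem_iff] at this
  · exact ⟨h1, h2, h3, h4, h5, h6⟩

lemma mem_K_iff (hK1 : (C.K : Set S.GG) = S.K1set) {g : S.GG} : g ∈ C.K ↔ g ∈ S.K1set := by
  rw [← hK1]; rfl

variable {𝔽 : Type} [Field 𝔽] {V : Type} [AddCommGroup V] [Module 𝔽 V]

/-- The action of an element of `G` lying in `K`. -/
abbrev sg (ρ : Representation 𝔽 ↥C.K V) : S.GG → Module.End 𝔽 V := sigma' C 𝔽 V ρ

variable (ρ : Representation 𝔽 ↥C.K V)

lemma sg_eq {g : S.GG} (hg : g ∈ C.K) : sg ρ g = ρ ⟨g, hg⟩ := dif_pos hg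

lemma sg_one : sg ρ 1 = 1 := by rw [sg_eq ρ C.K.one_mem]; exact map_one ρ

lemma sg_mul (hK1 : (C.K : Set S.GG) = S.K1set) {g h : S.GG} (hg : g ∈ S.K1set)
    (hh : h ∈ S.K1set) (v : V) : sg ρ (g * h) v = sg ρ g (sg ρ h v) := by
  rw [← mem_K_iff hK1] at hg hh
  rw [sg_eq ρ hg, sg_eq ρ hh, sg_eq ρ (C.K.mul_mem hg hh), ← Module.End.mul_apply, ← map_mul]
  rfl

lemma uE_pow_K1 (a : ℕ) : S.uE ^ a ∈ S.K1set := (Nk_sub_I1 (uE_pow_mem a)).1.1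

lemma uE_K1 : S.uE ∈ S.K1set := (Nk_sub_I1 uE_mem).1.1

lemma Nk_K1 {n : S.GG} (hn : n ∈ S.Nk (-1)) : n ∈ S.K1set := (Nk_sub_I1 hn).1.1

/-- A vector fixed by `N_{-1} K¹` on which `H₀` acts by `χ`. -/
structure KVec (χ : S.GG → 𝔽) (v : V) : Prop where
  one : ∀ z ∈ S.Kone1, sg ρ z v = v
  fix : sg ρ S.uE v = v
  eig : ∀ h ∈ S.Hset, h ∈ S.IK1 → sg ρ h v = χ h • v

/-- The sum of the translates of `β v` under `N_{-1}/N_0`. -/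
def psi (v : V) : V := ∑ a ∈ Finset.range S.p, sg ρ (S.uE ^ a) (sg ρ S.betaPr v)

variable {ρ} {χ : S.GG → 𝔽} {v : V}

lemma fix_conj (hK1 : (C.K : Set S.GG) = S.K1set) (h : ∀ z ∈ S.Kone1, sg ρ z v = v) {k z : S.GG}
    (hk : k ∈ S.K1set) (hz : z ∈ S.Kone1) : sg ρ z (sg ρ k v) = sg ρ k v := by
  have e : z * k = k * (k⁻¹ * z * k) := by group
  have := Kone1_conj (K1_inv hk) hz
  rw [inv_inv] at this
  rw [← sg_mul ρ hK1 (Kone1_sub_K1 hz) hk, e, sg_mul ρ hK1 hk (Kone1_sub_K1 this), h _ this]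

lemma fix_pow (hK1 : (C.K : Set S.GG) = S.K1set) (h : sg ρ S.uE v = v) (a : ℕ) :
    sg ρ (S.uE ^ a) v = v := by
  induction a with
  | zero => rw [pow_zero, sg_one, Module.End.one_apply]
  | succ a ih => rw [pow_succ, sg_mul ρ hK1 (uE_pow_K1 a) uE_K1, h, ih]

lemma fix_N (hK1 : (C.K : Set S.GG) = S.K1set) (hqp : S.q = S.p)
    (h1 : ∀ z ∈ S.Kone1, sg ρ z v = v) (h : sg ρ S.uE v = v)
    {n : S.GG} (hn : n ∈ S.Nk (-1)) : sg ρ n v = v := by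
  obtain ⟨a, -, n0, hn0, rfl⟩ := exists_uE_pow hqp hn
  rw [sg_mul ρ hK1 (uE_pow_K1 a) (Kone1_sub_K1 (Nk_sub_Kone1 hn0)), h1 _ (Nk_sub_Kone1 hn0),
    fix_pow hK1 h]

lemma KVec.line (hK1 : (C.K : Set S.GG) = S.K1set) (hqp : S.q = S.p) (h : KVec ρ χ v) {i : S.GG}
    (hi : i ∈ S.IK1) : ∃ c : 𝔽, sg ρ i v = c • v := by
  obtain ⟨x, y, hr, hy, t, ht, htI, n, hn, rfl⟩ := IK1_decomp hi
  have hk := n'E_mem_Kone1 hr hy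
  refine ⟨χ t, ?_⟩
  rw [sg_mul ρ hK1 (K1_mul (Kone1_sub_K1 hk) htI.1) (Nk_K1 hn), fix_N hK1 hqp h.one h.fix hn,
    sg_mul ρ hK1 (Kone1_sub_K1 hk) htI.1, h.eig t ht htI, map_smul, h.one _ hk]

lemma period (hK1 : (C.K : Set S.GG) = S.K1set) (h : ∀ z ∈ S.Kone1, sg ρ z v = v) :
    ∀ a, sg ρ (S.uE ^ (a % S.p)) (sg ρ S.betaPr v) = sg ρ (S.uE ^ a) (sg ρ S.betaPr v) := by
  intro a
  have hpk : ∀ k, sg ρ ((S.uE ^ S.p) ^ k) (sg ρ S.betaPr v) = sg ρ S.betaPr v := by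
    intro k
    have hp1 := Nk_sub_Kone1 (uE_pow_p_mem (S := S))
    induction k with
    | zero => rw [pow_zero, sg_one, Module.End.one_apply]
    | succ k ih =>
      rw [pow_succ, sg_mul ρ hK1 (by rw [← pow_mul]; exact uE_pow_K1 _) (Kone1_sub_K1 hp1),
        fix_conj hK1 h betaPr_mem hp1, ih]
  conv_rhs => rw [← Nat.mod_add_div a S.p, pow_add, pow_mul, sg_mul ρ hK1 (uE_pow_K1 _)
    (by rw [← pow_mul]; exact uE_pow_K1 _), hpk]

lemma sum_translate (hK1 : (C.K : Set S.GG) = S.K1set) (hqp : S.q = S.p)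
    (h : ∀ z ∈ S.Kone1, sg ρ z v = v) {n : S.GG} (hn : n ∈ S.Nk (-1)) :
    ∑ a ∈ Finset.range S.p, sg ρ (S.uE ^ a) (sg ρ n (sg ρ S.betaPr v)) = psi ρ v := by
  obtain ⟨b, -, n0, hn0, rfl⟩ := exists_uE_pow hqp hn
  have hn0' := Nk_sub_Kone1 hn0
  have e : ∀ a, sg ρ (S.uE ^ a) (sg ρ (S.uE ^ b * n0) (sg ρ S.betaPr v)) =
      sg ρ (S.uE ^ (a + b)) (sg ρ S.betaPr v) := by
    intro a
    rw [sg_mul ρ hK1 (uE_pow_K1 b) (Kone1_sub_K1 hn0'), fix_conj hK1 h betaPr_mem hn0',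
      ← sg_mul ρ hK1 (uE_pow_K1 a) (uE_pow_K1 b), pow_add]
  simp only [e]
  refine sum_range_reindex S.hp.pos (fun a => sg ρ (S.uE ^ a) (sg ρ S.betaPr v)) ?_
    (fun a => a + b) fun _ _ _ _ => Nat.ModEq.add_right_cancel'  b
  exact period hK1 h

lemma psi_translate (hK1 : (C.K : Set S.GG) = S.K1set) (hqp : S.q = S.p)
    (h : ∀ z ∈ S.Kone1, sg ρ z v = v) : sg ρ S.uE (psi ρ v) = psi ρ v := by
  conv_rhs => rw [← sum_translate hK1 hqp h uE_mem]
  rw [psi, map_sum]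
  refine Finset.sum_congr rfl fun a _ => ?_
  rw [← sg_mul ρ hK1 uE_K1 (uE_pow_K1 a), ← sg_mul ρ hK1 (uE_pow_K1 a) uE_K1, ← pow_succ, pow_succ']

lemma psi_one (hK1 : (C.K : Set S.GG) = S.K1set)
    (h : ∀ z ∈ S.Kone1, sg ρ z v = v) : ∀ z ∈ S.Kone1, sg ρ z (psi ρ v) = psi ρ v := by
  intro z hz
  rw [psi, map_sum]
  refine Finset.sum_congr rfl fun a _ => ?_
  rw [← sg_mul ρ hK1 (uE_pow_K1 a) betaPr_mem]
  exact fix_conj hK1 h (K1_mul (uE_pow_K1 a) betaPr_mem) hz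

lemma KVec.psi (hK1 : (C.K : Set S.GG) = S.K1set) (hqp : S.q = S.p) (h : KVec ρ χ v) :
    KVec ρ (fun t => χ (S.betaPr * t * S.betaPr)) (psi ρ v) := by
  refine ⟨psi_one hK1 h.one, psi_translate hK1 hqp h.one, fun t ht htI => ?_⟩
  obtain ⟨c, hc, hct⟩ := H_conj_uE hqp ht htI
  have hbt := beta_Hset ht
  have hbtK := K1_mul (K1_mul betaPr_mem htI.1) betaPr_mem
  have hbtI := Hset_K1_IK1 hbt hbtK
  have e : ∀ k, sg ρ t (sg ρ (S.uE ^ k) (sg ρ S.betaPr v)) =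
      χ (S.betaPr * t * S.betaPr) • sg ρ (S.uE ^ (c * k)) (sg ρ S.betaPr v) := by
    intro k
    obtain ⟨n0, hn0, e⟩ := hct k
    have hn0' := Nk_sub_Kone1 hn0
    have e2 : t * S.betaPr = S.betaPr * (S.betaPr * t * S.betaPr) := by
      rw [← mul_assoc, ← mul_assoc, betaPr_mul_self, one_mul]
    rw [← sg_mul ρ hK1 htI.1 (uE_pow_K1 k), e,
      sg_mul ρ hK1 (K1_mul (uE_pow_K1 _) (Kone1_sub_K1 hn0')) htI.1,
      ← sg_mul ρ hK1 htI.1 betaPr_mem, e2, sg_mul ρ hK1 betaPr_mem hbtK, h.eig _ hbt hbtI,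
      map_smul, map_smul, sg_mul ρ hK1 (uE_pow_K1 _) (Kone1_sub_K1 hn0'),
      fix_conj hK1 h.one betaPr_mem hn0']
  rw [U21.psi, map_sum, Finset.smul_sum]
  simp only [e]
  refine sum_range_reindex S.hp.pos
    (fun k => χ (S.betaPr * t * S.betaPr) • sg ρ (S.uE ^ k) (sg ρ S.betaPr v)) ?_
    (fun k => c * k) fun _ _ _ _ hab =>
    Nat.ModEq.cancel_left_of_coprime ((Nat.Prime.coprime_iff_not_dvd S.hp).2 hc) hab
  intro a
  rw [period hK1 h.one]

lemma KVec.beta_uE_beta (hK1 : (C.K : Set S.GG) = S.K1set) (hqp : S.q = S.p) (h : KVec ρ χ v)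
    {b : ℕ} (hb : ¬ S.p ∣ b) : ∃ n ∈ S.Nk (-1),
      sg ρ S.betaPr (sg ρ (S.uE ^ b) (sg ρ S.betaPr v)) =
        χ (S.dd (b * S.tz)) • sg ρ n (sg ρ S.betaPr v) := by
  obtain ⟨n, hn, e⟩ := beta_uE_beta_bruhat (S := S) hb
  refine ⟨n, hn, ?_⟩
  have hv : S.IsVal 0 ((b : S.E) * S.tz) := by simpa using (isVal_natCast hb).mul isVal_tz
  have hvi : S.IsVal 0 (-((b : S.E) * S.tz)⁻¹) := by simpa using hv.inv.neg
  have hD := dd_mem hvi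
  have hbD : S.betaPr * S.dd (-(b * S.tz)⁻¹) * S.betaPr = S.dd (b * S.tz) := by
    rw [beta_dd_beta hvi.1, map_neg, map_inv₀, map_mul, conj_natCast, conj_tz]
    congr 1
    simp
  have e2 : S.dd (-(b * S.tz)⁻¹) * S.betaPr = S.betaPr * S.dd (b * S.tz) := by
    rw [← hbD, ← mul_assoc, ← mul_assoc, betaPr_mul_self, one_mul]
  rw [← sg_mul ρ hK1 (uE_pow_K1 b) betaPr_mem,
    ← sg_mul ρ hK1 betaPr_mem (K1_mul (uE_pow_K1 b) betaPr_mem), ← mul_assoc, e,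
    sg_mul ρ hK1 (K1_mul (K1_mul (Nk_K1 hn) hD.2.1) betaPr_mem) (Nk_K1 hn),
    fix_N hK1 hqp h.one h.fix hn, mul_assoc, e2,
    sg_mul ρ hK1 (Nk_K1 hn) (K1_mul betaPr_mem (dd_mem hv).2.1),
    sg_mul ρ hK1 betaPr_mem (dd_mem hv).2.1, h.eig _ (dd_mem hv).1 (dd_mem hv).2, map_smul, map_smul]

lemma not_dvd_of_mem_Ico {b : ℕ} (hb : b ∈ Finset.Ico 1 S.p) : ¬ S.p ∣ b := by
  rw [Finset.mem_Ico] at hb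
  exact fun h => absurd (Nat.le_of_dvd hb.1 h) (by omega)

lemma sum_fix [CharP 𝔽 S.p] (hK1 : (C.K : Set S.GG) = S.K1set) (h : sg ρ S.uE v = v) :
    ∑ a ∈ Finset.range S.p, sg ρ (S.uE ^ a) v = 0 := by
  simp only [fix_pow hK1 h]
  rw [Finset.sum_const, Finset.card_range, ← Nat.cast_smul_eq_nsmul 𝔽, CharP.cast_eq_zero, zero_smul]

lemma KVec.psi_psi [CharP 𝔽 S.p] (hK1 : (C.K : Set S.GG) = S.K1set) (hqp : S.q = S.p)
    (hχ : RegChar χ) (h : KVec ρ χ v) : U21.psi ρ (U21.psi ρ v) = 0 := by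
  have hsum : ∑ b ∈ Finset.Ico 1 S.p, χ (S.dd (b * S.tz)) = 0 := hχ.sum hqp isVal_tz
  calc U21.psi ρ (U21.psi ρ v)
      = ∑ b ∈ Finset.range S.p, ∑ a ∈ Finset.range S.p,
          sg ρ (S.uE ^ a) (sg ρ S.betaPr (sg ρ (S.uE ^ b) (sg ρ S.betaPr v))) := by
        rw [Finset.sum_comm, U21.psi]
        refine Finset.sum_congr rfl fun a _ => ?_
        rw [U21.psi, map_sum, map_sum]
    _ = 0 := by
        rw [Finset.sum_range_eq_add_Ico _ S.hp.pos]
        have e0 : sg ρ S.betaPr (sg ρ (S.uE ^ 0) (sg ρ S.betaPr v)) = v := by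
          rw [pow_zero, sg_one, Module.End.one_apply, ← sg_mul ρ hK1 betaPr_mem betaPr_mem,
            betaPr_mul_self, sg_one, Module.End.one_apply]
        simp only [e0]
        rw [sum_fix hK1 h.fix, zero_add]
        have e : ∀ b ∈ Finset.Ico 1 S.p, ∑ a ∈ Finset.range S.p,
            sg ρ (S.uE ^ a) (sg ρ S.betaPr (sg ρ (S.uE ^ b) (sg ρ S.betaPr v))) =
            χ (S.dd (b * S.tz)) • U21.psi ρ v := by
          intro b hb
          obtain ⟨n, hn, e⟩ := h.beta_uE_beta hK1 hqp (not_dvd_of_mem_Ico hb)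
          rw [← sum_translate hK1 hqp h.one hn, Finset.smul_sum]
          refine Finset.sum_congr rfl fun a _ => ?_
          rw [e, map_smul]
        rw [Finset.sum_congr rfl e, ← Finset.sum_smul, hsum, zero_smul]

/-- The unipotent generator as an element of `K`. -/
def kU (hK1 : (C.K : Set S.GG) = S.K1set) : ↥C.K := ⟨S.uE, (mem_K_iff hK1).2 uE_K1⟩

/-- The Weyl element as an element of `K`. -/
def kB (hK1 : (C.K : Set S.GG) = S.K1set) : ↥C.K := ⟨S.betaPr, (mem_K_iff hK1).2 betaPr_mem⟩

lemma sg_coe (k : ↥C.K) : sg ρ (k : S.GG) = ρ k := sg_eq ρ k.2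

lemma KVec.special (hK1 : (C.K : Set S.GG) = S.K1set) (hqp : S.q = S.p) (h : KVec ρ χ v)
    (h0 : U21.psi ρ v = 0) : Special ρ S.p (kU hK1) (kB hK1) {k | (k : S.GG) ∈ S.IK1} v where
  hβ := Subtype.ext betaPr_mul_self
  dec k := by
    rcases bruhat hqp ((mem_K_iff hK1).1 k.2) with hk | ⟨a, ha, i, hi, e⟩
    · exact Or.inl hk
    · exact Or.inr ⟨a, ha, ⟨i, (mem_K_iff hK1).2 hi.1⟩, hi, Subtype.ext e⟩
  notMem a h0 h1 := beta_uE_beta_notMem h0 h1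
  line i hi := by
    obtain ⟨c, hc⟩ := h.line hK1 hqp hi
    exact ⟨c, by rwa [← sg_coe]⟩
  fix := by rw [← sg_coe]; exact h.fix
  pow := by
    rw [← sg_coe, ← sg_coe]
    exact fix_conj hK1 h.one betaPr_mem (Nk_sub_Kone1 uE_pow_p_mem)
  sum := by
    rw [← h0]
    refine Finset.sum_congr rfl fun a _ => ?_
    rw [← sg_coe, ← sg_coe]
    rfl

end KRep
end U21

namespace U21

open Setting

section WeightLemmas

variable {S : Setting} {C : Chamber S} {𝔽 : Type} [Field 𝔽] {W : Type} [AddCommGroup W] [Module 𝔽 W]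
  {σ : Representation 𝔽 ↥C.K W} {v0 : W} {χ : S.GG → 𝔽} {jσ : W →ₗ[𝔽] W}

/-- A regular weight of `K₁`, with its highest weight vector and the operator `j_σ`. -/
structure WeightData (C : Chamber S) (σ : Representation 𝔽 ↥C.K W) (v0 : W) (χ : S.GG → 𝔽)
    (jσ : W →ₗ[𝔽] W) : Prop where
  hK1 : (C.K : Set S.GG) = S.K1set
  hqp : S.q = S.p
  hσ : IsWeight C 𝔽 W σ
  hv0 : v0 ≠ 0
  hinv : ∀ g ∈ C.I1, sigma' C 𝔽 W σ g v0 = v0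
  hχ : IsChi C 𝔽 W σ v0 χ
  hreg : ∃ h ∈ C.H0, χ h ≠ χ (C.βK * h * C.βK)
  hj : IsJ C 𝔽 W σ jσ



lemma WeightData.H0 (D : WeightData C σ v0 χ jσ) {h : S.GG} : h ∈ C.H0 ↔ h ∈ S.Hset ∧ h ∈ S.IK1 := by
  rw [Chamber.H0, (chamber_eq D.hK1).2.1]; rfl

lemma WeightData.inv (D : WeightData C σ v0 χ jσ) {g : S.GG} (hg : g ∈ S.I1K1) : sg σ g v0 = v0 :=
  D.hinv g (by rwa [(chamber_eq D.hK1).2.2.1])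

lemma WeightData.kone (D : WeightData C σ v0 χ jσ) {g : S.GG} (hg : g ∈ S.Kone1) (w : W) : sg σ g w = w := by
  have hk : g ∈ C.K := (mem_K_iff D.hK1).2 (Kone1_sub_K1 hg)
  rw [sg_eq σ hk, D.hσ.2.2.2 g hk (by rwa [(chamber_eq D.hK1).1])]
  rfl

lemma WeightData.kvec (D : WeightData C σ v0 χ jσ) : KVec σ χ v0 where
  one _ _ := D.kone ‹_› _
  fix := D.inv (Nk_sub_I1 uE_mem)
  eig h hh hI := D.hχ h (D.H0.2 ⟨hh, hI⟩)

lemma WeightData.regChar (D : WeightData C σ v0 χ jσ) : RegChar χ where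
  mul h hh h' hh' hI hI' := by
    have hm : h * h' ∈ S.Hset := by
      obtain ⟨a, b, ha, hb, rfl⟩ := exists_hE hh
      obtain ⟨a', b', ha', hb', rfl⟩ := exists_hE hh'
      rw [hE_mul]; exact hE_mem _ _ _ _
    have e := D.kvec.eig _ hm (IK1_mul hI hI')
    rw [sg_mul σ D.hK1 hI.1 hI'.1, D.kvec.eig _ hh' hI', map_smul, D.kvec.eig _ hh hI, smul_smul] at e
    rw [← smul_left_injective 𝔽 D.hv0 e, mul_comm]
  one h hh hI := by
    have e := D.kvec.eig _ hh hI.1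
    rw [D.inv hI] at e
    exact (smul_left_injective 𝔽 D.hv0 (by simpa using e)).symm
  reg := by
    obtain ⟨h, hh, hne⟩ := D.hreg
    rw [(chamber_eq D.hK1).2.2.2.2.1] at hne
    exact ⟨h, (D.H0.1 hh).1, (D.H0.1 hh).2, hne⟩

lemma WeightData.orbitSpan_eq (D : WeightData C σ v0 χ jσ) {v : W} (hv : v ≠ 0) : orbitSpan 𝔽 σ v = ⊤ := by
  refine (D.hσ.2.2.1 _ ?_).resolve_left ?_
  · intro k w hw
    refine Submodule.span_induction (p := fun w _ => σ k w ∈ orbitSpan 𝔽 σ v) ?_ ?_ ?_ ?_ hw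
    · rintro _ ⟨g, rfl⟩
      exact Submodule.subset_span ⟨k * g, by rw [map_mul, Module.End.mul_apply]⟩
    · simp
    · intro x y _ _ h h'; rw [map_add]; exact Submodule.add_mem _ h h'
    · intro c x _ h; rw [map_smul]; exact Submodule.smul_mem _ _ h
  · refine (Submodule.ne_bot_iff _).2 ?_
    exact ⟨v, Submodule.subset_span ⟨1, by simp⟩, hv⟩

variable [CharP 𝔽 S.p]

lemma WeightData.psi_eq (D : WeightData C σ v0 χ jσ) : psi σ v0 = 0 := by
  have : Fact S.p.Prime := ⟨S.hp⟩
  by_contra h0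
  have hk := D.kvec.psi D.hK1 D.hqp
  have hsp := hk.special D.hK1 D.hqp (D.kvec.psi_psi D.hK1 D.hqp D.regChar)
  have hm := hsp.mem_of_stable (S0 := Submodule.span 𝔽 {v0}) h0
    (by rw [D.orbitSpan_eq h0]; exact le_top) ?_ ?_
  · obtain ⟨c, hc⟩ := Submodule.mem_span_singleton.1 hm
    have hc0 : c ≠ 0 := by rintro rfl; rw [zero_smul] at hc; exact h0 hc.symm
    obtain ⟨h, hh, hI, hne⟩ := D.regChar.reg
    have e := hk.eig h hh hI
    rw [← hc, map_smul, D.kvec.eig h hh hI, smul_smul, smul_smul] at e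
    have := smul_left_injective 𝔽 D.hv0 e
    rw [mul_comm] at this
    exact hne (mul_right_cancel₀ hc0 this)
  · intro x hx
    obtain ⟨c, rfl⟩ := Submodule.mem_span_singleton.1 hx
    rw [← sg_coe, map_smul]
    refine Submodule.smul_mem _ _ ?_
    have : sg σ S.uE v0 = v0 := D.kvec.fix
    rw [kU, this]
    exact Submodule.mem_span_singleton_self _
  · simpa using D.hv0

lemma WeightData.special (D : WeightData C σ v0 χ jσ) :
    Special σ S.p (kU D.hK1) (kB D.hK1) {k | (k : S.GG) ∈ S.IK1} v0 :=
  D.kvec.special D.hK1 D.hqp D.psi_eq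

/-- The weight is spanned by the vectors `β uᵃ β v₀`. -/
lemma WeightData.span_induction (D : WeightData C σ v0 χ jσ) {P : W → Prop} (h0 : P 0) (hadd : ∀ x y, P x → P y → P (x + y))
    (hsmul : ∀ (c : 𝔽) x, P x → P (c • x))
    (h : ∀ a, P (sg σ S.betaPr (sg σ (S.uE ^ a) (sg σ S.betaPr v0)))) (w : W) : P w := by
  have : Fact S.p.Prime := ⟨S.hp⟩
  have key : ∀ x ∈ bigSpan σ S.p (kU D.hK1) (kB D.hK1) v0, P (sg σ S.betaPr x) := by
    intro x hx
    refine Submodule.span_induction (p := fun x _ => P (sg σ S.betaPr x)) ?_ ?_ ?_ ?_ hx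
    · rintro _ ⟨a, rfl⟩
      have := h a
      beta_reduce
      rw [← map_pow, ← sg_coe, ← sg_coe]
      exact this
    · rw [map_zero]; exact h0
    · intro x y _ _ h h'; rw [map_add]; exact hadd _ _ h h'
    · intro c x _ h; rw [map_smul]; exact hsmul _ _ h
  have e : w = sg σ S.betaPr (sg σ S.betaPr w) := by
    rw [← sg_mul σ D.hK1 betaPr_mem betaPr_mem, betaPr_mul_self, sg_one, Module.End.one_apply]
  rw [e]
  refine key _ (D.special.orbit_le ?_)
  rw [D.orbitSpan_eq D.hv0]
  trivial

lemma WeightData.j_v0 (D : WeightData C σ v0 χ jσ) : jσ v0 = v0 := D.hj.1 _ D.hinv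

lemma WeightData.j_beta (D : WeightData C σ v0 χ jσ) (a : ℕ) :
    jσ (sg σ S.betaPr (sg σ (S.uE ^ a) (sg σ S.betaPr v0))) = v0 := by
  have h := beta_uE_beta_mem (S := S) a
  rw [← sg_mul σ D.hK1 (uE_pow_K1 a) betaPr_mem,
    ← sg_mul σ D.hK1 betaPr_mem (K1_mul (uE_pow_K1 a) betaPr_mem), ← mul_assoc]
  have := D.hj.2 v0 _ (by rw [(chamber_eq D.hK1).2.2.2.1]; exact h)
  rw [map_sub, sub_eq_zero] at this
  rw [this, D.j_v0]

lemma WeightData.j_mem (D : WeightData C σ v0 χ jσ) (w : W) : ∃ c : 𝔽, jσ w = c • v0 := by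
  refine D.span_induction (P := fun w => ∃ c : 𝔽, jσ w = c • v0) ⟨0, by simp⟩ ?_ ?_ ?_ w
  · rintro x y ⟨c, hc⟩ ⟨d, hd⟩; exact ⟨c + d, by rw [map_add, hc, hd, add_smul]⟩
  · rintro c x ⟨d, hd⟩; exact ⟨c * d, by rw [map_smul, hd, mul_smul]⟩
  · intro a; exact ⟨1, by rw [D.j_beta, one_smul]⟩

lemma WeightData.j_H (D : WeightData C σ v0 χ jσ) {h : S.GG} (hh : h ∈ S.Hset) (hI : h ∈ S.IK1) (w : W) :
    jσ (sg σ h w) = χ h • jσ w := by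
  refine D.span_induction (P := fun w => jσ (sg σ h w) = χ h • jσ w) (by simp) ?_ ?_ ?_ w
  · intro x y hx hy; rw [map_add, map_add, hx, hy, map_add, smul_add]
  · intro c x hx; rw [map_smul, map_smul, hx, map_smul, smul_comm]
  · intro a
    have hb := beta_Hset hh
    have hbK := K1_mul (K1_mul betaPr_mem hI.1) betaPr_mem
    obtain ⟨t, -, ht⟩ := H_conj_uE D.hqp hb (Hset_K1_IK1 hb hbK)
    obtain ⟨n0, hn0, e⟩ := ht a
    have hn1 := Nk_sub_Kone1 hn0
    have e1 : h * S.betaPr = S.betaPr * (S.betaPr * h * S.betaPr) := by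
      rw [← mul_assoc, ← mul_assoc, betaPr_mul_self, one_mul]
    have e2 : S.betaPr * h * S.betaPr * S.betaPr = S.betaPr * h := by
      rw [mul_assoc, betaPr_mul_self, mul_one]
    rw [D.j_beta, ← sg_mul σ D.hK1 hI.1 betaPr_mem, e1, sg_mul σ D.hK1 betaPr_mem hbK,
      ← sg_mul σ D.hK1 hbK (uE_pow_K1 a), e,
      sg_mul σ D.hK1 (K1_mul (uE_pow_K1 _) (Kone1_sub_K1 hn1)) hbK,
      ← sg_mul σ D.hK1 hbK betaPr_mem, e2, sg_mul σ D.hK1 betaPr_mem hI.1, D.kvec.eig h hh hI,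
      map_smul, map_smul, map_smul, map_smul, sg_mul σ D.hK1 (uE_pow_K1 _) (Kone1_sub_K1 hn1),
      D.kone hn1, D.j_beta]

lemma WeightData.j_beta_v0 (D : WeightData C σ v0 χ jσ) : jσ (sg σ S.betaPr v0) = 0 := by
  obtain ⟨h, hh, hI, hne⟩ := D.regChar.reg
  have hb := beta_Hset hh
  have hbK := K1_mul (K1_mul betaPr_mem hI.1) betaPr_mem
  have e := D.j_H hh hI (sg σ S.betaPr v0)
  have e1 : h * S.betaPr = S.betaPr * (S.betaPr * h * S.betaPr) := by
    rw [← mul_assoc, ← mul_assoc, betaPr_mul_self, one_mul]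
  rw [← sg_mul σ D.hK1 hI.1 betaPr_mem, e1, sg_mul σ D.hK1 betaPr_mem hbK,
    D.kvec.eig _ hb (Hset_K1_IK1 hb hbK), map_smul, map_smul, ← sub_eq_zero, ← sub_smul] at e
  exact (smul_eq_zero.1 e).resolve_left (sub_ne_zero.2 hne.symm)

lemma WeightData.exists_j_ne (D : WeightData C σ v0 χ jσ) {w : W} (hw : w ≠ 0) : ∃ a : ℕ, jσ (sg σ (S.uE ^ a) w) ≠ 0 := by
  have : Fact S.p.Prime := ⟨S.hp⟩
  by_contra! h
  let S0 : Submodule 𝔽 W := ⨅ a : ℕ, LinearMap.ker (jσ ∘ₗ sg σ (S.uE ^ a))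
  have hS0 : ∀ {x}, x ∈ S0 ↔ ∀ a : ℕ, jσ (sg σ (S.uE ^ a) x) = 0 := by
    intro x; simp [S0, Submodule.mem_iInf]
  have := D.special.mem_of_stable (S0 := S0) D.hv0 (by rw [D.orbitSpan_eq D.hv0]; exact le_top) ?_ ?_
  · have := hS0.1 this 0
    rw [pow_zero, sg_one, Module.End.one_apply, D.j_v0] at this
    exact D.hv0 this
  · intro x hx
    rw [hS0] at hx ⊢
    intro a
    have e : σ (kU D.hK1) x = sg σ S.uE x := by rw [← sg_coe]; rfl
    rw [e, ← sg_mul σ D.hK1 (uE_pow_K1 a) uE_K1, ← pow_succ]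
    exact hx _
  · refine (Submodule.ne_bot_iff _).2 ?_
    exact ⟨w, hS0.2 h, hw⟩

end WeightLemmas
end U21

namespace U21

open Setting

section Hecke

variable {S : Setting} {C : Chamber S} {𝔽 : Type} [Field 𝔽] {W : Type} [AddCommGroup W] [Module 𝔽 W]
  {σ : Representation 𝔽 ↥C.K W} {v0 : W} {χ : S.GG → 𝔽} {jσ : W →ₗ[𝔽] W}

lemma stdFn_of_mem (hK1 : (C.K : Set S.GG) = S.K1set) {g x : S.GG} (v : W) (h : x * g ∈ S.K1set) :
    stdFn C 𝔽 W σ g v x = sg σ (x * g) v := by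
  have h' := (mem_K_iff hK1).2 h
  rw [stdFn, dif_pos h', sg_eq σ h']

lemma stdFn_of_notMem (hK1 : (C.K : Set S.GG) = S.K1set) {g x : S.GG} (v : W)
    (h : x * g ∉ S.K1set) : stdFn C 𝔽 W σ g v x = 0 :=
  dif_neg (fun h' => h ((mem_K_iff hK1).1 h'))

variable (σ) in
/-- The function `[1, v]` as an element of the compact induction. -/
def stdOne (v : W) : ↥(IndSub C 𝔽 W σ) := ⟨stdFn C 𝔽 W σ 1 v, by
  refine ⟨fun k hk g => ?_, {1}, fun g hg => ?_⟩
  · by_cases h : g * 1 ∈ C.K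
    · have h' : k * g * 1 ∈ C.K := by rw [mul_assoc]; exact C.K.mul_mem hk h
      rw [stdFn, stdFn, dif_pos h, dif_pos h', ← Module.End.mul_apply, ← map_mul]
      congr 3
      exact Subtype.ext (mul_assoc _ _ _)
    · have h' : k * g * 1 ∉ C.K := by rwa [mul_assoc, C.K.mul_mem_cancel_left hk]
      rw [stdFn, stdFn, dif_neg h, dif_neg h', map_zero]
  · have h : g ∈ C.K := by
      by_contra h
      exact hg (dif_neg (by rwa [mul_one]))
    exact ⟨g, h, 1, by simp, by simp⟩⟩

lemma stdOne_of_mem (hK1 : (C.K : Set S.GG) = S.K1set) {x : S.GG} (v : W) (h : x ∈ S.K1set) :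
    (stdOne σ v : S.GG → W) x = sg σ x v := by
  have := stdFn_of_mem (σ := σ) hK1 (g := 1) v (by rwa [mul_one])
  rwa [mul_one] at this

lemma stdOne_of_notMem (hK1 : (C.K : Set S.GG) = S.K1set) {x : S.GG} (v : W) (h : x ∉ S.K1set) :
    (stdOne σ v : S.GG → W) x = 0 :=
  stdFn_of_notMem hK1 v (by rwa [mul_one])

lemma ind_mul (hK1 : (C.K : Set S.GG) = S.K1set) (F : ↥(IndSub C 𝔽 W σ)) {k : S.GG}
    (hk : k ∈ S.K1set) (g : S.GG) : (F : S.GG → W) (k * g) = sg σ k ((F : S.GG → W) g) := by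
  have h := (mem_K_iff hK1).2 hk
  rw [F.2.1 k h g, sg_eq σ h]

lemma sg_ne_zero (hK1 : (C.K : Set S.GG) = S.K1set) {k : S.GG} (hk : k ∈ S.K1set) {w : W}
    (hw : w ≠ 0) : sg σ k w ≠ 0 := by
  intro h
  apply hw
  have := sg_mul σ hK1 (K1_inv hk) hk w
  rw [h, map_zero, inv_mul_cancel, sg_one] at this
  exact this

lemma alpha_N_notMem {k : ℤ} (hk : 1 ≤ k) {n : S.GG} (hn : n ∈ S.Nset) :
    S.alphaE ^ k * n ∉ S.K1set := by
  intro h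
  refine alpha_N_bottom (w := 1) hn (by rwa [mul_one]) ?_
  simp only [mat_one, Matrix.one_apply]
  refine ⟨by simpa using zero_mem_pE _, by simpa using zero_mem_pE _, ?_⟩
  simpa using pE_mono (S := S) (by omega) one_mem_pE

lemma alpha_uN_mem {k : ℤ} (hk : 1 ≤ k) {n u : S.GG} (hn : n ∈ S.Nset) (hu : u ∈ S.Nset)
    (h : S.alphaE ^ k * n * (u * S.alphaE⁻¹) ∈ S.K1set) : k = 1 ∧ n * u ∈ S.Nk 1 := by
  have hnu := Nset_mul hn hu
  have h' : S.alphaE ^ k * (n * u) * S.alphaE⁻¹ ∈ S.K1set := by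
    rwa [← mul_assoc, mul_assoc _ u] 
  have hk1 : k = 1 := by
    by_contra hne
    refine alpha_N_bottom hnu h' ?_
    have e : S.mat S.alphaE⁻¹ = S.alphaMinv := rfl
    rw [e]
    refine ⟨by simpa [alphaMinv] using zero_mem_pE _, by simpa [alphaMinv] using zero_mem_pE _, ?_⟩
    have := (isVal_unif (S := S)).inv
    simpa [alphaMinv] using (pE_mono (by omega) this.2.1 : S.ϖ⁻¹ ∈ S.pE (1 - k))
  subst hk1
  refine ⟨rfl, ?_⟩
  have hc := alpha_conj_Nset 1 hnu
  rw [zpow_one] at hc h'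
  have h2 := alpha_conj_Nk (-1) (-1) (Nk_of_K1 hc h')
  have e : S.alphaE ^ (-1 : ℤ) * (S.alphaE * (n * u) * S.alphaE⁻¹) * (S.alphaE ^ (-1 : ℤ))⁻¹ = n * u := by
    simp only [zpow_neg, zpow_one]; group
  rw [e] at h2
  exact h2

lemma beta_uN_notMem {k : ℤ} (hk : 1 ≤ k) {n u : S.GG} (hn : n ∈ S.Nset) (hu : u ∈ S.Nk 0) :
    S.alphaE ^ k * n * (S.betaPr * u * S.alphaE⁻¹) ∉ S.K1set := by
  intro h
  refine alpha_N_bottom hn h ?_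
  obtain ⟨hu1, hu2⟩ := mem_Nk_iff.1 hu
  obtain ⟨x, y, hr, rfl⟩ := exists_nE hu1
  simp [nM] at hu2
  have hx := pE_of_rel (l := 0) (by norm_num) hr hu2
  have e : S.mat S.alphaE⁻¹ = S.alphaMinv := rfl
  have hv := isVal_unif (S := S)
  have hne := S.unif_ne
  simp only [mat_mul_apply, mat_betaPr, e, mat_nE]
  simp [nM, alphaMinv]
  refine ⟨pE_mul' hv.2.1 hv.2.1 (by omega), pE_mul' hv.2.1 hx (by omega), ?_⟩
  have : S.ϖ * y * S.ϖ⁻¹ = y := by field_simp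
  rw [this]
  exact pE_mono (by omega) hu2

lemma indRep_apply (g : S.GG) (F : ↥(IndSub C 𝔽 W σ)) (x : S.GG) :
    (indRep C 𝔽 W σ g F : S.GG → W) x = (F : S.GG → W) (x * g) := rfl

lemma exists_height (hK1 : (C.K : Set S.GG) = S.K1set) (F : ↥(IndSub C 𝔽 W σ)) (hF : F ≠ 0) :
    ∃ m : ℤ, (∃ n ∈ S.Nset, (F : S.GG → W) (S.alphaE ^ m * n) ≠ 0) ∧
      ∀ k, m < k → ∀ n ∈ S.Nset, (F : S.GG → W) (S.alphaE ^ k * n) = 0 := by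
  obtain ⟨s, hs⟩ := F.2.2
  have hne : ∃ m : ℤ, ∃ n ∈ S.Nset, (F : S.GG → W) (S.alphaE ^ m * n) ≠ 0 := by
    by_contra! h
    refine hF (Subtype.ext (funext fun x => ?_))
    obtain ⟨κ, hκ, m, n, hn, rfl⟩ := iwasawa x
    rw [mul_assoc, ind_mul hK1 F hκ, h m n hn, map_zero]; rfl
  have hb : ∃ b : ℤ, ∀ m, (∃ n ∈ S.Nset, (F : S.GG → W) (S.alphaE ^ m * n) ≠ 0) → m ≤ b := by
    choose κ hκ ht n hn e using iwasawa (S := S)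
    obtain ⟨b, hb⟩ := (s.image ht).exists_le
    refine ⟨b, ?_⟩
    rintro m ⟨n', hn', hm⟩
    obtain ⟨k, hk, t, hts, h⟩ := hs _ hm
    refine le_trans ?_ (hb _ (Finset.mem_image_of_mem _ hts))
    by_contra hlt
    refine alpha_N_notMem (k := m - ht t) (by omega)
      (alpha_conj_Nset (ht t) (Nset_mul hn' (Nset_inv (hn t)))) ?_
    have : S.alphaE ^ (m - ht t) * (S.alphaE ^ ht t * (n' * (n t)⁻¹) * (S.alphaE ^ ht t)⁻¹) = k * κ t := by
      rw [zpow_sub]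
      have h2 := h
      rw [e t] at h2
      rw [← mul_inv_eq_iff_eq_mul.2 (by rw [h2]; simp only [mul_assoc] : S.alphaE ^ m * n' = (k * κ t) * (S.alphaE ^ ht t * n t))]
      group
    rw [this]
    exact K1_mul ((mem_K_iff hK1).1 hk) (hκ t)
  obtain ⟨m, hm, hmax⟩ := Int.exists_greatest_of_bdd hb hne
  refine ⟨m, hm, fun k hk n hn => ?_⟩
  by_contra h
  exact absurd (hmax k ⟨n, hn, h⟩) (by omega)

variable [CharP 𝔽 S.p] {T : Module.End 𝔽 ↥(IndSub C 𝔽 W σ)}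

lemma WeightData.hecke_stdOne (D : WeightData C σ v0 χ jσ) (hT : IsHeckeT C 𝔽 W σ jσ T) (v : W)
    {k : ℤ} (hk : 1 ≤ k) {n : S.GG} (hn : n ∈ S.Nset) :
    (T (stdOne σ v) : S.GG → W) (S.alphaE ^ k * n) =
      jσ ((stdOne σ v : S.GG → W) (S.alphaE ^ (k - 1) * n)) := by
  obtain ⟨U2, hU2⟩ := exists_reps_Nk_neg_one (S := S) D.hqp
  obtain ⟨U1, hU1⟩ := exists_reps_Nk_zero (S := S)
  have hc := chamber_eq D.hK1
  have e := hT.2 v (stdOne σ v) rfl U2 U1 (by rw [hc.2.2.2.2.2]; exact hU2)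
    (by rw [hc.2.2.2.2.2]; exact hU1)
  rw [e, Pi.add_apply, Finset.sum_apply, Finset.sum_apply]
  rw [Finset.sum_eq_zero (s := U1), add_zero]
  swap
  · intro u hu
    refine stdFn_of_notMem D.hK1 _ ?_
    rw [hc.2.2.2.2.1]
    exact beta_uN_notMem hk hn (hU1.1 hu)
  have hterm : ∀ u ∈ U2, u ∈ S.Nset := fun u hu => (mem_Nk_iff.1 (hU2.1 hu)).1
  by_cases hk1 : k = 1
  swap
  · rw [stdOne_of_notMem D.hK1 v (alpha_N_notMem (by omega) hn), map_zero]
    refine Finset.sum_eq_zero fun u hu => stdFn_of_notMem D.hK1 _ fun h => ?_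
    exact hk1 (alpha_uN_mem hk hn (hterm u hu) h).1
  subst hk1
  rw [sub_self, zpow_zero, one_mul]
  by_cases hnK : n ∈ S.K1set
  · have hnk := Nk_of_K1 hn hnK
    obtain ⟨u, ⟨hu, hu1⟩, huniq⟩ := hU2.2 n⁻¹ (Nk_inv hnk)
    rw [inv_inv] at hu1
    rw [Finset.sum_eq_single_of_mem u hu]
    · have hm := alpha_conj_Nk 1 1 hu1
      have e1 : S.alphaE ^ (1 : ℤ) * n * (u * S.alphaE⁻¹) =
          S.alphaE ^ (1 : ℤ) * (n * u) * (S.alphaE ^ (1 : ℤ))⁻¹ := by rw [zpow_one]; group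
      have hm1 : S.alphaE ^ (1 : ℤ) * (n * u) * (S.alphaE ^ (1 : ℤ))⁻¹ ∈ S.I1K1 := Nk_sub_I1 (by simpa using hm)
      rw [stdFn_of_mem D.hK1 _ (by rw [e1]; exact I1_sub_K1 hm1), e1]
      obtain ⟨c, hcj⟩ := D.j_mem (sg σ u⁻¹ v)
      have hfix : sg σ (S.alphaE ^ (1 : ℤ) * (n * u) * (S.alphaE ^ (1 : ℤ))⁻¹) (jσ (sg σ u⁻¹ v)) = jσ (sg σ u⁻¹ v) := by
        rw [hcj, map_smul, D.inv hm1]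
      rw [hfix, stdOne_of_mem D.hK1 v hnK]
      have e2 : u⁻¹ = (n * u)⁻¹ * n := by group
      have hk0 := Nk_sub_Kone1 (Nk_mono (k := 0) (by norm_num) (Nk_inv hu1))
      rw [e2, sg_mul σ D.hK1 (Kone1_sub_K1 hk0) hnK, D.kone hk0]
    · intro u' hu' hne
      refine stdFn_of_notMem D.hK1 _ fun h => hne ?_
      exact huniq u' ⟨hu', by rw [inv_inv]; exact (alpha_uN_mem hk hn (hterm u' hu') h).2⟩
  · rw [stdOne_of_notMem D.hK1 v hnK, map_zero]
    refine Finset.sum_eq_zero fun u hu => stdFn_of_notMem D.hK1 _ fun h => hnK ?_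
    have h1 := (alpha_uN_mem hk hn (hterm u hu) h).2
    have := Nk_mul (Nk_mono (k := -1) (by norm_num) h1) (Nk_inv (hU2.1 hu))
    rw [mul_inv_cancel_right] at this
    exact Nk_K1 this

/-- The top value of `T F` is `j_σ` of the top value of `F`. -/
lemma WeightData.hecke_top (D : WeightData C σ v0 χ jσ) (hT : IsHeckeT C 𝔽 W σ jσ T)
    (F : ↥(IndSub C 𝔽 W σ)) {m : ℤ}
    (hF : ∀ k, m < k → ∀ n ∈ S.Nset, (F : S.GG → W) (S.alphaE ^ k * n) = 0)
    {k : ℤ} (hk : m < k) {n : S.GG} (hn : n ∈ S.Nset) :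
    (T F : S.GG → W) (S.alphaE ^ k * n) = jσ ((F : S.GG → W) (S.alphaE ^ (k - 1) * n)) := by
  obtain ⟨s, hs⟩ := F.2.2
  induction s using Finset.induction_on generalizing F with
  | empty =>
    have : F = 0 := by
      refine Subtype.ext (funext fun x => ?_)
      by_contra h
      obtain ⟨_, _, t, ht, _⟩ := hs x h
      simp at ht
    rw [this]; simp
  | insert t s _ ih =>
    obtain ⟨κ, hκ, m', n', hn', rfl⟩ := iwasawa t
    set t0 := S.alphaE ^ m' * n' with ht0
    by_cases h0 : (F : S.GG → W) t0 = 0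
    · refine ih F hF fun g hg => ?_
      obtain ⟨k, hk, t, ht, rfl⟩ := hs g hg
      rcases Finset.mem_insert.1 ht with rfl | ht
      · exfalso; apply hg
        have hk' := (mem_K_iff D.hK1).1 hk
        rw [mul_assoc κ, ind_mul D.hK1 F hk', ind_mul D.hK1 F hκ, ← ht0, h0, map_zero, map_zero]
      · exact ⟨k, hk, t, ht, rfl⟩
    have hm' : m' ≤ m := by
      by_contra hlt
      exact h0 (hF m' (by omega) n' hn')
    set P := indRep C 𝔽 W σ t0⁻¹ (stdOne σ ((F : S.GG → W) t0)) with hP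
    have hval : ∀ x, (P : S.GG → W) x = if x * t0⁻¹ ∈ S.K1set then (F : S.GG → W) x else 0 := by
      intro x
      rw [hP, indRep_apply]
      split_ifs with h
      · rw [stdOne_of_mem D.hK1 _ h, ← ind_mul D.hK1 F h, inv_mul_cancel_right]
      · rw [stdOne_of_notMem D.hK1 _ h]
    have hsub : ∀ x, ((F - P : ↥(IndSub C 𝔽 W σ)) : S.GG → W) x =
        if x * t0⁻¹ ∈ S.K1set then 0 else (F : S.GG → W) x := by
      intro x
      rw [Submodule.coe_sub, Pi.sub_apply, hval]
      split_ifs <;> simp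
    have e1 := ih (F - P) (fun k hk n hn => by rw [hsub, hF k hk n hn, ite_self]) (by
      intro g hg
      rw [hsub] at hg
      split_ifs at hg with hgt
      · exact absurd rfl hg
      obtain ⟨k, hk, t, ht, rfl⟩ := hs g hg
      rcases Finset.mem_insert.1 ht with rfl | ht
      · exfalso; apply hgt
        rw [mul_assoc κ, ← ht0, ← mul_assoc, mul_inv_cancel_right]
        exact K1_mul ((mem_K_iff D.hK1).1 hk) hκ
      · exact ⟨k, hk, t, ht, rfl⟩)
    have e2 : (T P : S.GG → W) (S.alphaE ^ k * n) = jσ ((P : S.GG → W) (S.alphaE ^ (k - 1) * n)) := by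
      have hc : ∀ l : ℤ, S.alphaE ^ l * n * t0⁻¹ =
          S.alphaE ^ (l - m') * (S.alphaE ^ m' * (n * n'⁻¹) * (S.alphaE ^ m')⁻¹) := by
        intro l
        rw [ht0, zpow_sub]; group
      rw [hP, hT.1, indRep_apply, indRep_apply, hc, hc, show k - 1 - m' = k - m' - 1 by ring]
      exact D.hecke_stdOne hT _ (by omega) (alpha_conj_Nset _ (Nset_mul hn (Nset_inv hn')))
    rw [map_sub, Submodule.coe_sub, Pi.sub_apply, e2, Submodule.coe_sub, Pi.sub_apply, map_sub] at e1
    exact sub_left_injective e1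

end Hecke
end U21

namespace U21

open Setting

section FirstFunction

variable {S : Setting} {C : Chamber S} {𝔽 : Type} [Field 𝔽] {W : Type} [AddCommGroup W] [Module 𝔽 W]
  {σ : Representation 𝔽 ↥C.K W} {v0 : W} {χ : S.GG → 𝔽} {jσ : W →ₗ[𝔽] W}

/-- The properties characterizing the function `f₁` of the compact induction. -/
structure IsFirst (v0 : W) (f : ↥(IndSub C 𝔽 W σ)) : Prop where
  inv : ∀ i ∈ S.I1K1, ∀ x, (f : S.GG → W) (x * i) = (f : S.GG → W) x
  supp : ∀ x, (f : S.GG → W) x ≠ 0 → ∃ κ ∈ S.K1set, ∃ i ∈ S.I1K1, x = κ * S.alphaE⁻¹ * i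
  val : (f : S.GG → W) S.alphaE⁻¹ = sg σ S.betaPr v0

lemma isFirst_ff (hK1 : (C.K : Set S.GG) = S.K1set) {ff : ℤ → ↥(IndSub C 𝔽 W σ)}
    (hff : IsFFamily C 𝔽 W σ v0 ff) : IsFirst v0 (ff 1) := by
  obtain ⟨-, -, h1, h2, h3, -⟩ := hff
  obtain ⟨-, -, e1, -, e2, -⟩ := chamber_eq hK1
  refine ⟨fun i hi x => ?_, fun x hx => ?_, ?_⟩
  · rw [← indRep_apply, h1 1 i (by rwa [e1])]
  · obtain ⟨k, hk, i, hi, rfl⟩ := h2 1 x hx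
    exact ⟨k, (mem_K_iff hK1).1 hk, i, by rwa [← e1], by simp⟩
  · have := h3 1 one_pos
    rw [e2] at this
    simpa using this

variable {f : ↥(IndSub C 𝔽 W σ)}

lemma I1K1_bottom {i : S.GG} (hi : i ∈ S.I1K1) :
    S.mat i 2 0 ∈ S.pE 2 ∧ S.mat i 2 1 ∈ S.pE 1 ∧ S.mat i 2 2 ∈ S.pE 0 :=
  ⟨hi.1.2, (mem_IK1_iff.1 hi.1) 2 1, (mem_IK1_iff.1 hi.1) 2 2⟩

lemma I1K1_inv {i : S.GG} (hi : i ∈ S.I1K1) : i⁻¹ ∈ S.I1K1 := by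
  have h := IK1_inv hi.1
  refine ⟨h, ?_, ?_, ?_⟩
  · have := pE_conj hi.2.2.2
    rw [map_sub, map_one] at this
    rw [mat_inv_apply]; exact this
  · have := pE_conj hi.2.2.1
    rw [map_sub, map_one] at this
    rw [mat_inv_apply]; exact this
  · have := pE_conj hi.2.1
    rw [map_sub, map_one] at this
    rw [mat_inv_apply]; exact this

lemma IsFirst.high (hf : IsFirst v0 f) {k : ℤ} (hk : 0 < k) {n : S.GG} (hn : n ∈ S.Nset) :
    (f : S.GG → W) (S.alphaE ^ k * n) = 0 := by
  by_contra h
  obtain ⟨κ, hκ, i, hi, e⟩ := hf.supp _ h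
  have e' : S.alphaE ^ k * n * (i⁻¹ * S.alphaE) = κ := by
    rw [← mul_assoc, e]; group
  refine alpha_N_bottom (w := i⁻¹ * S.alphaE) hn (by rwa [e']) ?_
  obtain ⟨h0, h1, h2⟩ := I1K1_bottom (I1K1_inv hi)
  have hv := isVal_unif (S := S)
  simp only [mat_mul_apply, mat_alphaE]
  simp [alphaM]
  exact ⟨pE_mul' h0 hv.inv.2.1 (by omega), pE_mono (by omega) h1, pE_mul' h2 hv.2.1 (by omega)⟩

lemma IsFirst.one (hf : IsFirst v0 f) : (f : S.GG → W) 1 = 0 := by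
  by_contra h
  obtain ⟨κ, hκ, i, hi, e⟩ := hf.supp _ h
  have e' : S.alphaE ^ (1 : ℤ) * 1 * κ⁻¹ = i := by
    have : κ⁻¹ = S.alphaE⁻¹ * i := by
      rw [inv_eq_iff_mul_eq_one, ← mul_assoc, ← e]
    rw [this, zpow_one]; group
  have hb := (mem_K1_iff.1 (K1_inv hκ))
  have h2 : S.mat i 2 2 ∈ S.pE 1 := by
    rw [← e', mul_one, mat_mul_apply, mat_alphaE_zpow]
    simp
    exact pE_mul' (isVal_unif (S := S)).2.1 (hb 2 2) (by decide)
  refine one_notMem_pE (S := S) le_rfl ?_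
  have := pE_sub h2 hi.2.2.2
  simpa using this

lemma exists_alpha_inv_decomp : ∃ n ∈ S.Nk (-2), ∃ κ ∈ S.K1set, ∃ i ∈ S.I1K1,
    n = κ * S.alphaE⁻¹ * i := by
  have hv := isVal_tz (S := S)
  have hne := S.unif_ne
  have hc : S.conj (S.tz * S.ϖ⁻¹) = -(S.tz * S.ϖ⁻¹) := by
    rw [map_mul, conj_tz, map_inv₀, S.unif_conj]; ring
  have hc0 : S.tz * S.ϖ⁻¹ ≠ 0 := mul_ne_zero hv.1 (inv_ne_zero hne)
  have key := n'E_traceless hc0 hc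
  have hr : (0 : S.E) * S.conj 0 + S.tz * S.ϖ ^ (-2 : ℤ) + S.conj (S.tz * S.ϖ ^ (-2 : ℤ)) = 0 := by
    rw [map_mul, conj_tz, map_zpow₀, S.unif_conj]; ring
  set m0 := nE 0 ((S.tz * S.ϖ⁻¹)⁻¹ * S.ϖ⁻¹)
        (rel_traceless (by rw [map_mul, conj_inv_traceless hc, map_inv₀, S.unif_conj]; ring)) with hm0
  have hm : m0 ∈ S.Nk 0 := by
    rw [mem_Nk_iff]
    refine ⟨nE_mem _ _ _, ?_⟩
    have e : (S.tz * S.ϖ⁻¹)⁻¹ * S.ϖ⁻¹ = S.tz⁻¹ := by field_simp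
    simp only [hm0, mat_nE, nM]
    simp only [Matrix.of_apply, Matrix.cons_val]
    rw [e]
    simpa using hv.inv.2.1
  refine ⟨nE 0 (S.tz * S.ϖ ^ (-2 : ℤ)) hr, mem_Nk_iff.2 ⟨nE_mem _ _ _, ?_⟩,
    S.betaPr * m0 * dE (-S.tz⁻¹) (neg_ne_zero.2 (inv_ne_zero hv.1)), ?_,
    S.betaPr * m0 * S.betaPr, Kone1_sub_I1 (beta_Nk0_mem hm), ?_⟩
  · simp only [mat_nE, nM]
    simpa using pE_mul' hv.2.1 (unif_zpow_mem (le_refl (-2 : ℤ))) (by norm_num)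
  · exact K1_mul (K1_mul betaPr_mem (Kone1_sub_K1 (Nk_sub_Kone1 hm)))
      (dE_mem_IK1 _ hv.inv.neg).1
  · have e1 : nE 0 (S.tz * S.ϖ ^ (-2 : ℤ)) hr =
        S.betaPr * n'E 0 (S.tz * S.ϖ⁻¹ * S.ϖ)
          (rel_traceless (by rw [map_mul, hc, S.unif_conj]; ring)) * S.betaPr := by
      rw [beta_conj_n'E]
      refine nE_ext (by simp) ?_
      rw [zpow_neg]; field_simp
    have e2 : dE (-(S.tz * S.ϖ⁻¹)⁻¹) (neg_ne_zero.2 (inv_ne_zero hc0)) =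
        dE (-S.tz⁻¹) (neg_ne_zero.2 (inv_ne_zero hv.1)) * S.alphaE⁻¹ := by
      have : S.alphaE⁻¹ = dE S.ϖ hne := by
        apply mat_injective
        have e : S.mat S.alphaE⁻¹ = S.alphaMinv := rfl
        rw [e, dE, mat_hE, S.unif_conj]; rfl
      rw [this, dE_mul]
      congr 1
      field_simp
    rw [e1, key, e2]
    simp only [mul_assoc]

variable [CharP 𝔽 S.p] {T : Module.End 𝔽 ↥(IndSub C 𝔽 W σ)}

lemma WeightData.notMem_range (D : WeightData C σ v0 χ jσ) (hT : IsHeckeT C 𝔽 W σ jσ T)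
    (hf : IsFirst v0 f) : f ∉ LinearMap.range T := by
  rintro ⟨F, rfl⟩
  obtain ⟨n, hn, κ, hκ, i, hi, e⟩ := exists_alpha_inv_decomp (S := S)
  have hne : (T F : S.GG → W) n ≠ 0 := by
    rw [e, hf.inv i hi, ind_mul D.hK1 _ hκ, hf.val]
    exact sg_ne_zero D.hK1 hκ (sg_ne_zero D.hK1 betaPr_mem D.hv0)
  have hF : F ≠ 0 := by
    rintro rfl
    exact hne (by rw [map_zero]; rfl)
  obtain ⟨m, ⟨n1, hn1, hm1⟩, hm⟩ := exists_height D.hK1 F hF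
  have hm0 : m < 0 := by
    by_contra hlt
    obtain ⟨a, ha⟩ := D.exists_j_ne hm1
    have hu := uE_pow_mem (S := S) a
    apply ha
    have h1 := D.hecke_top hT F hm (k := m + 1) (by omega)
      (n := S.alphaE ^ (-m) * S.uE ^ a * (S.alphaE ^ (-m))⁻¹ * n1)
      (Nset_mul (alpha_conj_Nset _ (mem_Nk_iff.1 hu).1) hn1)
    rw [hf.high (by omega) (Nset_mul (alpha_conj_Nset _ (mem_Nk_iff.1 hu).1) hn1)] at h1
    rw [← ind_mul D.hK1 F (uE_pow_K1 a), h1]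
    congr 2
    rw [add_sub_cancel_right, zpow_neg]; group
  have h1 := D.hecke_top hT F hm hm0 (mem_Nk_iff.1 hn).1
  have h2 := D.hecke_top hT F hm hm0 one_mem_Nset
  rw [zpow_zero, one_mul] at h1 h2
  have hc := alpha_conj_Nk (0 - 1) (-2) hn
  have hk := Nk_sub_Kone1 (Nk_mono (k := 0) (by norm_num) hc)
  have e3 : S.alphaE ^ (0 - 1 : ℤ) * n =
      (S.alphaE ^ (0 - 1 : ℤ) * n * (S.alphaE ^ (0 - 1 : ℤ))⁻¹) * S.alphaE ^ (0 - 1 : ℤ) := by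
    group
  rw [e3, ind_mul D.hK1 F (Kone1_sub_K1 hk), D.kone hk] at h1
  rw [hf.one, mul_one] at h2
  exact hne (h1.trans h2.symm)

end FirstFunction
end U21

namespace U21

open Setting

section Relation

variable {S : Setting} {C : Chamber S} {𝔽 : Type} [Field 𝔽] {W : Type} [AddCommGroup W] [Module 𝔽 W]
  {σ : Representation 𝔽 ↥C.K W} {v0 : W} {χ : S.GG → 𝔽} {jσ : W →ₗ[𝔽] W}
  {f : ↥(IndSub C 𝔽 W σ)}

lemma I1K1_conj {h i : S.GG} (hh : h ∈ S.IK1) (hi : i ∈ S.I1K1) : h * i * h⁻¹ ∈ S.I1K1 := by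
  rw [mem_I1K1_iff] at *
  have h1 := mem_IK1_iff.1 hh
  have h2 := mem_IK1_iff.1 (IK1_inv hh)
  have e : S.mat (h * i * h⁻¹) - 1 = S.mat h * (S.mat i - 1) * S.mat h⁻¹ := by
    rw [mul_sub, sub_mul, mul_one, ← mat_mul, ← mat_mul, ← mat_mul, mul_inv_cancel, mat_one]
  rw [e]
  exact (h1.mul (c := i1M) hi (by decide)).mul h2 (by decide)

lemma alpha_N_height {m : ℤ} {n : S.GG} (hn : n ∈ S.Nset) (h : S.alphaE ^ m * n ∈ S.K1set) :
    m = 0 := by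
  rcases lt_trichotomy m 0 with hm | hm | hm
  · exfalso
    refine alpha_N_notMem (k := -m) (by omega) (alpha_conj_Nset m (Nset_inv hn)) ?_
    have e : S.alphaE ^ (-m) * (S.alphaE ^ m * n⁻¹ * (S.alphaE ^ m)⁻¹) = (S.alphaE ^ m * n)⁻¹ := by
      rw [zpow_neg]; group
    rw [e]; exact K1_inv h
  · exact hm
  · exact absurd h (alpha_N_notMem (by omega) hn)

lemma alpha_Hset {h : S.GG} (hh : h ∈ S.Hset) : S.alphaE * h = h * S.alphaE := by
  obtain ⟨a, b, ha, hb, rfl⟩ := exists_hE hh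
  apply mat_injective
  ext i j
  simp only [mat_mul_apply, mat_alphaE, mat_hE]
  fin_cases i <;> fin_cases j <;> simp [alphaM, mul_comm]

lemma alpha_inv_Hset {h : S.GG} (hh : h ∈ S.Hset) : S.alphaE⁻¹ * h = h * S.alphaE⁻¹ := by
  rw [inv_mul_eq_iff_eq_mul, ← mul_assoc, alpha_Hset hh, mul_inv_cancel_right]

lemma alpha_betaPr : S.alphaE * S.betaPr = S.betaPr * S.alphaE⁻¹ := by
  have e : S.mat S.alphaE⁻¹ = S.alphaMinv := rfl
  apply mat_injective
  ext i j
  simp only [mat_mul_apply, mat_alphaE, mat_betaPr, e]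
  fin_cases i <;> fin_cases j <;> simp [alphaM, alphaMinv, S.unif_ne]

/-- Every element of `K α⁻¹ I₁` lies in `K α⁻¹ β N₀ β`. -/
lemma alpha_inv_I1_decomp {i : S.GG} (hi : i ∈ S.I1K1) :
    ∃ κ ∈ S.K1set, ∃ n ∈ S.Nk 0, S.alphaE⁻¹ * i = κ * S.alphaE⁻¹ * (S.betaPr * n * S.betaPr) := by
  obtain ⟨n, hn, h, hh, hI, x, y, hr, hy, rfl⟩ := IK1_decomp' hi.1
  have hc := alpha_conj_Nk (-1) (-1) hn
  refine ⟨S.alphaE ^ (-1 : ℤ) * n * (S.alphaE ^ (-1 : ℤ))⁻¹ * h,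
    K1_mul (Kone1_sub_K1 (Nk_sub_Kone1 (Nk_mono (by norm_num) hc))) hI.1,
    S.betaPr * n'E x y hr * S.betaPr, ?_, ?_⟩
  · rw [beta_conj_n'E, mem_Nk_iff]
    refine ⟨nE_mem _ _ _, ?_⟩
    have hu := (isVal_unif (S := S)).inv.2.1
    have : S.ϖ⁻¹ * S.ϖ⁻¹ * y ∈ S.pE 0 := pE_mul' (pE_mul hu hu) hy (by norm_num)
    simpa [nM] using this
  · have e : S.betaPr * (S.betaPr * n'E x y hr * S.betaPr) * S.betaPr = n'E x y hr := by
      simp only [mul_assoc, betaPr_mul_self, mul_one]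
      rw [← mul_assoc, betaPr_mul_self, one_mul]
    have e2 : S.alphaE ^ (-1 : ℤ) * n * (S.alphaE ^ (-1 : ℤ))⁻¹ * h * S.alphaE⁻¹ =
        S.alphaE⁻¹ * n * h := by
      rw [mul_assoc _ h, ← alpha_inv_Hset hh, zpow_neg, zpow_one]
      group
    rw [e, e2]
    simp only [mul_assoc]

lemma IsFirst.alpha_beta (hf : IsFirst v0 f) (hK1 : (C.K : Set S.GG) = S.K1set) {n : S.GG}
    (hn : n ∈ S.Nk 0) : (f : S.GG → W) (S.alphaE * n * S.betaPr) = v0 := by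
  have e : S.alphaE * n * S.betaPr = S.betaPr * S.alphaE⁻¹ * (S.betaPr * n * S.betaPr) := by
    rw [← alpha_betaPr]
    calc _ = S.alphaE * 1 * n * S.betaPr := by rw [mul_one]
      _ = _ := by rw [← betaPr_mul_self]; simp only [mul_assoc]
  rw [e, hf.inv _ (Kone1_sub_I1 (beta_Nk0_mem hn)), ind_mul hK1 f betaPr_mem, hf.val,
    ← sg_mul σ hK1 betaPr_mem betaPr_mem, betaPr_mul_self, sg_one, Module.End.one_apply]

lemma IsFirst.alpha_N_beta (hf : IsFirst v0 f) {m : ℤ} {n : S.GG} (hn : n ∈ S.Nset)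
    (h : (f : S.GG → W) (S.alphaE ^ m * n * S.betaPr) ≠ 0) : m = 1 ∧ n ∈ S.Nk 0 := by
  obtain ⟨κ, hκ, i, hi, e⟩ := hf.supp _ h
  obtain ⟨κ', hκ', n0, hn0, e'⟩ := alpha_inv_I1_decomp hi
  rw [mul_assoc κ, e'] at e
  have hn0' := (mem_Nk_iff.1 hn0).1
  have e2 : S.alphaE ^ m * n = κ * κ' * S.betaPr * (S.alphaE * n0) := by
    have e3 : S.alphaE ^ m * n = κ * (κ' * S.alphaE⁻¹ * (S.betaPr * n0 * S.betaPr)) * S.betaPr⁻¹ := by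
      rw [← e]; group
    have e4 : S.alphaE⁻¹ * S.betaPr = S.betaPr * S.alphaE := by
      rw [inv_mul_eq_iff_eq_mul, ← mul_assoc, alpha_betaPr, inv_mul_cancel_right]
    rw [e3]
    calc _ = κ * κ' * (S.alphaE⁻¹ * S.betaPr) * n0 * (S.betaPr * S.betaPr⁻¹) := by
          simp only [mul_assoc]
      _ = _ := by rw [e4, mul_inv_cancel, mul_one]; simp only [mul_assoc]
  have hk : κ * κ' * S.betaPr ∈ S.K1set := K1_mul (K1_mul hκ hκ') betaPr_mem
  have e5 : S.alphaE ^ (m - 1) * (S.alphaE ^ (1 : ℤ) * (n * n0⁻¹) * (S.alphaE ^ (1 : ℤ))⁻¹) =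
      κ * κ' * S.betaPr := by
    rw [← mul_inv_eq_iff_eq_mul.2 e2, zpow_sub]; group
  have hN := alpha_conj_Nset 1 (Nset_mul hn (Nset_inv hn0'))
  have hm := alpha_N_height hN (by rw [e5]; exact hk)
  obtain rfl : m = 1 := by omega
  refine ⟨rfl, ?_⟩
  rw [sub_self, zpow_zero, one_mul] at e5
  have h6 := alpha_conj_Nk (-1) (-1) (Nk_of_K1 hN (by rw [e5]; exact hk))
  have e7 : S.alphaE ^ (-1 : ℤ) * (S.alphaE ^ (1 : ℤ) * (n * n0⁻¹) * (S.alphaE ^ (1 : ℤ))⁻¹) *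
      (S.alphaE ^ (-1 : ℤ))⁻¹ = n * n0⁻¹ := by
    simp only [zpow_neg, zpow_one]; group
  rw [e7] at h6
  have := Nk_mul (Nk_mono (k := 0) (by norm_num) h6) hn0
  rwa [inv_mul_cancel_right] at this

lemma uE_pow_Nk0_inj {n : S.GG} {a b : ℕ} (ha : a < S.p) (hb : b < S.p)
    (h1 : n * S.uE ^ a ∈ S.Nk 0) (h2 : n * S.uE ^ b ∈ S.Nk 0) : a = b := by
  have key : ∀ {a b : ℕ}, a < b → b < S.p → n * S.uE ^ a ∈ S.Nk 0 → n * S.uE ^ b ∈ S.Nk 0 →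
      False := by
    intro a b hab hb h1 h2
    have h := Nk_mul (Nk_inv h1) h2
    have e : (n * S.uE ^ a)⁻¹ * (n * S.uE ^ b) = S.uE ^ (b - a) := by
      obtain ⟨c, rfl⟩ := Nat.exists_eq_add_of_lt hab
      rw [show a + c + 1 - a = c + 1 by omega, add_assoc, pow_add _ a]; group
    rw [e] at h
    exact beta_uE_beta_notMem (by omega) (by omega) (Kone1_sub_I1 (beta_Nk0_mem h)).1
  rcases lt_trichotomy a b with h | h | h
  · exact (key h hb h1 h2).elim
  · exact h
  · exact (key h ha h2 h1).elim

lemma IsFirst.eig (hf : IsFirst v0 f) (hK1 : (C.K : Set S.GG) = S.K1set) (hkv : KVec σ χ v0)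
    {h : S.GG} (hh : h ∈ S.Hset) (hI : h ∈ S.IK1) (x : S.GG) :
    (f : S.GG → W) (x * h) = χ (S.betaPr * h * S.betaPr) • (f : S.GG → W) x := by
  have key : ∀ {h : S.GG}, h ∈ S.Hset → h ∈ S.IK1 → ∀ κ i : S.GG,
      κ * S.alphaE⁻¹ * i * h = κ * h * S.alphaE⁻¹ * (h⁻¹ * i * h) := by
    intro h hh hI κ i
    rw [mul_assoc κ h, ← alpha_inv_Hset hh]; group
  have hconj : ∀ {h i : S.GG}, h ∈ S.IK1 → i ∈ S.I1K1 → h⁻¹ * i * h ∈ S.I1K1 := by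
    intro h i hI hi
    have := I1K1_conj (IK1_inv hI) hi
    rwa [inv_inv] at this
  have hb := beta_Hset hh
  have hbK := K1_mul (K1_mul betaPr_mem hI.1) betaPr_mem
  have e1 : h * S.betaPr = S.betaPr * (S.betaPr * h * S.betaPr) := by
    rw [← mul_assoc, ← mul_assoc, betaPr_mul_self, one_mul]
  by_cases hx : ∃ κ ∈ S.K1set, ∃ i ∈ S.I1K1, x = κ * S.alphaE⁻¹ * i
  · obtain ⟨κ, hκ, i, hi, rfl⟩ := hx
    rw [key hh hI, hf.inv _ (hconj hI hi), hf.inv _ hi, ind_mul hK1 f (K1_mul hκ hI.1),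
      ind_mul hK1 f hκ, hf.val, sg_mul σ hK1 hκ hI.1, ← sg_mul σ hK1 hI.1 betaPr_mem, e1,
      sg_mul σ hK1 betaPr_mem hbK, hkv.eig _ hb (Hset_K1_IK1 hb hbK), map_smul, map_smul]
  · have h0 : (f : S.GG → W) x = 0 := by
      by_contra hne; exact hx (hf.supp _ hne)
    rw [h0, smul_zero]
    by_contra hne
    obtain ⟨κ, hκ, i, hi, e⟩ := hf.supp _ hne
    refine hx ⟨κ * h⁻¹, K1_mul hκ (K1_inv hI.1), h * i * h⁻¹, I1K1_conj hI hi, ?_⟩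
    have hh' : h⁻¹ ∈ S.Hset := by
      obtain ⟨a, b, ha, hb, rfl⟩ := exists_hE hh
      rw [hE_inv]; exact hE_mem _ _ _ _
    have := key hh' (IK1_inv hI) κ i
    rw [← e, mul_inv_cancel_right, inv_inv] at this
    exact this

variable [CharP 𝔽 S.p] {T : Module.End 𝔽 ↥(IndSub C 𝔽 W σ)}

lemma WeightData.hecke_v0_low (D : WeightData C σ v0 χ jσ) (hT : IsHeckeT C 𝔽 W σ jσ T)
    {m : ℤ} (hm : m ≠ 1) {n : S.GG} (hn : n ∈ S.Nset) :
    (T (stdOne σ v0) : S.GG → W) (S.alphaE ^ m * n) = 0 := by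
  obtain ⟨U2, hU2⟩ := exists_reps_Nk_neg_one (S := S) D.hqp
  obtain ⟨U1, hU1⟩ := exists_reps_Nk_zero (S := S)
  have hc := chamber_eq D.hK1
  have e := hT.2 v0 (stdOne σ v0) rfl U2 U1 (by rw [hc.2.2.2.2.2]; exact hU2)
    (by rw [hc.2.2.2.2.2]; exact hU1)
  rw [e, Pi.add_apply, Finset.sum_apply, Finset.sum_apply, Finset.sum_eq_zero, zero_add]
  · refine Finset.sum_eq_zero fun u _ => ?_
    have h0 := D.j_beta_v0
    rw [hc.2.2.2.2.1, h0]
    rw [stdFn]; split_ifs <;> simp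
  · intro u hu
    refine stdFn_of_notMem D.hK1 _ fun h => hm ?_
    have hN := alpha_conj_Nset 1 (Nset_mul hn (mem_Nk_iff.1 (hU2.1 hu)).1)
    have e5 : S.alphaE ^ (m - 1) * (S.alphaE ^ (1 : ℤ) * (n * u) * (S.alphaE ^ (1 : ℤ))⁻¹) =
      S.alphaE ^ m * n * (u * S.alphaE⁻¹) := by
      rw [zpow_sub]; group
    have := alpha_N_height hN (by rw [e5]; exact h)
    omega

lemma WeightData.hecke_v0 (D : WeightData C σ v0 χ jσ) (hT : IsHeckeT C 𝔽 W σ jσ T)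
    (hf : IsFirst v0 f) :
    T (stdOne σ v0) =
      ∑ a ∈ Finset.range S.p, indRep C 𝔽 W σ (S.uE ^ a) (indRep C 𝔽 W σ S.betaPr f) := by
  have : Fact S.p.Prime := ⟨S.hp⟩
  refine Subtype.ext (funext fun x => ?_)
  rw [AddSubmonoidClass.coe_finset_sum, Finset.sum_apply]
  simp only [indRep_apply]
  obtain ⟨κ, hκ, m, n, hn, rfl⟩ := iwasawa x
  have e : ∀ a, κ * S.alphaE ^ m * n * S.uE ^ a * S.betaPr =
      κ * (S.alphaE ^ m * (n * S.uE ^ a) * S.betaPr) := by intro a; simp only [mul_assoc]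
  simp only [e, ind_mul D.hK1 f hκ]
  rw [mul_assoc κ, ind_mul D.hK1 _ hκ, ← map_sum]
  congr 1
  have hNu : ∀ a, n * S.uE ^ a ∈ S.Nset := fun a => Nset_mul hn (mem_Nk_iff.1 (uE_pow_mem a)).1
  by_cases hm : m = 1
  swap
  · rw [D.hecke_v0_low hT hm hn, Finset.sum_eq_zero]
    intro a _
    by_contra hne
    exact hm (hf.alpha_N_beta (hNu a) hne).1
  subst hm
  rw [D.hecke_stdOne hT v0 le_rfl hn, sub_self, zpow_zero, one_mul]
  by_cases hnK : n ∈ S.K1set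
  · rw [stdOne_of_mem D.hK1 v0 hnK, D.inv (Nk_sub_I1 (Nk_of_K1 hn hnK)), D.j_v0]
    obtain ⟨a, ha, n0, hn0, e⟩ := exists_uE_pow D.hqp (Nk_inv (Nk_of_K1 hn hnK))
    have hna : n * S.uE ^ a ∈ S.Nk 0 := by
      have : n * S.uE ^ a = n0⁻¹ := by
        rw [← inv_inv n, e]; group
      rw [this]; exact Nk_inv hn0
    rw [Finset.sum_eq_single_of_mem a (Finset.mem_range.2 ha), zpow_one, hf.alpha_beta D.hK1 hna]
    intro b hb hne
    by_contra h
    exact hne (uE_pow_Nk0_inj (Finset.mem_range.1 hb) ha (hf.alpha_N_beta (hNu b) h).2 hna)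
  · rw [stdOne_of_notMem D.hK1 v0 hnK, map_zero, Finset.sum_eq_zero]
    intro a _
    by_contra h
    apply hnK
    have := Nk_mul (Nk_mono (k := -1) (by norm_num) (hf.alpha_N_beta (hNu a) h).2)
      (Nk_inv (uE_pow_mem a))
    rw [mul_inv_cancel_right] at this
    exact Nk_K1 this

/-- The action of `K` on the quotient of the compact induction by the image of `T`. -/
def quotRep (hT : IsHeckeT C 𝔽 W σ jσ T) :
    Representation 𝔽 ↥C.K (↥(IndSub C 𝔽 W σ) ⧸ LinearMap.range T) where
  toFun k := Submodule.mapQ _ _ (indRep C 𝔽 W σ k) (by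
    rintro _ ⟨y, rfl⟩
    exact ⟨indRep C 𝔽 W σ k y, hT.1 _ _⟩)
  map_one' := by
    refine LinearMap.ext fun x => ?_
    obtain ⟨y, rfl⟩ := Submodule.Quotient.mk_surjective _ x
    rw [Submodule.mapQ_apply, Subgroup.coe_one, map_one]; rfl
  map_mul' k l := by
    refine LinearMap.ext fun x => ?_
    obtain ⟨y, rfl⟩ := Submodule.Quotient.mk_surjective _ x
    rw [Submodule.mapQ_apply, Subgroup.coe_mul, map_mul]; rfl

lemma quotRep_mk (hT : IsHeckeT C 𝔽 W σ jσ T) (k : ↥C.K) (y : ↥(IndSub C 𝔽 W σ)) :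
    quotRep hT k (Submodule.Quotient.mk y) = Submodule.Quotient.mk (indRep C 𝔽 W σ k y) := rfl

lemma sg_quotRep_mk (hK1 : (C.K : Set S.GG) = S.K1set) (hT : IsHeckeT C 𝔽 W σ jσ T) {k : S.GG}
    (hk : k ∈ S.K1set) (y : ↥(IndSub C 𝔽 W σ)) :
    sg (quotRep hT) k (Submodule.Quotient.mk y) = Submodule.Quotient.mk (indRep C 𝔽 W σ k y) := by
  rw [sg_eq _ ((mem_K_iff hK1).2 hk), quotRep_mk]

lemma WeightData.quot_kvec (D : WeightData C σ v0 χ jσ) (hT : IsHeckeT C 𝔽 W σ jσ T)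
    (hf : IsFirst v0 f) :
    KVec (quotRep hT) (fun h => χ (S.betaPr * h * S.betaPr)) (Submodule.Quotient.mk f) where
  one z hz := by
    rw [sg_quotRep_mk D.hK1 hT (Kone1_sub_K1 hz)]
    congr 1
    exact Subtype.ext (funext fun x => hf.inv z (Kone1_sub_I1 hz) x)
  fix := by
    rw [sg_quotRep_mk D.hK1 hT uE_K1]
    congr 1
    exact Subtype.ext (funext fun x => hf.inv _ (Nk_sub_I1 uE_mem) x)
  eig h hh hI := by
    rw [sg_quotRep_mk D.hK1 hT hI.1, ← Submodule.Quotient.mk_smul]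
    congr 1
    exact Subtype.ext (funext fun x => hf.eig D.hK1 D.kvec hh hI x)

lemma WeightData.quot_psi (D : WeightData C σ v0 χ jσ) (hT : IsHeckeT C 𝔽 W σ jσ T)
    (hf : IsFirst v0 f) : psi (quotRep hT) (Submodule.Quotient.mk f) = 0 := by
  have e : psi (quotRep hT) (Submodule.Quotient.mk f) =
      Submodule.Quotient.mk (T (stdOne σ v0)) := by
    rw [D.hecke_v0 hT hf, psi, ← Submodule.mkQ_apply, ← Submodule.mkQ_apply, map_sum]
    refine Finset.sum_congr rfl fun a _ => ?_
    rw [Submodule.mkQ_apply, Submodule.mkQ_apply, sg_quotRep_mk D.hK1 hT betaPr_mem,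
      sg_quotRep_mk D.hK1 hT (uE_pow_K1 a)]
  rw [e, Submodule.Quotient.mk_eq_zero]
  exact ⟨_, rfl⟩

end Relation
end U21

namespace U21

open Setting

/-- A `p`-periodic operator in characteristic `p` has a fixed vector. -/
lemma exists_fixed_of_pow {𝔽 : Type} [Field 𝔽] {V : Type} [AddCommGroup V] [Module 𝔽 V] {p : ℕ}
    [Fact p.Prime] [CharP 𝔽 p] {U : Module.End 𝔽 V} {M : Submodule 𝔽 V} (hM : ∀ x ∈ M, U x ∈ M)
    {s : V} (hs : s ∈ M) (hs0 : s ≠ 0) (hp : (U ^ p) s = s) : ∃ f ∈ M, f ≠ 0 ∧ U f = f := by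
  have : Nontrivial V := ⟨⟨s, 0, hs0⟩⟩
  have : CharP (Module.End 𝔽 V) p :=
    charP_of_injective_algebraMap (FaithfulSMul.algebraMap_injective 𝔽 (Module.End 𝔽 V)) p
  have hX : ((U - 1) ^ p) s = 0 := by
    rw [sub_pow_char_of_commute p (Commute.one_right _), one_pow, LinearMap.sub_apply, hp,
      Module.End.one_apply, sub_self]
  obtain ⟨m, hm0, hm1⟩ := exists_ker_of_nilpotent hs0 hX
  refine ⟨_, ?_, hm0, sub_eq_zero.1 hm1⟩
  clear hm0 hm1
  induction m with
  | zero => simpa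
  | succ m ih =>
    rw [pow_succ', Module.End.mul_apply]
    exact M.sub_mem (hM _ ih) ih

section PrincipalSeries

variable {S : Setting} {C : Chamber S} {𝔽 : Type} [Field 𝔽] {χ : S.GG → 𝔽}

lemma Setting.RegChar.beta (h : RegChar χ) : RegChar fun t => χ (S.betaPr * t * S.betaPr) := by
  have hI : ∀ {t : S.GG}, t ∈ S.Hset → t ∈ S.IK1 → S.betaPr * t * S.betaPr ∈ S.IK1 := fun ht ht' =>
    Hset_K1_IK1 (beta_Hset ht) (K1_mul (K1_mul betaPr_mem ht'.1) betaPr_mem)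
  have hbb : ∀ t, S.betaPr * (S.betaPr * t * S.betaPr) * S.betaPr = t := fun t => by
    simp only [mul_assoc, betaPr_mul_self, mul_one]
    rw [← mul_assoc, betaPr_mul_self, one_mul]
  refine ⟨fun t ht t' ht' hI1 hI2 => ?_, fun t ht ht1 => ?_, ?_⟩
  · have e : S.betaPr * (t * t') * S.betaPr =
        S.betaPr * t * S.betaPr * (S.betaPr * t' * S.betaPr) := by
      calc _ = S.betaPr * t * 1 * t' * S.betaPr := by simp only [mul_assoc, one_mul]
        _ = _ := by rw [← betaPr_mul_self]; simp only [mul_assoc]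
    simp only [e]
    exact h.mul _ (beta_Hset ht) _ (beta_Hset ht') (hI ht hI1) (hI ht' hI2)
  · refine h.one _ (beta_Hset ht) ?_
    have hv := IK1_isVal ht1.1
    have hm := mem_I1K1_iff.1 ht1
    obtain ⟨a, b, ha, hb, rfl⟩ := exists_hE ht
    have h0 := hm 0 0
    have h1 := hm 1 1
    simp [mat_hE, i1M] at hv h0 h1
    rw [beta_conj_hE]
    refine hE_mem_I1 _ _ ?_ h1
    have e : (S.conj a)⁻¹ - 1 = -((S.conj a)⁻¹ * S.conj (a - 1)) := by
      have : S.conj a ≠ 0 := (map_ne_zero _).2 ha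
      rw [map_sub, map_one]; field_simp; ring
    rw [e]
    exact pE_neg (pE_mul' hv.conj.inv.2.1 (pE_conj h0) (by norm_num))
  · obtain ⟨t, ht, ht', hne⟩ := h.reg
    exact ⟨S.betaPr * t * S.betaPr, beta_Hset ht, hI ht ht', by simpa only [hbb] using hne.symm.symm⟩

/-- The action of `K` on the principal series by right translation. -/
def psRep (hK1 : (C.K : Set S.GG) = S.K1set) (χ : S.GG → 𝔽) :
    Representation 𝔽 ↥C.K ↥(PSchiSub C 𝔽 χ) where
  toFun k :=
    { toFun := fun f => ⟨PSact C 𝔽 k f, fun b hb x => by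
          simp only [PSact, mul_assoc]; exact f.2.1 b hb _, fun h hh x => by
          simp only [PSact, mul_assoc]; exact f.2.2.1 h hh _, fun z hz x => by
          have e : x * z * k = x * k * (k⁻¹ * z * k) := by group
          simp only [PSact, e]
          refine f.2.2.2 _ ?_ _
          have h1 := (chamber_eq hK1).1
          rw [h1] at hz ⊢
          have := Kone1_conj (K1_inv ((mem_K_iff hK1).1 k.2)) hz
          rwa [inv_inv] at this⟩
      map_add' := fun _ _ => rfl
      map_smul' := fun _ _ => rfl }
  map_one' := LinearMap.ext fun f => Subtype.ext (funext fun x =>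
    congrArg (f : ↥C.K → 𝔽) (mul_one x))
  map_mul' k l := LinearMap.ext fun f => Subtype.ext (funext fun x =>
    congrArg (f : ↥C.K → 𝔽) (mul_assoc x k l).symm)

/-- The value at `g ∈ K` of an element of the principal series. -/
def psVal (g : S.GG) : ↥(PSchiSub C 𝔽 χ) →ₗ[𝔽] 𝔽 :=
  if h : g ∈ C.K then LinearMap.proj ⟨g, h⟩ ∘ₗ (PSchiSub C 𝔽 χ).subtype else 0

lemma psVal_of_mem {g : S.GG} (h : g ∈ C.K) (f : ↥(PSchiSub C 𝔽 χ)) :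
    psVal g f = (f : ↥C.K → 𝔽) ⟨g, h⟩ := by
  rw [psVal, dif_pos h]; rfl

variable {f : ↥(PSchiSub C 𝔽 χ)} {g b : S.GG}

lemma one_K1 : (1 : S.GG) ∈ S.K1set := by simpa using uE_pow_K1 (S := S) 0

lemma psVal_sg (hK1 : (C.K : Set S.GG) = S.K1set) (hg : g ∈ S.K1set) (hb : b ∈ S.K1set) (f : ↥(PSchiSub C 𝔽 χ)) :
    psVal g (sg (psRep hK1 χ) b f) = psVal (g * b) f := by
  rw [← mem_K_iff hK1] at hg hb
  rw [psVal_of_mem hg, psVal_of_mem (C.K.mul_mem hg hb), sg_eq _ hb]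
  rfl

lemma psVal_I1 (hK1 : (C.K : Set S.GG) = S.K1set) (hb : b ∈ S.I1K1) (hg : g ∈ S.K1set) (f : ↥(PSchiSub C 𝔽 χ)) :
    psVal (b * g) f = psVal g f := by
  have hb' := (mem_K_iff hK1).2 hb.1.1
  rw [← mem_K_iff hK1] at hg
  rw [psVal_of_mem hg, psVal_of_mem (C.K.mul_mem hb' hg)]
  exact f.2.1 ⟨b, hb'⟩ (by rw [(chamber_eq hK1).2.2.1]; exact hb) ⟨g, hg⟩

lemma psVal_H (hK1 : (C.K : Set S.GG) = S.K1set) (hb : b ∈ S.Hset) (hI : b ∈ S.IK1) (hg : g ∈ S.K1set) (f : ↥(PSchiSub C 𝔽 χ)) :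
    psVal (b * g) f = χ b * psVal g f := by
  have hb' := (mem_K_iff hK1).2 hI.1
  rw [← mem_K_iff hK1] at hg
  rw [psVal_of_mem hg, psVal_of_mem (C.K.mul_mem hb' hg)]
  refine f.2.2.1 ⟨b, hb'⟩ ?_ ⟨g, hg⟩
  rw [Chamber.H0, (chamber_eq hK1).2.1]; exact ⟨hb, hI⟩

lemma ps_one (hK1 : (C.K : Set S.GG) = S.K1set) : ∀ z ∈ S.Kone1, sg (psRep hK1 χ) z f = f := by
  intro z hz
  rw [sg_eq _ ((mem_K_iff hK1).2 (Kone1_sub_K1 hz))]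
  refine Subtype.ext (funext fun x => ?_)
  exact f.2.2.2 ⟨z, _⟩ (by rw [(chamber_eq hK1).1]; exact hz) x

lemma psVal_IK (hK1 : (C.K : Set S.GG) = S.K1set) (hb : b ∈ S.IK1) (hg : g ∈ S.K1set) (f : ↥(PSchiSub C 𝔽 χ)) :
    ∃ c : 𝔽, psVal (b * g) f = c * psVal g f := by
  obtain ⟨n, hn, t, ht, hI, x, y, hr, hy, rfl⟩ := IK1_decomp' hb
  have hz := n'E_mem_Kone1 hr hy
  refine ⟨χ t, ?_⟩
  rw [mul_assoc, mul_assoc, psVal_I1 hK1 (Nk_sub_I1 hn) (K1_mul hI.1 (K1_mul (Kone1_sub_K1 hz) hg)),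
    psVal_H hK1 ht hI (K1_mul (Kone1_sub_K1 hz) hg), psVal_I1 hK1 (Kone1_sub_I1 hz) hg]

/-- A fixed vector of the unipotent radical is determined by its values at `1` and `β`. -/
lemma ps_eq_zero (hK1 : (C.K : Set S.GG) = S.K1set) (hqp : S.q = S.p) (hf : sg (psRep hK1 χ) S.uE f = f)
    (h1 : psVal 1 f = 0) (hβ : psVal S.betaPr f = 0) : f = 0 := by
  refine Subtype.ext (funext fun x => ?_)
  have hx := (mem_K_iff hK1).1 x.2
  suffices psVal (x : S.GG) f = 0 by rwa [psVal_of_mem x.2] at this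
  rcases bruhat hqp (K1_inv hx) with hI | ⟨a, -, i, hi, e⟩
  · have hI' := IK1_inv hI
    rw [inv_inv] at hI'
    obtain ⟨c, hc⟩ := psVal_IK hK1 hI' (one_K1 (S := S)) f
    rw [mul_one, h1, mul_zero] at hc
    exact hc
  · have e2 : (x : S.GG) * S.uE ^ a = i⁻¹ * S.betaPr := by
      rw [← inv_inv (x : S.GG), e, mul_inv_rev, mul_inv_rev, betaPr_inv]; group
    obtain ⟨c, hc⟩ := psVal_IK hK1 (IK1_inv hi) betaPr_mem f
    rw [← e2, hβ, mul_zero, ← psVal_sg hK1 hx (uE_pow_K1 a), fix_pow hK1 hf] at hc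
    exact hc

lemma ps_ext (hK1 : (C.K : Set S.GG) = S.K1set) (hqp : S.q = S.p) {f' : ↥(PSchiSub C 𝔽 χ)} (hf : sg (psRep hK1 χ) S.uE f = f)
    (hf' : sg (psRep hK1 χ) S.uE f' = f')
    (h1 : psVal 1 f = psVal 1 f') (hβ : psVal S.betaPr f = psVal S.betaPr f') : f = f' := by
  rw [← sub_eq_zero]
  refine ps_eq_zero hK1 hqp (by rw [map_sub, hf, hf']) ?_ ?_ <;> rw [map_sub, sub_eq_zero] <;>
    assumption

lemma ps_fix_H (hK1 : (C.K : Set S.GG) = S.K1set) (hqp : S.q = S.p) (hf : sg (psRep hK1 χ) S.uE f = f) (hb : b ∈ S.Hset)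
    (hI : b ∈ S.IK1) : sg (psRep hK1 χ) S.uE (sg (psRep hK1 χ) b f) = sg (psRep hK1 χ) b f := by
  have hb' : b⁻¹ ∈ S.Hset := by
    obtain ⟨a, b, ha, hb, rfl⟩ := exists_hE hb
    rw [hE_inv]; exact hE_mem _ _ _ _
  obtain ⟨t, -, ht⟩ := H_conj_uE hqp hb' (IK1_inv hI)
  obtain ⟨n0, hn0, e⟩ := ht 1
  have hn := Nk_sub_Kone1 hn0
  have e2 : S.uE * b = b * (S.uE ^ (t * 1) * n0) := by
    rw [pow_one] at e
    calc _ = b * (b⁻¹ * S.uE) * b := by group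
      _ = _ := by rw [e]; group
  rw [← sg_mul _ hK1 uE_K1 hI.1, e2, sg_mul _ hK1 hI.1 (K1_mul (uE_pow_K1 _) (Kone1_sub_K1 hn)),
    sg_mul _ hK1 (uE_pow_K1 _) (Kone1_sub_K1 hn), ps_one hK1 _ hn, fix_pow hK1 hf]

lemma psVal_beta_uE_beta (hK1 : (C.K : Set S.GG) = S.K1set) (hf : sg (psRep hK1 χ) S.uE f = f) (hqp : S.q = S.p) {m : ℕ}
    (hm : ¬ S.p ∣ m) :
    psVal (S.betaPr * S.uE ^ m * S.betaPr) f = χ (S.dd (-(m * S.tz)⁻¹)) * psVal S.betaPr f := by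
  obtain ⟨n, hn, e⟩ := beta_uE_beta_bruhat (S := S) hm
  have hv : S.IsVal 0 ((m : S.E) * S.tz) := by simpa using (isVal_natCast hm).mul isVal_tz
  have hD := dd_mem (S := S) (z := -(m * S.tz)⁻¹) (by simpa using hv.inv.neg)
  rw [e, ← psVal_sg hK1 (K1_mul (K1_mul (Nk_K1 hn) hD.2.1) betaPr_mem) (Nk_K1 hn),
    fix_N hK1 hqp (ps_one hK1) hf hn, mul_assoc,
    psVal_I1 hK1 (Nk_sub_I1 hn) (K1_mul hD.2.1 betaPr_mem), psVal_H hK1 hD.1 hD.2 betaPr_mem]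

lemma psVal_psi (hK1 : (C.K : Set S.GG) = S.K1set) (hg : g ∈ S.K1set) : psVal g (psi (psRep hK1 χ) f) =
    ∑ a ∈ Finset.range S.p, psVal (g * S.uE ^ a * S.betaPr) f := by
  rw [psi, map_sum]
  refine Finset.sum_congr rfl fun a _ => ?_
  rw [psVal_sg hK1 hg (uE_pow_K1 a), psVal_sg hK1 (K1_mul hg (uE_pow_K1 a)) betaPr_mem]

lemma psVal_psi_beta (hK1 : (C.K : Set S.GG) = S.K1set) (hf : sg (psRep hK1 χ) S.uE f = f) (hqp : S.q = S.p) :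
    psVal S.betaPr (psi (psRep hK1 χ) f) = psVal 1 f +
      (∑ a ∈ Finset.Ico 1 S.p, χ (S.dd (-(a * S.tz)⁻¹))) * psVal S.betaPr f := by
  rw [psVal_psi hK1 betaPr_mem, Finset.sum_range_eq_add_Ico _ S.hp.pos, pow_zero, mul_one,
    betaPr_mul_self, Finset.sum_mul]
  congr 1
  refine Finset.sum_congr rfl fun a ha => ?_
  rw [psVal_beta_uE_beta hK1 hf hqp (not_dvd_of_mem_Ico ha)]

lemma psVal_psi_one [CharP 𝔽 S.p] (hK1 : (C.K : Set S.GG) = S.K1set) : psVal 1 (psi (psRep hK1 χ) f) = 0 := by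
  rw [psVal_psi hK1 one_K1]
  have e : ∀ a ∈ Finset.range S.p, psVal (1 * S.uE ^ a * S.betaPr) f = psVal S.betaPr f := by
    intro a _
    rw [one_mul, psVal_I1 hK1 (Nk_sub_I1 (uE_pow_mem a)) betaPr_mem]
  rw [Finset.sum_congr rfl e, Finset.sum_const, Finset.card_range, ← Nat.cast_smul_eq_nsmul 𝔽,
    CharP.cast_eq_zero, zero_smul]

lemma Setting.RegChar.sum_inv (hqp : S.q = S.p) (hχ : RegChar χ) :
    ∑ a ∈ Finset.Ico 1 S.p, χ (S.dd (-(a * S.tz)⁻¹)) = 0 := by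
  rw [← hχ.beta.sum hqp isVal_tz]
  refine Finset.sum_congr rfl fun a ha => ?_
  have hv : S.IsVal 0 ((a : S.E) * S.tz) := by
    simpa using (isVal_natCast (not_dvd_of_mem_Ico ha)).mul isVal_tz
  rw [beta_dd_beta hv.1, map_mul, conj_natCast, conj_tz]
  congr 2
  field_simp

/-- A nonzero invariant subspace of a regular principal series contains a vector generating
the representation `σ^s`. -/
lemma exists_kvec_ps [CharP 𝔽 S.p] (hK1 : (C.K : Set S.GG) = S.K1set) (hqp : S.q = S.p) (hχ : RegChar χ)
    {Ws : Submodule 𝔽 ↥(PSchiSub C 𝔽 χ)} (hW : ∀ k, ∀ f ∈ Ws, psRep hK1 χ k f ∈ Ws)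
    (hne : Ws ≠ ⊥) : ∃ w ∈ Ws, w ≠ 0 ∧
      KVec (psRep hK1 χ) (fun h => χ (S.betaPr * h * S.betaPr)) w ∧ psi (psRep hK1 χ) w = 0 := by
  have : Fact S.p.Prime := ⟨S.hp⟩
  have hW' : ∀ k ∈ S.K1set, ∀ f ∈ Ws, sg (psRep hK1 χ) k f ∈ Ws := fun k hk f hf => by
    rw [sg_eq _ ((mem_K_iff hK1).2 hk)]; exact hW _ f hf
  obtain ⟨s, hs, hs0⟩ := Ws.ne_bot_iff.1 hne
  have hup : (sg (psRep hK1 χ) S.uE ^ S.p) s = s := by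
    have e : sg (psRep hK1 χ) S.uE ^ S.p = sg (psRep hK1 χ) (S.uE ^ S.p) := by
      rw [sg_eq _ ((mem_K_iff hK1).2 uE_K1), ← map_pow,
        sg_eq _ ((mem_K_iff hK1).2 (uE_pow_K1 _))]
      rfl
    rw [e, ps_one hK1 _ (Nk_sub_Kone1 uE_pow_p_mem)]
  obtain ⟨f₁, hf₁, hf0, hu⟩ := exists_fixed_of_pow (fun x hx => hW' _ uE_K1 x hx) hs hs0 hup
  obtain ⟨f, hfW, hfu, hfβ⟩ : ∃ f ∈ Ws, sg (psRep hK1 χ) S.uE f = f ∧ psVal S.betaPr f ≠ 0 := by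
    by_cases hβ : psVal S.betaPr f₁ = 0
    · refine ⟨psi (psRep hK1 χ) f₁,
        Ws.sum_mem fun a _ => hW' _ (uE_pow_K1 a) _ (hW' _ betaPr_mem _ hf₁),
        psi_translate hK1 hqp (ps_one hK1), ?_⟩
      rw [psVal_psi_beta hK1 hu hqp, hβ, mul_zero, add_zero]
      exact fun h1 => hf0 (ps_eq_zero hK1 hqp hu h1 hβ)
    · exact ⟨_, hf₁, hu, hβ⟩
  have hcomm : ∀ {t : S.GG}, S.betaPr * t = S.betaPr * t * S.betaPr * S.betaPr := fun {t} => by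
    rw [mul_assoc _ S.betaPr, betaPr_mul_self, mul_one]
  have hbI : ∀ {t : S.GG}, t ∈ S.Hset → t ∈ S.IK1 → S.betaPr * t * S.betaPr ∈ S.IK1 :=
    fun ht ht' => Hset_K1_IK1 (beta_Hset ht) (K1_mul (K1_mul betaPr_mem ht'.1) betaPr_mem)
  have val1 : ∀ {t : S.GG}, t ∈ S.Hset → t ∈ S.IK1 → ∀ f : ↥(PSchiSub C 𝔽 χ),
      psVal 1 (sg (psRep hK1 χ) t f) = χ t * psVal 1 f := by
    intro t ht hI f
    rw [psVal_sg hK1 one_K1 hI.1, one_mul, ← psVal_H hK1 ht hI one_K1, mul_one]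
  have valβ : ∀ {t : S.GG}, t ∈ S.Hset → t ∈ S.IK1 → ∀ f : ↥(PSchiSub C 𝔽 χ),
      psVal S.betaPr (sg (psRep hK1 χ) t f) =
        χ (S.betaPr * t * S.betaPr) * psVal S.betaPr f := by
    intro t ht hI f
    rw [psVal_sg hK1 betaPr_mem hI.1, ← psVal_H hK1 (beta_Hset ht) (hbI ht hI) betaPr_mem, ← hcomm]
  obtain ⟨h, hh, hI, hne⟩ := hχ.reg
  set w := sg (psRep hK1 χ) h f - χ h • f with hw
  have hwu : sg (psRep hK1 χ) S.uE w = w := by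
    rw [hw, map_sub, map_smul, hfu, ps_fix_H hK1 hqp hfu hh hI]
  have hw1 : psVal 1 w = 0 := by
    rw [hw, map_sub, map_smul, val1 hh hI, smul_eq_mul, sub_self]
  have hwβ : psVal S.betaPr w ≠ 0 := by
    rw [hw, map_sub, map_smul, valβ hh hI, smul_eq_mul, ← sub_mul]
    exact mul_ne_zero (sub_ne_zero.2 hne.symm) hfβ
  refine ⟨w, Ws.sub_mem (hW' _ hI.1 _ hfW) (Ws.smul_mem _ hfW), ?_, ⟨ps_one hK1, hwu, ?_⟩, ?_⟩
  · rintro h0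
    rw [h0, map_zero] at hwβ
    exact hwβ rfl
  · intro t ht hI
    refine ps_ext hK1 hqp (ps_fix_H hK1 hqp hwu ht hI) (by rw [map_smul, hwu]) ?_ ?_
    · rw [val1 ht hI, map_smul, hw1, mul_zero, smul_zero]
    · rw [valβ ht hI, map_smul, smul_eq_mul]
  · refine ps_eq_zero hK1 hqp (psi_translate hK1 hqp (ps_one hK1)) (psVal_psi_one hK1) ?_
    rw [psVal_psi_beta hK1 hwu hqp, hw1, hχ.sum_inv hqp, zero_mul, zero_add]

end PrincipalSeries

section Comparison

variable {𝔽 : Type} [Field 𝔽] {Γ : Type} [Group Γ] {V₁ V₂ : Type} [AddCommGroup V₁] [Module 𝔽 V₁]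
  [AddCommGroup V₂] [Module 𝔽 V₂] {ρ₁ : Representation 𝔽 Γ V₁} {ρ₂ : Representation 𝔽 Γ V₂}
  {p : ℕ} {u β : Γ} {I : Set Γ} {v₁ : V₁} {v₂ : V₂}

lemma orbitSpan_stable {V : Type} [AddCommGroup V] [Module 𝔽 V] {ρ : Representation 𝔽 Γ V} {v : V}
    (k : Γ) : ∀ x ∈ orbitSpan 𝔽 ρ v, ρ k x ∈ orbitSpan 𝔽 ρ v := by
  intro x hx
  refine Submodule.span_induction (p := fun x _ => ρ k x ∈ orbitSpan 𝔽 ρ v) ?_ ?_ ?_ ?_ hx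
  · rintro _ ⟨g, rfl⟩
    exact Submodule.subset_span ⟨k * g, by rw [map_mul, Module.End.mul_apply]⟩
  · simp
  · intro x y _ _ h h'; rw [map_add]; exact Submodule.add_mem _ h h'
  · intro c x _ h; rw [map_smul]; exact Submodule.smul_mem _ _ h

lemma self_mem_orbitSpan {V : Type} [AddCommGroup V] [Module 𝔽 V] {ρ : Representation 𝔽 Γ V} {v : V} :
    v ∈ orbitSpan 𝔽 ρ v := Submodule.subset_span ⟨1, by simp⟩

lemma map_orbitSpan {V V' : Type} [AddCommGroup V] [Module 𝔽 V] [AddCommGroup V'] [Module 𝔽 V']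
    {ρ : Representation 𝔽 Γ V} {ρ' : Representation 𝔽 Γ V'} (φ : V →ₗ[𝔽] V')
    (hφ : ∀ g x, φ (ρ g x) = ρ' g (φ x)) (v : V) :
    (orbitSpan 𝔽 ρ v).map φ = orbitSpan 𝔽 ρ' (φ v) := by
  rw [orbitSpan, orbitSpan, Submodule.map_span]
  congr 1
  ext w
  constructor
  · rintro ⟨_, ⟨g, rfl⟩, rfl⟩
    exact ⟨g, hφ g v⟩
  · rintro ⟨g, rfl⟩
    exact ⟨_, ⟨g, rfl⟩, hφ g v⟩

/-- The projection of the cyclic module generated by a special vector onto its image under an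
equivariant map not killing the vector is an isomorphism. -/
lemma Special.exists_equiv {V V' : Type} [AddCommGroup V] [Module 𝔽 V] [AddCommGroup V']
    [Module 𝔽 V'] [Fact p.Prime] [CharP 𝔽 p]
    {ρ : Representation 𝔽 Γ V} {ρ' : Representation 𝔽 Γ V'} {v : V} (h : Special ρ p u β I v)
    (φ : V →ₗ[𝔽] V') (hφ : ∀ g x, φ (ρ g x) = ρ' g (φ x)) {v' : V'} (hφv : φ v = v')
    (hv : v' ≠ 0) :
    ∃ e : ↥(orbitSpan 𝔽 ρ v) ≃ₗ[𝔽] ↥(orbitSpan 𝔽 ρ' v'), ∀ x, (e x : V') = φ x := by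
  subst hφv
  have hm := map_orbitSpan φ hφ v
  have hinj : ∀ x ∈ orbitSpan 𝔽 ρ v, φ x = 0 → x = 0 := by
    by_contra hc
    push Not at hc
    obtain ⟨x, hx, hx0, hne⟩ := hc
    have := h.mem_of_stable (S0 := orbitSpan 𝔽 ρ v ⊓ LinearMap.ker φ)
      (fun h0 => hv (by rw [h0, map_zero])) inf_le_left
      (fun y hy => ⟨orbitSpan_stable _ _ hy.1, by
        have := LinearMap.mem_ker.1 hy.2
        exact LinearMap.mem_ker.2 (by rw [hφ, this, map_zero])⟩)
      ((Submodule.ne_bot_iff _).2 ⟨x, ⟨hx, hx0⟩, hne⟩)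
    exact hv this.2
  let ψ : ↥(orbitSpan 𝔽 ρ v) →ₗ[𝔽] ↥(orbitSpan 𝔽 ρ' (φ v)) :=
    φ.restrict fun x hx => hm ▸ Submodule.mem_map_of_mem hx
  refine ⟨LinearEquiv.ofBijective ψ ⟨?_, ?_⟩, fun x => rfl⟩
  · refine (injective_iff_map_eq_zero ψ).2 fun x hx => Subtype.ext (hinj x x.2 ?_)
    exact congrArg Subtype.val hx
  · rintro ⟨y, hy⟩
    obtain ⟨x, hx, rfl⟩ : y ∈ (orbitSpan 𝔽 ρ v).map φ := by rwa [hm]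
    exact ⟨⟨x, hx⟩, rfl⟩

/-- Two vectors whose diagonal is special generate isomorphic representations. -/
lemma Special.exists_orbitSpan_equiv [Fact p.Prime] [CharP 𝔽 p]
    (h : Special (ρ₁.prod ρ₂) p u β I (v₁, v₂)) (h₁ : v₁ ≠ 0) (h₂ : v₂ ≠ 0) :
    ∃ e : ↥(orbitSpan 𝔽 ρ₁ v₁) ≃ₗ[𝔽] ↥(orbitSpan 𝔽 ρ₂ v₂),
      ∀ (k : Γ) (x x' : ↥(orbitSpan 𝔽 ρ₁ v₁)), (x' : V₁) = ρ₁ k x → (e x' : V₂) = ρ₂ k (e x) := by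
  obtain ⟨e₁, he₁⟩ := h.exists_equiv (ρ' := ρ₁) (v' := v₁) (LinearMap.fst 𝔽 V₁ V₂) (fun _ _ => rfl) rfl h₁
  obtain ⟨e₂, he₂⟩ := h.exists_equiv (ρ' := ρ₂) (v' := v₂) (LinearMap.snd 𝔽 V₁ V₂) (fun _ _ => rfl) rfl h₂
  refine ⟨e₁.symm.trans e₂, fun k x x' hx => ?_⟩
  obtain ⟨y, rfl⟩ := e₁.surjective x
  have hy' : x' = e₁ ⟨(ρ₁.prod ρ₂) k y, orbitSpan_stable k (y : V₁ × V₂) y.2⟩ := by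
    apply Subtype.ext
    rw [hx, he₁, he₁]
    rfl
  subst hy'
  rw [LinearEquiv.trans_apply, LinearEquiv.trans_apply, LinearEquiv.symm_apply_apply,
    LinearEquiv.symm_apply_apply, he₂, he₂]
  rfl

end Comparison

section KProd

variable {S : Setting} {C : Chamber S} {𝔽 : Type} [Field 𝔽] {V₁ V₂ : Type}
  [AddCommGroup V₁] [Module 𝔽 V₁] [AddCommGroup V₂] [Module 𝔽 V₂]
  {ρ₁ : Representation 𝔽 ↥C.K V₁} {ρ₂ : Representation 𝔽 ↥C.K V₂} {χ : S.GG → 𝔽}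
  {v₁ : V₁} {v₂ : V₂}

lemma sg_prod (g : S.GG) (v₁ : V₁) (v₂ : V₂) :
    sg (ρ₁.prod ρ₂) g (v₁, v₂) = (sg ρ₁ g v₁, sg ρ₂ g v₂) := by
  by_cases h : g ∈ C.K
  · rw [sg_eq _ h, sg_eq _ h, sg_eq _ h]; rfl
  · simp only [sg, sigma', dif_neg h, Module.End.one_apply]

lemma KVec.prod (h₁ : KVec ρ₁ χ v₁) (h₂ : KVec ρ₂ χ v₂) : KVec (ρ₁.prod ρ₂) χ (v₁, v₂) where
  one z hz := by rw [sg_prod, h₁.one z hz, h₂.one z hz]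
  fix := by rw [sg_prod, h₁.fix, h₂.fix]
  eig t ht hI := by rw [sg_prod, h₁.eig t ht hI, h₂.eig t ht hI]; rfl

lemma psi_prod : psi (ρ₁.prod ρ₂) (v₁, v₂) = (psi ρ₁ v₁, psi ρ₂ v₂) := by
  simp only [psi, sg_prod]
  exact Prod.ext (by simp [Prod.fst_sum]) (by simp [Prod.snd_sum])

end KProd

end U21

namespace U21

/-- Suppose `K = K₁`, `q = p`, `σ` a weight with `χ_σ ≠ χ_σ^s`, and let
`σ^s` be the unique irreducible subrepresentation `Ws` of `Ind_𝔹^{Γ_K} χ_σ`.  Then the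
image of `f₁` in `(ind_K^G σ)/(T)` is nonzero and the `K`-subrepresentation it generates
is isomorphic to `σ^s`. -/
theorem stmt3
    (S : Setting) (C : Chamber S)
    (hK1 : (C.K : Set S.GG) = S.K1set) (hqp : S.q = S.p)
    (𝔽 : Type) [Field 𝔽] [IsAlgClosed 𝔽] [Algebra (ZMod S.p) 𝔽]
    [Algebra.IsAlgebraic (ZMod S.p) 𝔽]
    (W : Type) [AddCommGroup W] [Module 𝔽 W]
    (σ : Representation 𝔽 ↥C.K W) (hσ : IsWeight C 𝔽 W σ)
    (v0 : W) (hv0 : v0 ≠ 0) (hv0inv : ∀ g ∈ C.I1, sigma' C 𝔽 W σ g v0 = v0)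
    (χ : S.GG → 𝔽) (hχ : IsChi C 𝔽 W σ v0 χ)
    (hreg : ∃ h ∈ C.H0, χ h ≠ χ (C.βK * h * C.βK))
    (jσ : W →ₗ[𝔽] W) (hj : IsJ C 𝔽 W σ jσ)
    (T : Module.End 𝔽 ↥(IndSub C 𝔽 W σ)) (hT : IsHeckeT C 𝔽 W σ jσ T)
    (ff : ℤ → ↥(IndSub C 𝔽 W σ)) (hff : IsFFamily C 𝔽 W σ v0 ff)
    (Ws : Submodule 𝔽 ↥(PSchiSub C 𝔽 χ))
    (hWsInvt : ∀ (k : ↥C.K) (f f' : ↥(PSchiSub C 𝔽 χ)),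
        (f' : ↥C.K → 𝔽) = PSact C 𝔽 k (f : ↥C.K → 𝔽) → f ∈ Ws → f' ∈ Ws)
    (hWsne : Ws ≠ ⊥)
    (hWsirr : ∀ Ssub : Submodule 𝔽 ↥(PSchiSub C 𝔽 χ), Ssub ≤ Ws →
        (∀ (k : ↥C.K) (f f' : ↥(PSchiSub C 𝔽 χ)),
          (f' : ↥C.K → 𝔽) = PSact C 𝔽 k (f : ↥C.K → 𝔽) → f ∈ Ssub → f' ∈ Ssub) →
        Ssub = ⊥ ∨ Ssub = Ws) :
    ff 1 ∉ LinearMap.range T ∧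
    ∃ e : ↥(genQuot C 𝔽 W σ T (ff 1)) ≃ₗ[𝔽] ↥Ws,
      ∀ (k : ↥C.K) (x x' : ↥(genQuot C 𝔽 W σ T (ff 1))),
        (∀ y : ↥(IndSub C 𝔽 W σ),
          (Submodule.Quotient.mk y : _ ⧸ LinearMap.range T) = ↑x →
          (Submodule.Quotient.mk (indRep C 𝔽 W σ ↑k y) : _ ⧸ LinearMap.range T) = ↑x') →
        ((e x' : ↥(PSchiSub C 𝔽 χ)) : ↥C.K → 𝔽) =
          PSact C 𝔽 k ((e x : ↥(PSchiSub C 𝔽 χ)) : ↥C.K → 𝔽) := by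
  have hp : Fact S.p.Prime := ⟨S.hp⟩
  have hchar : CharP 𝔽 S.p :=
    charP_of_injective_algebraMap (FaithfulSMul.algebraMap_injective (ZMod S.p) 𝔽) S.p
  have D : WeightData C σ v0 χ jσ := ⟨hK1, hqp, hσ, hv0, hv0inv, hχ, hreg, hj⟩
  have hf := isFirst_ff hK1 hff
  have hnot := D.notMem_range hT hf
  obtain ⟨w, hw, hw0, hwk, hwpsi⟩ := exists_kvec_ps hK1 hqp D.regChar
    (fun k f hf => hWsInvt k f _ rfl hf) hWsne
  have hsp := ((D.quot_kvec hT hf).prod hwk).special hK1 hqp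
    (by rw [psi_prod, D.quot_psi hT hf, hwpsi]; rfl)
  obtain ⟨e, he⟩ := hsp.exists_orbitSpan_equiv
    (fun h => hnot ((Submodule.Quotient.mk_eq_zero _).1 h)) hw0
  have hgen : genQuot C 𝔽 W σ T (ff 1) =
      orbitSpan 𝔽 (quotRep hT) (Submodule.Quotient.mk (ff 1)) := by
    rw [genQuot, orbitSpan]
    congr 1
    ext x
    exact ⟨fun ⟨k, hk, h⟩ => ⟨⟨k, hk⟩, h⟩, fun ⟨k, h⟩ => ⟨k, k.2, h⟩⟩
  have hWs : orbitSpan 𝔽 (psRep hK1 χ) w = Ws := by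
    refine (hWsirr _ ?_ ?_).resolve_left ?_
    · rw [orbitSpan, Submodule.span_le]
      rintro _ ⟨k, rfl⟩
      exact hWsInvt k w _ rfl hw
    · intro k f f' hf' hmem
      have : f' = psRep hK1 χ k f := Subtype.ext hf'
      rw [this]
      exact orbitSpan_stable k f hmem
    · exact (Submodule.ne_bot_iff _).2 ⟨w, self_mem_orbitSpan, hw0⟩
  refine ⟨hnot, (LinearEquiv.ofEq _ _ hgen).trans (e.trans (LinearEquiv.ofEq _ _ hWs)),
    fun k x x' hx => ?_⟩
  obtain ⟨y, hy⟩ := Submodule.Quotient.mk_surjective _ (x : _ ⧸ LinearMap.range T)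
  have h := he k (LinearEquiv.ofEq _ _ hgen x) (LinearEquiv.ofEq _ _ hgen x') (by
    rw [LinearEquiv.coe_ofEq_apply, LinearEquiv.coe_ofEq_apply, ← hx y hy, ← hy, quotRep_mk])
  exact congrArg Subtype.val h

end U21
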